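/- Projective degrees for Gorenstein ideals of height three: assume (i) ht(I) = 3 and there is an exact sequence of graded R-modules 0 → R(−2δ−D) → R(−δ−D)^{n+1} →^φ R(−δ)^{n+1} → I → 0 in which φ is given by an alternating matrix (φ^T = −φ) all of whose nonzero entries are homogeneous of degree D ≥ 1 (so I is a Gorenstein ideal of height three whose alternating minimal presentation matrix has all nonzero entries of degree D), and (ii) I satisfies the condition G_{d+1}. Then the projective degrees of F : ℙ^d_k ⇢ ℙ^n_k are d_i(F) = D^{d−i} · ∑_{k=0}^{⌊(n−d+i)/2⌋} binom(n−1−2k, d−i−1) for 0 ≤ i ≤ d−3, and d_i(F) = δ^{d−i} for d−2 ≤ i ≤ d. -/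

import Mathlib

section

variable {d : ℕ} (k : Type) [Field k]

/-- The bigraded Hilbert function of the Rees algebra of `I = (f₀,…,f_n)`:
`H(j,q) = dim_k [I^q]_{j+qδ}`. -/
noncomputable def reesHilbFn {n : ℕ} (δ : ℕ)
    (f : Fin (n + 1) → MvPolynomial (Fin (d + 1)) k) (j q : ℕ) : ℕ :=
  Module.finrank k
    ↥(((Ideal.span (Set.range f)) ^ q).restrictScalars k ⊓
      MvPolynomial.homogeneousSubmodule (Fin (d + 1)) k (j + q * δ))

/-- `P ∈ ℚ[u,v]` agrees with the bigraded function `H` for all `(j,q) ≫ (0,0)`. -/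
def IsBigradedHilbPoly (H : ℕ → ℕ → ℕ) (P : MvPolynomial (Fin 2) ℚ) : Prop :=
  ∃ j₀ q₀ : ℕ, ∀ j q : ℕ, j₀ ≤ j → q₀ ≤ q →
    MvPolynomial.eval ![(j : ℚ), (q : ℚ)] P = (H j q : ℚ)

/-- The `i`-th projective degree `d_i(F) = i!(d−i)!` times the coefficient of
`u^i v^{d-i}` in the bigraded Hilbert polynomial `P` of the Rees algebra. -/
noncomputable def projDeg (d : ℕ) (P : MvPolynomial (Fin 2) ℚ) (i : ℕ) : ℚ :=
  ((Nat.factorial i : ℚ) * (Nat.factorial (d - i) : ℚ)) *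
    MvPolynomial.coeff (Finsupp.single (0 : Fin 2) i + Finsupp.single (1 : Fin 2) (d - i)) P

/-- The height of an ideal: the infimum of the heights of the primes containing it. -/
noncomputable def idealHeight {R : Type} [CommRing R] (I : Ideal R) : ℕ∞ :=
  ⨅ (p : PrimeSpectrum R) (_ : I ≤ p.asIdeal), Order.height p

/-- The minimal number of generators of an ideal. -/
noncomputable def minGens {R : Type} [CommRing R] (I : Ideal R) : ℕ∞ :=
  ⨅ (s : Finset R) (_ : Ideal.span (s : Set R) = I), (s.card : ℕ∞)

/-- The condition `G_s`: `μ(I_𝔭) ≤ ht 𝔭` for every prime `𝔭 ⊇ I` with `ht 𝔭 < s`. -/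
def CondG (s : ℕ) {R : Type} [CommRing R] (I : Ideal R) : Prop :=
  ∀ p : PrimeSpectrum R, I ≤ p.asIdeal → Order.height p < (s : ℕ∞) →
    minGens (I.map (algebraMap R (Localization.AtPrime p.asIdeal))) ≤ Order.height p

end

/-! ### Dimensions of images in quotients -/

section QuotientDimension

variable {k E E' : Type*} [Field k] [AddCommGroup E] [Module k E] [AddCommGroup E'] [Module k E']

/-- The dimension of the image of `V` in `E ⧸ W`. -/
noncomputable def qdim (W V : Submodule k E) : ℕ := Module.finrank k (V.map W.mkQ)

theorem qdim_add_finrank_inf (W V : Submodule k E) [FiniteDimensional k V] :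
    qdim W V + Module.finrank k ↥(V ⊓ W) = Module.finrank k V := by
  have h := LinearMap.finrank_range_add_finrank_ker (W.mkQ.comp V.subtype)
  have h1 : LinearMap.range (W.mkQ.comp V.subtype) = V.map W.mkQ := by
    rw [LinearMap.range_comp, Submodule.range_subtype]
  have h2 : (LinearMap.ker (W.mkQ.comp V.subtype)).map V.subtype = V ⊓ W := by
    rw [LinearMap.ker_comp, Submodule.ker_mkQ, Submodule.map_comap_subtype]
  rw [h1] at h
  rw [← h, ← h2, qdim, Submodule.finrank_map_subtype_eq]

theorem qdim_le_finrank (W V : Submodule k E) [FiniteDimensional k V] :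
    qdim W V ≤ Module.finrank k V := by
  have := qdim_add_finrank_inf W V
  omega

/-- A subspace of `V` complementary to `V ⊓ W` has dimension `qdim W V`. -/
theorem exists_disjoint_finrank_eq_qdim (W V : Submodule k E) :
    ∃ C ≤ V, Disjoint C W ∧ Module.finrank k C = qdim W V := by
  obtain ⟨C, hC⟩ := Submodule.exists_isCompl (W.comap V.subtype)
  refine ⟨C.map V.subtype, Submodule.map_subtype_le V C, ?_, ?_⟩
  · rw [Submodule.disjoint_def]
    rintro _ ⟨x, hx, rfl⟩ hxW
    have := (Submodule.disjoint_def.mp hC.disjoint) x hxW hx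
    simp [this]
  · rw [Submodule.finrank_map_subtype_eq, qdim]
    have h1 : LinearMap.range (W.mkQ.comp V.subtype) = V.map W.mkQ := by
      rw [LinearMap.range_comp, Submodule.range_subtype]
    rw [← h1, ← (LinearMap.quotKerEquivRange _).finrank_eq]
    have h2 : LinearMap.ker (W.mkQ.comp V.subtype) = W.comap V.subtype := by
      rw [LinearMap.ker_comp, Submodule.ker_mkQ]
    rw [h2]
    exact (Submodule.quotientEquivOfIsCompl _ C hC).finrank_eq.symm

/-- A family of maps that is jointly injective on a complement of `W` in `V`, modulo `W'`,
bounds a multiple of `qdim W V`. -/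
theorem card_mul_qdim_le {τ : Type*} [Fintype τ] (W V : Submodule k E) (W' V' : Submodule k E')
    [FiniteDimensional k V] [FiniteDimensional k V'] (L : τ → E →ₗ[k] E')
    (hL : ∀ t, ∀ x ∈ V, L t x ∈ V')
    (h : ∀ C ≤ V, Disjoint C W → ∀ r : τ → E, (∀ t, r t ∈ C) → ∑ t, L t (r t) ∈ W' → r = 0) :
    Fintype.card τ * qdim W V ≤ qdim W' V' := by
  obtain ⟨C, hCV, hCW, hC⟩ := exists_disjoint_finrank_eq_qdim W V
  have : FiniteDimensional k C := Submodule.finiteDimensional_of_le hCV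
  let Φ : (τ → C) →ₗ[k] E' ⧸ W' :=
    ∑ t, (W'.mkQ.comp ((L t).comp C.subtype)).comp (LinearMap.proj t)
  have hΦ : ∀ r, Φ r = W'.mkQ (∑ t, L t (r t)) := by
    intro r
    simp [Φ, LinearMap.sum_apply, map_sum]
  have hinj : Function.Injective Φ := by
    rw [← LinearMap.ker_eq_bot, LinearMap.ker_eq_bot']
    intro r hr
    rw [hΦ, Submodule.mkQ_apply, Submodule.Quotient.mk_eq_zero] at hr
    have := h C hCV hCW (fun t => (r t : E)) (fun t => (r t).2) hr
    ext t
    exact congrFun this t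
  have hrange : LinearMap.range Φ ≤ V'.map W'.mkQ := by
    rintro _ ⟨r, rfl⟩
    rw [hΦ]
    exact Submodule.mem_map_of_mem (Submodule.sum_mem _ fun t _ => hL t _ (hCV (r t).2))
  have h1 := Submodule.finrank_mono hrange
  rw [LinearMap.finrank_range_of_inj hinj, Module.finrank_pi_fintype] at h1
  simpa [hC, qdim] using h1

theorem qdim_le_qdim (W V : Submodule k E) (W' V' : Submodule k E')
    [FiniteDimensional k V] [FiniteDimensional k V'] (L : E →ₗ[k] E')
    (hL : ∀ x ∈ V, L x ∈ V') (h : ∀ x ∈ V, L x ∈ W' → x ∈ W) :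
    qdim W V ≤ qdim W' V' := by
  have := card_mul_qdim_le (τ := Unit) W V W' V' (fun _ => L) (fun _ => hL) ?_
  · simpa using this
  · intro C hCV hCW r hr hs
    ext t
    exact Submodule.disjoint_def.mp hCW _ (hr t)
      (h _ (hCV (hr t)) (by simpa using hs))

/-- If `V` is covered, modulo `W`, by images of `V₀` under maps sending `W₀` into `W`, then
`qdim W V` is at most the number of maps times `qdim W₀ V₀`. -/
theorem qdim_le_card_mul {τ : Type*} [Fintype τ] (W V : Submodule k E) (W₀ V₀ : Submodule k E')
    [FiniteDimensional k V₀] (M : τ → E' →ₗ[k] E) (hM : ∀ t, ∀ y ∈ W₀, M t y ∈ W)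
    (h : ∀ x ∈ V, ∃ r : τ → E', (∀ t, r t ∈ V₀) ∧ x - ∑ t, M t (r t) ∈ W) :
    qdim W V ≤ Fintype.card τ * qdim W₀ V₀ := by
  let Mq : τ → (E' ⧸ W₀) →ₗ[k] E ⧸ W := fun t => W₀.mapQ W (M t) (hM t)
  let Φ : (τ → V₀.map W₀.mkQ) →ₗ[k] E ⧸ W :=
    ∑ t, ((Mq t).comp (V₀.map W₀.mkQ).subtype).comp (LinearMap.proj t)
  have hle : V.map W.mkQ ≤ LinearMap.range Φ := by
    rintro _ ⟨x, hx, rfl⟩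
    obtain ⟨r, hr, hxr⟩ := h x hx
    refine ⟨fun t => ⟨W₀.mkQ (r t), Submodule.mem_map_of_mem (hr t)⟩, ?_⟩
    have : W.mkQ x = W.mkQ (∑ t, M t (r t)) := by
      rw [← sub_eq_zero, ← map_sub, Submodule.mkQ_apply, Submodule.Quotient.mk_eq_zero]
      exact hxr
    rw [this]
    simp [Φ, Mq, LinearMap.sum_apply, map_sum]
  have h1 := (Submodule.finrank_mono hle).trans (LinearMap.finrank_range_le Φ)
  rw [Module.finrank_pi_fintype] at h1
  simpa [qdim] using h1

end QuotientDimension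

/-! ### Growth of quotients of polynomial rings by primes of large height -/

section Growth

open MvPolynomial

theorem eq_zero_of_sum_pow_mul_mem {A : Type*} [CommRing A] {q p : Ideal A} [q.IsPrime]
    (hqp : q ≤ p) {f : A} (hfp : f ∈ p) (hfq : f ∉ q) {S : Set A}
    (hS : ∀ x ∈ S, x ∈ p → x = 0) :
    ∀ (m : ℕ) (r : Fin m → A), (∀ t, r t ∈ S) → ∑ t : Fin m, f ^ (t : ℕ) * r t ∈ q → r = 0
  | 0, r, _, _ => by ext t; exact t.elim0
  | m + 1, r, hr, h => by
    rw [Fin.sum_univ_succ] at h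
    have h1 : ∑ t : Fin m, f ^ ((t.succ : Fin (m + 1)) : ℕ) * r t.succ =
        f * ∑ t : Fin m, f ^ (t : ℕ) * r t.succ := by
      rw [Finset.mul_sum]
      exact Finset.sum_congr rfl fun t _ => by rw [Fin.val_succ, pow_succ]; ring
    rw [h1] at h
    have h0 : r 0 = 0 := by
      refine hS _ (hr 0) ?_
      have := p.sub_mem (hqp h) (p.mul_mem_right (∑ t : Fin m, f ^ (t : ℕ) * r t.succ) hfp)
      simpa using this
    rw [h0, mul_zero, zero_add] at h
    have ih := eq_zero_of_sum_pow_mul_mem hqp hfp hfq hS m (fun t => r t.succ)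
      (fun t => hr _) (((inferInstance : q.IsPrime).mem_or_mem h).resolve_left hfq)
    ext t
    refine Fin.cases h0 (fun t => ?_) t
    exact congrFun ih t

theorem exists_lt_height_of_add_one_le_height {α : Type*} [Preorder α] {a : α} {h : ℕ}
    (ha : ((h + 1 : ℕ) : ℕ∞) ≤ Order.height a) : ∃ b < a, (h : ℕ∞) ≤ Order.height b := by
  obtain ⟨s, hs, hl⟩ := Order.exists_series_of_le_height a ha
  refine ⟨s.eraseLast.last, ?_, ?_⟩
  · rw [← hs]
    exact s.eraseLast_last_rel_last (by omega)
  · have := Order.length_le_height_last (p := s.eraseLast)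
    simpa [hl] using this

variable {k : Type*} [Field k] {N : ℕ}

theorem finrank_restrictTotalDegree_le (j : ℕ) :
    Module.finrank k (restrictTotalDegree (Fin N) k j) ≤ (j + 1) ^ N := by
  let s : Set (Fin N →₀ ℕ) := { n | (n.sum fun _ e => e) ≤ j }
  let g : s → (Fin N → Fin (j + 1)) := fun n i => ⟨n.1 i, by
    have h1 : n.1 i ≤ n.1.sum fun _ e => e := by
      rcases eq_or_ne (n.1 i) 0 with h | h
      · omega
      · exact Finset.single_le_sum (f := fun i => n.1 i) (fun _ _ => Nat.zero_le _)
          (Finsupp.mem_support_iff.mpr h)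
    have := n.2
    simp only [s, Set.mem_ofPred_eq] at this
    omega⟩
  have hg : Function.Injective g := by
    intro a b hab
    apply Subtype.ext
    ext i
    exact congrArg Fin.val (congrFun hab i)
  have : Finite s := Finite.of_injective g hg
  have h1 := Module.finrank_eq_nat_card_basis (basisRestrictSupport k s)
  have h2 := Nat.card_le_card_of_injective g hg
  simp only [Nat.card_eq_fintype_card (α := Fin N → Fin (j+1)), Fintype.card_fun,
    Fintype.card_fin] at h2
  calc _ = Nat.card s := h1
    _ ≤ _ := h2

theorem exists_qdim_restrictTotalDegree_mul_le (h : ℕ) :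
    ∀ p : PrimeSpectrum (MvPolynomial (Fin N) k), (h : ℕ∞) ≤ Order.height p →
      ∃ C : ℕ, ∀ j : ℕ, qdim (p.asIdeal.restrictScalars k) (restrictTotalDegree (Fin N) k j) *
        (j + 1) ^ h ≤ C * (j + 1) ^ N := by
  induction h with
  | zero =>
    intro p _
    refine ⟨1, fun j => ?_⟩
    simpa using (qdim_le_finrank _ _).trans (finrank_restrictTotalDegree_le j)
  | succ h ih =>
    intro p hp
    obtain ⟨q, hqp, hq⟩ := exists_lt_height_of_add_one_le_height hp
    obtain ⟨C, hC⟩ := ih q hq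
    have hlt : q.asIdeal < p.asIdeal := hqp
    obtain ⟨f, hfp, hfq⟩ := SetLike.exists_of_lt hlt
    set e := f.totalDegree
    refine ⟨C * (e + 1) ^ N, fun j => ?_⟩
    have key := card_mul_qdim_le (τ := Fin (j + 1)) (p.asIdeal.restrictScalars k)
      (restrictTotalDegree (Fin N) k j) (q.asIdeal.restrictScalars k)
      (restrictTotalDegree (Fin N) k (j + j * e))
      (fun t => LinearMap.mulLeft k (f ^ (t : ℕ))) ?_ ?_
    · rw [Fintype.card_fin] at key
      set G := qdim (p.asIdeal.restrictScalars k) (restrictTotalDegree (Fin N) k j)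
      have h1 := hC (j + j * e)
      calc G * (j + 1) ^ (h + 1) = ((j + 1) * G) * (j + 1) ^ h := by ring
        _ ≤ qdim (q.asIdeal.restrictScalars k) (restrictTotalDegree (Fin N) k (j + j * e)) *
            (j + j * e + 1) ^ h := by gcongr; omega
        _ ≤ C * (j + j * e + 1) ^ N := h1
        _ ≤ C * ((e + 1) * (j + 1)) ^ N := by gcongr; nlinarith
        _ = C * (e + 1) ^ N * (j + 1) ^ N := by rw [mul_pow]; ring
    · intro t x hx
      rw [mem_restrictTotalDegree] at hx ⊢
      refine (totalDegree_mul _ _).trans ?_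
      have h1 : (f ^ (t : ℕ)).totalDegree ≤ t * e := totalDegree_pow _ _
      have h2 : (t : ℕ) * e ≤ j * e := Nat.mul_le_mul_right _ (by omega)
      omega
    · intro C' hC' hdisj r hr hsum
      exact eq_zero_of_sum_pow_mul_mem (q := q.asIdeal) (p := p.asIdeal) hlt.le hfp hfq
        (S := C') (fun x hx hxp => Submodule.disjoint_def.mp hdisj x hx hxp) _ r hr
        (by simpa using hsum)

theorem homogeneousSubmodule_le_restrictTotalDegree (i : ℕ) :
    homogeneousSubmodule (Fin N) k i ≤ restrictTotalDegree (Fin N) k i := by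
  intro x hx
  rw [mem_restrictTotalDegree]
  exact IsHomogeneous.totalDegree_le hx

instance finiteDimensional_homogeneousSubmodule (i : ℕ) :
    FiniteDimensional k (homogeneousSubmodule (Fin N) k i) :=
  Submodule.finiteDimensional_of_le (homogeneousSubmodule_le_restrictTotalDegree i)

/-- If a homogeneous prime of height at least `h` does not contain all the variables, the
Hilbert function of its quotient grows at most as `i ^ (N - 1 - h)`. -/
theorem exists_qdim_homogeneousSubmodule_mul_le (h : ℕ)
    (p : PrimeSpectrum (MvPolynomial (Fin N) k)) (hp : (h : ℕ∞) ≤ Order.height p)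
    (hhom : ∀ g ∈ p.asIdeal, ∀ i, homogeneousComponent i g ∈ p.asIdeal)
    (l : Fin N) (hl : X l ∉ p.asIdeal) :
    ∃ C : ℕ, ∀ i : ℕ, qdim (p.asIdeal.restrictScalars k) (homogeneousSubmodule (Fin N) k i) *
      (i + 1) ^ (h + 1) ≤ C * (i + 1) ^ N := by
  obtain ⟨C, hC⟩ := exists_qdim_restrictTotalDegree_mul_le h p hp
  refine ⟨C * 2 ^ N, fun i => ?_⟩
  have key := card_mul_qdim_le (τ := Fin (i + 1)) (p.asIdeal.restrictScalars k)
    (homogeneousSubmodule (Fin N) k i) (p.asIdeal.restrictScalars k)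
    (restrictTotalDegree (Fin N) k (2 * i))
    (fun t => LinearMap.mulLeft k (X l ^ (t : ℕ))) ?_ ?_
  · rw [Fintype.card_fin] at key
    set G := qdim (p.asIdeal.restrictScalars k) (homogeneousSubmodule (Fin N) k i)
    calc G * (i + 1) ^ (h + 1) = ((i + 1) * G) * (i + 1) ^ h := by ring
      _ ≤ qdim (p.asIdeal.restrictScalars k) (restrictTotalDegree (Fin N) k (2 * i)) *
          (2 * i + 1) ^ h := by gcongr; omega
      _ ≤ C * (2 * i + 1) ^ N := hC _
      _ ≤ C * (2 * (i + 1)) ^ N := by gcongr; omega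
      _ = C * 2 ^ N * (i + 1) ^ N := by rw [mul_pow]; ring
  · intro t x hx
    have h1 : (X l ^ (t : ℕ) * x : MvPolynomial (Fin N) k).IsHomogeneous (t + i) :=
      (isHomogeneous_X_pow l t).mul hx
    rw [mem_restrictTotalDegree]
    have := h1.totalDegree_le
    have := t.2
    simp only [LinearMap.mulLeft_apply]
    omega
  · intro C' hC' hdisj r hr hsum
    ext1 t
    refine Submodule.disjoint_def.mp hdisj _ (hr t) ?_
    have h1 := hhom _ hsum (t + i)
    have h2 : homogeneousComponent (t + i) (∑ s : Fin (i + 1),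
        LinearMap.mulLeft k (X l ^ (s : ℕ)) (r s)) = X l ^ (t : ℕ) * r t := by
      rw [map_sum, Finset.sum_eq_single t]
      · rw [LinearMap.mulLeft_apply,
          homogeneousComponent_of_mem ((isHomogeneous_X_pow l t).mul (hC' (hr t)))]
        simp
      · intro s _ hst
        rw [LinearMap.mulLeft_apply,
          homogeneousComponent_of_mem ((isHomogeneous_X_pow l s).mul (hC' (hr s)))]
        rw [if_neg]
        intro hh
        apply hst
        ext
        omega
      · simp
    rw [h2] at h1
    exact (p.2.mem_or_mem h1).resolve_left fun h => hl (p.2.mem_of_pow_mem _ h)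

end Growth

/-! ### The adjugate of the alternating matrix -/

section AlternatingAdjugate

open Matrix

variable {A : Type*} [CommRing A] {ι : Type*} [Fintype ι] [DecidableEq ι]

theorem mulVec_updateRow_add_single (φ : Matrix ι ι A) (i : ι) (v : ι → A) :
    (φ.updateRow i (φ i + Pi.single i 1)).mulVec v = φ.mulVec v + Pi.single i (v i) := by
  ext a
  by_cases h : a = i
  · subst h
    simp [Matrix.mulVec, dotProduct, add_mul, Finset.sum_add_distrib, Pi.single_apply]
  · simp [Matrix.mulVec, h]

variable [IsDomain A]

theorem not_dvd_det_updateRow {φ : Matrix ι ι A} {f w : ι → A}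
    (hfφ : ∀ u, ∑ j, φ.mulVec u j * f j = 0)
    (hker1 : ∀ v, φ.mulVec v = 0 → ∃ x : A, x • w = v)
    (hker2 : ∀ v : ι → A, ∑ j, v j * f j = 0 → ∃ u, φ.mulVec u = v)
    {x' : A} (hx' : f = x' • w) {π : A} (hπ : (Ideal.span {π}).IsPrime) {i : ι}
    (hi : ¬ π ∣ f i) : ¬ π ∣ (φ.updateRow i (φ i + Pi.single i 1)).det := by
  intro hdvd
  set ψ := φ.updateRow i (φ i + Pi.single i 1) with hψ
  let q := Ideal.Quotient.mk (Ideal.span {π})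
  have hq : ∀ a, q a = 0 ↔ π ∣ a := fun a => by
    rw [Ideal.Quotient.eq_zero_iff_mem, Ideal.mem_span_singleton]
  have hdom : IsDomain (A ⧸ Ideal.span {π}) := Ideal.Quotient.isDomain _
  have hprime : ∀ a b, π ∣ a * b → π ∣ a ∨ π ∣ b := fun a b => by
    simp only [← Ideal.mem_span_singleton]
    exact hπ.mem_or_mem
  have hdet : (ψ.map q).det = 0 := by
    have := RingHom.map_det q ψ
    rw [RingHom.mapMatrix_apply] at this
    rw [← this, hq]
    exact hdvd
  obtain ⟨vb, hvb, hvb0⟩ := Matrix.exists_mulVec_eq_zero_iff.mpr hdet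
  choose v hv using fun a => Ideal.Quotient.mk_surjective (I := Ideal.span {π}) (vb a)
  have hvq : vb = q ∘ v := funext fun a => (hv a).symm
  have h1 : ∀ a, π ∣ ψ.mulVec v a := by
    intro a
    rw [← hq, RingHom.map_mulVec]
    rw [hvq] at hvb0
    exact congrFun hvb0 a
  choose u hu using h1
  have h2 : ψ.mulVec v = φ.mulVec v + Pi.single i (v i) := mulVec_updateRow_add_single φ i v
  have h3 : v i * f i = π * ∑ a, u a * f a := by
    have h4 : ∑ a, ψ.mulVec v a * f a = v i * f i := by
      rw [h2]
      simp [add_mul, Finset.sum_add_distrib, hfφ, Pi.single_apply]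
    rw [← h4, Finset.mul_sum]
    exact Finset.sum_congr rfl fun a _ => by rw [hu]; ring
  obtain ⟨v', hv'⟩ := (hprime _ _ ⟨_, h3⟩).resolve_right hi
  set u' : ι → A := u - Pi.single i v'
  have h5 : φ.mulVec v = π • u' := by
    ext a
    have := congrFun h2 a
    rw [hu, hv'] at this
    by_cases ha : a = i
    · subst ha
      simp only [Pi.add_apply, Pi.single_eq_same] at this
      simp only [u', Pi.smul_apply, Pi.sub_apply, Pi.single_eq_same, smul_eq_mul, mul_sub]
      rw [this]; ring
    · simp only [Pi.add_apply, Pi.single_eq_of_ne ha] at this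
      simp only [u', Pi.smul_apply, Pi.sub_apply, Pi.single_eq_of_ne ha, smul_eq_mul]
      rw [sub_zero, this, add_zero]
  obtain ⟨t, ht⟩ : ∃ t, φ.mulVec v = φ.mulVec (π • t) := by
    by_cases h0 : π = 0
    · refine ⟨0, ?_⟩
      rw [h5, h0]
      simp
    · have h6 := hfφ v
      rw [h5] at h6
      have h7 : ∑ j, u' j * f j = 0 := by
        have : π * ∑ j, u' j * f j = 0 := by
          rw [Finset.mul_sum, ← h6]
          exact Finset.sum_congr rfl fun a _ => by simp [mul_assoc]
        exact (mul_eq_zero.mp this).resolve_left h0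
      obtain ⟨t, ht⟩ := hker2 u' h7
      exact ⟨t, by rw [h5, mulVec_smul, ht]⟩
  obtain ⟨x, hx⟩ := hker1 (v - π • t) (by rw [mulVec_sub, ht, sub_self])
  have hvx : ∀ a, v a = x * w a + π * t a := fun a => by
    have := congrFun hx a
    simp only [Pi.smul_apply, Pi.sub_apply, smul_eq_mul] at this
    rw [this]; ring
  have hxw : π ∣ x * w i := by
    have : x * w i = π * (v' - t i) := by
      have := hvx i
      rw [hv'] at this
      linear_combination -this
    exact ⟨_, this⟩
  have hxd : π ∣ x := by
    refine (hprime _ _ hxw).resolve_right fun h => hi ?_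
    rw [hx']
    exact h.mul_left _
  apply hvb
  rw [hvq]
  ext a
  simp only [Function.comp_apply, Pi.zero_apply]
  rw [hq, hvx a]
  exact (hxd.mul_right _).add (dvd_mul_right _ _)

theorem exists_adjugate_eq_unit_mul [UniqueFactorizationMonoid A] {φ : Matrix ι ι A}
    {f w : ι → A} (hφ : φ.transpose = -φ) (hf : ∃ i, f i ≠ 0)
    (hw : ∃ i, w i ≠ 0) (hφw : φ.mulVec w = 0)
    (hfφ : ∀ u, ∑ j, φ.mulVec u j * f j = 0)
    (hker1 : ∀ v, φ.mulVec v = 0 → ∃ x : A, x • w = v)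
    (hker2 : ∀ v : ι → A, ∑ j, v j * f j = 0 → ∃ u, φ.mulVec u = v)
    (hirr : ∀ π : A, Irreducible π → ∃ i, ¬ π ∣ f i) :
    ∃ z : A, IsUnit z ∧ ∀ a b, φ.adjugate a b = z * w b * w a := by
  have hneg : ∀ a b, φ b a = - φ a b := fun a b => congrFun (congrFun hφ a) b
  have hφf : φ.mulVec f = 0 := by
    ext b
    have h := hfφ (Pi.single b 1)
    simp only [mulVec_single_one, Matrix.col_apply] at h
    simp only [Matrix.mulVec, dotProduct, Pi.zero_apply]
    rw [← neg_eq_zero, ← Finset.sum_neg_distrib, ← h]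
    exact Finset.sum_congr rfl fun j _ => by rw [hneg b j]; ring
  obtain ⟨x', hx'⟩ := hker1 f hφf
  have hdet : φ.det = 0 := by
    rw [← Matrix.exists_mulVec_eq_zero_iff]
    refine ⟨w, ?_, hφw⟩
    obtain ⟨i, hi⟩ := hw
    exact fun h => hi (congrFun h i)
  have hcol : ∀ b, ∃ y : A, y • w = fun a => φ.adjugate a b := by
    intro b
    apply hker1
    ext c
    have := congrFun (congrFun (mul_adjugate φ) c) b
    rw [hdet, zero_smul] at this
    exact this
  choose y hy using hcol
  have hy' : ∀ a b, φ.adjugate a b = y b * w a := fun a b => (congrFun (hy b) a).symm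
  have hφy : φ.mulVec y = 0 := by
    obtain ⟨a, ha⟩ := hw
    ext c
    have := congrFun (congrFun (adjugate_mul φ) a) c
    rw [hdet, zero_smul, Matrix.mul_apply] at this
    simp only [hy', Matrix.zero_apply] at this
    have h2 : w a * ∑ b, φ c b * y b = 0 := by
      rw [← neg_eq_zero, ← this, Finset.mul_sum, ← Finset.sum_neg_distrib]
      exact Finset.sum_congr rfl fun b _ => by rw [hneg b c]; ring
    exact (mul_eq_zero.mp h2).resolve_left ha
  obtain ⟨z, hz⟩ := hker1 y hφy
  have hadj : ∀ a b, φ.adjugate a b = z * w b * w a := fun a b => by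
    rw [hy', ← hz]; rfl
  have hkey : ∀ π : A, (Ideal.span {π}).IsPrime → (∃ i, ¬ π ∣ f i) → ¬ π ∣ z := by
    rintro π hπ ⟨i, hi⟩ hdvd
    apply not_dvd_det_updateRow hfφ hker1 hker2 hx'.symm hπ hi
    rw [det_updateRow_add, updateRow_eq_self, hdet, zero_add, ← adjugate_apply, hadj]
    exact (hdvd.mul_right _).mul_right _
  refine ⟨z, ?_, hadj⟩
  have hz0 : z ≠ 0 := by
    have := hkey 0 (by simpa using Ideal.isPrime_bot) (by simpa using hf)
    simpa using this
  by_contra hu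
  obtain ⟨π, hπ, hd⟩ := WfDvdMonoid.exists_irreducible_factor hu hz0
  exact hkey π ((Ideal.span_singleton_prime hπ.ne_zero).mpr hπ.prime) (hirr π hπ) hd

open MvPolynomial in
theorem isHomogeneous_det {σ R : Type*} [CommRing R] {m D : ℕ}
    (M : Matrix (Fin m) (Fin m) (MvPolynomial σ R)) (hM : ∀ a b, (M a b).IsHomogeneous D) :
    M.det.IsHomogeneous (m * D) := by
  rw [Matrix.det_apply']
  refine MvPolynomial.IsHomogeneous.sum _ _ _ fun s _ => ?_
  rw [← zero_add (m * D)]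
  refine MvPolynomial.IsHomogeneous.mul ?_ ?_
  · rcases Int.units_eq_one_or (Equiv.Perm.sign s) with h | h
    · simpa [h] using isHomogeneous_one σ R
    · simpa [h] using (isHomogeneous_one σ R).neg
  · have := MvPolynomial.IsHomogeneous.prod Finset.univ (fun i => M (s i) i) (fun _ => D)
      fun i _ => hM _ _
    simpa using this

open MvPolynomial in
theorem two_mul_degree_eq {σ k : Type*} [Field k] {n δ D : ℕ}
    {φ : Matrix (Fin (n + 1)) (Fin (n + 1)) (MvPolynomial σ k)}
    {f w : Fin (n + 1) → MvPolynomial σ k} (hφ : φ.transpose = -φ) (hf : ∃ i, f i ≠ 0)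
    (hφdeg : ∀ a b, (φ a b).IsHomogeneous D) (hwdeg : ∀ a, (w a).IsHomogeneous δ)
    (hw : ∃ i, w i ≠ 0) (hφw : φ.mulVec w = 0)
    (hfφ : ∀ u, ∑ j, φ.mulVec u j * f j = 0)
    (hker1 : ∀ v, φ.mulVec v = 0 → ∃ x : MvPolynomial σ k, x • w = v)
    (hker2 : ∀ v : Fin (n + 1) → MvPolynomial σ k,
      ∑ j, v j * f j = 0 → ∃ u, φ.mulVec u = v)
    (hirr : ∀ π : MvPolynomial σ k, Irreducible π → ∃ i, ¬ π ∣ f i) :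
    2 * δ = n * D := by
  obtain ⟨z, hz, hadj⟩ := exists_adjugate_eq_unit_mul hφ hf hw hφw hfφ hker1 hker2 hirr
  obtain ⟨i, hi⟩ := hw
  have h1 : (φ.adjugate i i).IsHomogeneous (n * D) := by
    rw [Matrix.adjugate_fin_succ_eq_det_submatrix]
    rw [← zero_add (n * D)]
    refine MvPolynomial.IsHomogeneous.mul ?_ (isHomogeneous_det _ fun _ _ => hφdeg _ _)
    simpa using ((isHomogeneous_one σ k).neg).pow (i + i : ℕ)
  have h2 : (φ.adjugate i i).IsHomogeneous (2 * δ) := by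
    rw [hadj]
    obtain ⟨c, -, rfl⟩ := MvPolynomial.isUnit_iff_eq_C_of_isReduced.mp hz
    have := ((isHomogeneous_C σ c).mul (hwdeg i)).mul (hwdeg i)
    convert this using 1
    omega
  have h3 : φ.adjugate i i ≠ 0 := by
    rw [hadj]
    exact mul_ne_zero (mul_ne_zero hz.ne_zero hi) hi
  exact h2.inj_right h1 h3

end AlternatingAdjugate

/-! ### Growth of functions of a bidegree -/

section BidegreeGrowth

open Filter Asymptotics Topology

/-- Bidegrees, ordered lexicographically. -/
abbrev Bideg := ℤ ×ₗ ℤ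

/-- The filter of bidegrees with both entries tending to infinity. -/
noncomputable def bigBideg : Filter Bideg := (atTop : Filter (ℤ × ℤ)).map toLex

/-- The total degree of a bidegree. -/
def Bideg.total (g : Bideg) : ℚ := (ofLex g).1 + (ofLex g).2

open Bideg (total)

theorem eventually_bigBideg {p : Bideg → Prop} :
    (∀ᶠ g in bigBideg, p g) ↔ ∃ M : ℤ, ∀ j q : ℤ, M ≤ j → M ≤ q → p (toLex (j, q)) := by
  rw [bigBideg, eventually_map, eventually_atTop]
  constructor
  · rintro ⟨⟨a, b⟩, h⟩
    exact ⟨max a b, fun j q hj hq => h (j, q) ⟨(le_max_left _ _).trans hj, (le_max_right _ _).trans hq⟩⟩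
  · rintro ⟨M, h⟩
    exact ⟨(M, M), fun b hb => h b.1 b.2 hb.1 hb.2⟩

theorem tendsto_sub_bigBideg (s : Bideg) : Tendsto (fun g => g - s) bigBideg bigBideg := by
  intro U hU
  have hU' : ∀ᶠ g in bigBideg, g ∈ U := hU
  rw [eventually_bigBideg] at hU'
  obtain ⟨M, hM⟩ := hU'
  change ∀ᶠ g in bigBideg, g - s ∈ U
  rw [eventually_bigBideg]
  refine ⟨max (M + (ofLex s).1) (M + (ofLex s).2), fun j q hj hq => ?_⟩
  have := hM (j - (ofLex s).1) (q - (ofLex s).2) (by omega) (by omega)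
  exact this

theorem eventually_total_ge (c : ℚ) : ∀ᶠ g in bigBideg, c ≤ total g := by
  rw [eventually_bigBideg]
  refine ⟨max 0 ⌈c⌉, fun j q hj hq => ?_⟩
  have h1 : c ≤ j := (Int.le_ceil c).trans (by exact_mod_cast (le_max_right _ _).trans hj)
  have h2 : (0 : ℚ) ≤ q := by exact_mod_cast (le_max_left _ _).trans hq
  simp only [total, ofLex_toLex]
  linarith

theorem one_le_norm_of_one_le {x : ℚ} (hx : 1 ≤ x) : 1 ≤ ‖x‖ := by
  rw [← Rat.norm_cast_real, Real.norm_eq_abs]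
  exact le_trans (by exact_mod_cast hx) (le_abs_self _)

theorem one_isBigO_total : (fun _ : Bideg => (1 : ℚ)) =O[bigBideg] total := by
  refine IsBigO.of_bound 1 ?_
  filter_upwards [eventually_total_ge 1] with g hg
  rw [norm_one, one_mul]
  exact one_le_norm_of_one_le hg

theorem total_sub_isBigO (s : Bideg) : (fun g => total (g - s)) =O[bigBideg] total := by
  have : (fun g => total (g - s)) = fun g => total g - total s * 1 := by
    funext g
    simp [total]
    ring
  rw [this]
  exact (isBigO_refl _ _).sub (one_isBigO_total.const_mul_left _)

/-- `F` has growth of degree at most `e`. -/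
def GrowthLE (e : ℕ) (F : Bideg → ℚ) : Prop := F =O[bigBideg] fun g => total g ^ e

/-- `F` has growth of degree less than `e`. -/
def GrowthLT (e : ℕ) (F : Bideg → ℚ) : Prop :=
  (fun g => F g * total g) =O[bigBideg] fun g => total g ^ e

theorem GrowthLT.congr {e : ℕ} {F F' : Bideg → ℚ} (h : GrowthLT e F) (hF : F =ᶠ[bigBideg] F') :
    GrowthLT e F' :=
  IsBigO.congr' h (by filter_upwards [hF] with g hg; rw [hg]) EventuallyEq.rfl

theorem GrowthLT.add {e : ℕ} {F F' : Bideg → ℚ} (h : GrowthLT e F) (h' : GrowthLT e F') :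
    GrowthLT e (F + F') := by
  have := IsBigO.add h h'
  refine this.congr_left fun g => ?_
  simp [add_mul]

theorem GrowthLT.const_mul {e : ℕ} {F : Bideg → ℚ} (h : GrowthLT e F) (c : ℚ) :
    GrowthLT e (fun g => c * F g) := by
  have := IsBigO.const_mul_left h c
  refine this.congr_left fun g => ?_
  simp [mul_assoc]

theorem GrowthLT.neg {e : ℕ} {F : Bideg → ℚ} (h : GrowthLT e F) : GrowthLT e (-F) := by
  have := h.const_mul (-1)
  convert this using 1
  ext g; simp

theorem GrowthLT.sub {e : ℕ} {F F' : Bideg → ℚ} (h : GrowthLT e F) (h' : GrowthLT e F') :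
    GrowthLT e (F - F') := by
  rw [sub_eq_add_neg]; exact h.add h'.neg

theorem growthLT_zero (e : ℕ) : GrowthLT e 0 := by
  have : (fun _ : Bideg => (0 : ℚ)) =O[bigBideg] fun g => total g ^ e := isBigO_zero _ _
  refine this.congr_left fun g => by simp

theorem GrowthLT.sum {e : ℕ} {ι : Type*} (s : Finset ι) {F : ι → Bideg → ℚ}
    (h : ∀ i ∈ s, GrowthLT e (F i)) : GrowthLT e (∑ i ∈ s, F i) := by
  classical
  induction s using Finset.induction_on with
  | empty => simpa using growthLT_zero e
  | insert a s ha ih =>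
    rw [Finset.sum_insert ha]
    exact (h a (Finset.mem_insert_self _ _)).add
      (ih fun i hi => h i (Finset.mem_insert_of_mem hi))

theorem GrowthLT.shift {e : ℕ} {F : Bideg → ℚ} (h : GrowthLT e F) (s : Bideg) :
    GrowthLT e (fun g => F (g - s)) := by
  have h1 := IsBigO.comp_tendsto h (tendsto_sub_bigBideg s)
  have h2 : (fun g => F (g - s) * total (g - s)) =O[bigBideg] fun g => total g ^ e :=
    h1.trans ((total_sub_isBigO s).pow e)
  have h3 : total =O[bigBideg] fun g => total (g - s) := by
    have h := IsBigO.comp_tendsto (total_sub_isBigO (-s)) (tendsto_sub_bigBideg s)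
    simpa [Function.comp_def] using h
  exact ((isBigO_refl _ _).mul h3).trans h2

theorem GrowthLT.mul {a b : ℕ} {F F' : Bideg → ℚ} (h : GrowthLT a F) (h' : GrowthLE b F') :
    GrowthLT (a + b) (F * F') := by
  have := IsBigO.mul h h'
  simp only [← pow_add] at this
  refine this.congr_left fun g => ?_
  simp only [Pi.mul_apply]; ring

theorem GrowthLE.mul {a b : ℕ} {F F' : Bideg → ℚ} (h : GrowthLE a F) (h' : GrowthLE b F') :
    GrowthLE (a + b) (F * F') := by
  have := IsBigO.mul h h'
  simp only [← pow_add] at this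
  exact this

theorem GrowthLE.shift {e : ℕ} {F : Bideg → ℚ} (h : GrowthLE e F) (s : Bideg) :
    GrowthLE e (fun g => F (g - s)) :=
  (IsBigO.comp_tendsto h (tendsto_sub_bigBideg s)).trans ((total_sub_isBigO s).pow e)

theorem GrowthLE.growthLT {a b : ℕ} {F : Bideg → ℚ} (h : GrowthLE a F) (hab : a < b) :
    GrowthLT b F := by
  have h1 := IsBigO.mul h (isBigO_refl total bigBideg)
  refine h1.trans ?_
  refine IsBigO.of_bound 1 ?_
  filter_upwards [eventually_total_ge 1] with g hg
  rw [one_mul, ← pow_succ, norm_pow, norm_pow]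
  exact pow_le_pow_right₀ (one_le_norm_of_one_le hg) hab

/-- Functions of growth at most `e` whose differences have growth less than `e`. -/
structure GrowthSmooth (e : ℕ) (F : Bideg → ℚ) : Prop where
  le : GrowthLE e F
  diff : ∀ s : Bideg, GrowthLT e ((fun g => F (g - s)) - F)

theorem GrowthSmooth.mul {a b : ℕ} {F F' : Bideg → ℚ} (h : GrowthSmooth a F)
    (h' : GrowthSmooth b F') : GrowthSmooth (a + b) (F * F') := by
  refine ⟨h.le.mul h'.le, fun s => ?_⟩
  have h1 := ((h.diff s).mul (h'.le.shift s)).add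
    (Nat.add_comm b a ▸ (h'.diff s).mul h.le)
  convert h1 using 1
  ext g
  simp only [Pi.mul_apply, Pi.sub_apply, Pi.add_apply]
  ring

theorem GrowthSmooth.add {e : ℕ} {F F' : Bideg → ℚ} (h : GrowthSmooth e F)
    (h' : GrowthSmooth e F') : GrowthSmooth e (F + F') := by
  refine ⟨IsBigO.add h.le h'.le, fun s => ?_⟩
  convert (h.diff s).add (h'.diff s) using 1
  ext g
  simp only [Pi.sub_apply, Pi.add_apply]
  ring

theorem growthSmooth_const (c : ℚ) : GrowthSmooth 0 (fun _ => c) := by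
  refine ⟨?_, fun s => ?_⟩
  · have := isBigO_const_const c (one_ne_zero (α := ℚ)) bigBideg
    refine this.congr_right fun g => by simp
  · convert growthLT_zero 0 using 1
    ext g; simp

theorem GrowthSmooth.const_mul {e : ℕ} {F : Bideg → ℚ} (h : GrowthSmooth e F) (c : ℚ) :
    GrowthSmooth e (fun g => c * F g) := by
  have := (growthSmooth_const c).mul h
  rwa [zero_add] at this

theorem GrowthSmooth.mono {a b : ℕ} {F : Bideg → ℚ} (h : GrowthSmooth a F) (hab : a ≤ b) :
    GrowthSmooth b F := by
  rcases hab.eq_or_lt with rfl | hab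
  · exact h
  have hlt := h.le.growthLT hab
  refine ⟨?_, fun s => (hlt.shift s).sub hlt⟩
  refine h.le.trans (IsBigO.of_bound 1 ?_)
  filter_upwards [eventually_total_ge 1] with g hg
  rw [one_mul, norm_pow, norm_pow]
  exact pow_le_pow_right₀ (one_le_norm_of_one_le hg) hab.le

/-- The first entry of a bidegree. -/
def Bideg.fst (g : Bideg) : ℚ := (ofLex g).1

/-- The second entry of a bidegree. -/
def Bideg.snd (g : Bideg) : ℚ := (ofLex g).2

theorem growthSmooth_of_additive {F : Bideg → ℚ} (hF : ∀ g s, F (g - s) = F g - F s)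
    (h : F =O[bigBideg] total) : GrowthSmooth 1 F := by
  refine ⟨h.congr_right fun g => by simp, fun s => ?_⟩
  have := ((growthSmooth_const (-F s)).le.growthLT one_pos)
  convert this using 1
  ext g
  simp only [Pi.sub_apply, hF]
  ring

theorem growthSmooth_fst : GrowthSmooth 1 Bideg.fst := by
  refine growthSmooth_of_additive (fun g s => by simp [Bideg.fst]) (IsBigO.of_bound 1 ?_)
  rw [eventually_bigBideg]
  refine ⟨0, fun j q hj hq => ?_⟩
  rw [one_mul, ← Rat.norm_cast_real, ← Rat.norm_cast_real, Real.norm_eq_abs, Real.norm_eq_abs]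
  simp only [Bideg.fst, total, ofLex_toLex]
  push_cast
  have hj' : (0 : ℝ) ≤ j := by exact_mod_cast hj
  have hq' : (0 : ℝ) ≤ q := by exact_mod_cast hq
  rw [abs_of_nonneg hj', abs_of_nonneg (add_nonneg hj' hq')]
  linarith

theorem growthSmooth_snd : GrowthSmooth 1 Bideg.snd := by
  refine growthSmooth_of_additive (fun g s => by simp [Bideg.snd]) (IsBigO.of_bound 1 ?_)
  rw [eventually_bigBideg]
  refine ⟨0, fun j q hj hq => ?_⟩
  rw [one_mul, ← Rat.norm_cast_real, ← Rat.norm_cast_real, Real.norm_eq_abs, Real.norm_eq_abs]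
  simp only [Bideg.snd, total, ofLex_toLex]
  push_cast
  have hj' : (0 : ℝ) ≤ j := by exact_mod_cast hj
  have hq' : (0 : ℝ) ≤ q := by exact_mod_cast hq
  rw [abs_of_nonneg hq', abs_of_nonneg (add_nonneg hj' hq')]
  linarith

theorem GrowthSmooth.pow {a : ℕ} {F : Bideg → ℚ} (h : GrowthSmooth a F) :
    ∀ m : ℕ, GrowthSmooth (m * a) (fun g => F g ^ m)
  | 0 => by simpa using growthSmooth_const 1
  | m + 1 => by
    have := (h.pow m).mul h
    rw [Nat.succ_mul]
    convert this using 1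
    ext g; simp [pow_succ]

/-- The value of a bivariate polynomial at a bidegree. -/
noncomputable def bieval (P : MvPolynomial (Fin 2) ℚ) (g : Bideg) : ℚ :=
  MvPolynomial.eval ![g.fst, g.snd] P

theorem bieval_eq (P : MvPolynomial (Fin 2) ℚ) :
    bieval P = ∑ m ∈ P.support, fun g => P.coeff m * (g.fst ^ m 0 * g.snd ^ m 1) := by
  ext g
  rw [bieval, MvPolynomial.eval_eq']
  simp [Fin.prod_univ_two]

theorem growthSmooth_monomial (a b : ℕ) :
    GrowthSmooth (a + b) (fun g => g.fst ^ a * g.snd ^ b) := by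
  have := (growthSmooth_fst.pow a).mul (growthSmooth_snd.pow b)
  simp only [mul_one] at this
  exact this

theorem GrowthSmooth.sum {e : ℕ} {ι : Type*} (s : Finset ι) {F : ι → Bideg → ℚ}
    (h : ∀ i ∈ s, GrowthSmooth e (F i)) : GrowthSmooth e (∑ i ∈ s, F i) := by
  classical
  induction s using Finset.induction_on with
  | empty => exact (growthSmooth_const 0).mono (Nat.zero_le e)
  | insert a s ha ih =>
    rw [Finset.sum_insert ha]
    exact (h a (Finset.mem_insert_self _ _)).add
      (ih fun i hi => h i (Finset.mem_insert_of_mem hi))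

theorem totalDegree_fin_two {P : MvPolynomial (Fin 2) ℚ} {d : ℕ} (hP : P.totalDegree ≤ d)
    {m : Fin 2 →₀ ℕ} (hm : m ∈ P.support) : m 0 + m 1 ≤ d := by
  have := (MvPolynomial.le_totalDegree hm).trans hP
  rwa [Finsupp.sum_fintype _ _ (fun _ => rfl), Fin.sum_univ_two] at this

theorem growthSmooth_bieval {P : MvPolynomial (Fin 2) ℚ} {d : ℕ} (hP : P.totalDegree ≤ d) :
    GrowthSmooth d (bieval P) := by
  rw [bieval_eq]
  exact GrowthSmooth.sum _ fun m hm =>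
    ((growthSmooth_monomial _ _).mono (totalDegree_fin_two hP hm)).const_mul _

/-- The exponent vector `(a, b)`. -/
noncomputable def expo (a b : ℕ) : Fin 2 →₀ ℕ := Finsupp.single 0 a + Finsupp.single 1 b

theorem bieval_sub_leading {P : MvPolynomial (Fin 2) ℚ} {d : ℕ} (hP : P.totalDegree ≤ d) :
    GrowthLT d (bieval P - fun g => ∑ e ∈ Finset.range (d + 1),
      P.coeff (expo (d - e) e) * (g.fst ^ (d - e) * g.snd ^ e)) := by
  have h1 : (fun g : Bideg => ∑ e ∈ Finset.range (d + 1),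
      P.coeff (expo (d - e) e) * (g.fst ^ (d - e) * g.snd ^ e)) =
      ∑ m ∈ P.support.filter (fun m => m 0 + m 1 = d),
        fun g => P.coeff m * (g.fst ^ m 0 * g.snd ^ m 1) := by
    ext g
    rw [Finset.sum_apply, Finset.sum_filter]
    symm
    rw [← Finset.sum_filter]
    refine Finset.sum_bij_ne_zero (fun m _ _ => m 1) ?_ ?_ ?_ ?_
    · intro m hm _
      have := (Finset.mem_filter.mp hm).2
      simp only [Finset.mem_range]
      omega
    · intro m hm _ m' hm' _ h
      have h2 := (Finset.mem_filter.mp hm).2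
      have h3 := (Finset.mem_filter.mp hm').2
      ext i
      fin_cases i
      · simp only [Fin.zero_eta]; omega
      · exact h
    · intro e he hne
      refine ⟨expo (d - e) e, ?_, ?_, by simp [expo]⟩
      · simp only [Finset.mem_filter, MvPolynomial.mem_support_iff]
        refine ⟨left_ne_zero_of_mul hne, ?_⟩
        have := Finset.mem_range.mp he
        simp [expo]; omega
      · simpa [expo] using hne
    · intro m hm _
      have h2 := (Finset.mem_filter.mp hm).2
      have h3 : d - m 1 = m 0 := by omega
      have h4 : expo (m 0) (m 1) = m := by
        ext i
        fin_cases i <;> simp [expo]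
      rw [h3, h4]
  rw [h1, bieval_eq, ← Finset.sum_filter_add_sum_filter_not _ (fun m => m 0 + m 1 = d),
    add_sub_cancel_left]
  refine GrowthLT.sum _ fun m hm => ?_
  have h2 := (Finset.mem_filter.mp hm).2
  have h3 := totalDegree_fin_two hP (Finset.mem_filter.mp hm).1
  exact ((growthSmooth_monomial _ _).le.growthLT (lt_of_le_of_ne h3 h2)).const_mul _

/-- A homogeneous form with growth smaller than its degree vanishes. -/
theorem eq_zero_of_growthLT {d : ℕ} {γ : ℕ → ℚ}
    (h : GrowthLT d (fun g => ∑ e ∈ Finset.range (d + 1), γ e * (g.fst ^ (d - e) * g.snd ^ e)))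
    {e : ℕ} (he : e ≤ d) : γ e = 0 := by
  obtain ⟨C, hC⟩ := h.bound
  rw [eventually_bigBideg] at hC
  obtain ⟨M, hM⟩ := hC
  let p : Polynomial ℚ := ∑ e ∈ Finset.range (d + 1), Polynomial.C (γ e) * Polynomial.X ^ e
  have hroot : ∀ y : ℕ, p.eval ((y : ℚ) + 1) = 0 := by
    intro y
    by_contra hne
    have key : ∀ N : ℕ, M ≤ N → 1 ≤ N →
        (N : ℝ) * (‖p.eval ((y : ℚ) + 1)‖ * (y + 2)) ≤ C * (y + 2) ^ d := by
      intro N hN hN1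
      have h1 := hM N (N * (y + 1)) hN (by nlinarith)
      have h2 : (∑ e ∈ Finset.range (d + 1), γ e * (Bideg.fst (toLex ((N : ℤ), (N * (y + 1) : ℤ))) ^
          (d - e) * Bideg.snd (toLex ((N : ℤ), (N * (y + 1) : ℤ))) ^ e)) =
          (N : ℚ) ^ d * p.eval ((y : ℚ) + 1) := by
        simp only [Bideg.fst, Bideg.snd, ofLex_toLex, p, Polynomial.eval_finsetSum,
          Finset.mul_sum, Polynomial.eval_mul, Polynomial.eval_C, Polynomial.eval_pow,
          Polynomial.eval_X]
        refine Finset.sum_congr rfl fun e he => ?_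
        have := Finset.mem_range.mp he
        push_cast
        have hsplit : (N : ℚ) ^ d = N ^ (d - e) * N ^ e := by
          rw [← pow_add, Nat.sub_add_cancel (by omega)]
        rw [hsplit, mul_pow]
        ring
      have h3 : total (toLex ((N : ℤ), (N * (y + 1) : ℤ)) : Bideg) = N * (y + 2) := by
        simp only [total, ofLex_toLex]
        push_cast
        ring
      beta_reduce at h1
      rw [h2, h3, norm_mul, norm_mul, norm_pow, norm_pow] at h1
      have h4 : ‖(N : ℚ) * ((y : ℚ) + 2)‖ = N * (y + 2) := by
        rw [← Rat.norm_cast_real]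
        push_cast
        rw [Real.norm_of_nonneg (by positivity)]
      have h5 : ‖(N : ℚ)‖ = N := by
        rw [← Rat.norm_cast_real]
        push_cast
        rw [Real.norm_of_nonneg (by positivity)]
      rw [h4, h5, mul_pow] at h1
      have h6 : (0 : ℝ) < (N : ℝ) ^ d := by positivity
      refine le_of_mul_le_mul_left ?_ h6
      linarith
    have hpos : 0 < ‖p.eval ((y : ℚ) + 1)‖ * ((y : ℝ) + 2) := by
      have := norm_pos_iff.mpr hne
      positivity
    obtain ⟨N, hN⟩ := exists_nat_gt (C * ((y : ℝ) + 2) ^ d / (‖p.eval ((y : ℚ) + 1)‖ * ((y : ℝ) + 2)))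
    have h7 := key (max (max N M.toNat) 1) (by omega) (by omega)
    rw [div_lt_iff₀ hpos] at hN
    have h8 : (N : ℝ) ≤ ((max (max N M.toNat) 1 : ℕ) : ℝ) := by
      exact_mod_cast (le_max_left _ _).trans (le_max_left _ _)
    have := mul_le_mul_of_nonneg_right h8 hpos.le
    linarith
  have hp : p = 0 := by
    refine Polynomial.eq_zero_of_infinite_isRoot p ?_
    refine Set.infinite_of_injective_forall_mem (f := fun y : ℕ => ((y : ℚ) + 1)) ?_ hroot
    intro a b hab
    simpa using hab
  have : p.coeff e = γ e := by
    simp only [p, Polynomial.finsetSum_coeff, Polynomial.coeff_C_mul, Polynomial.coeff_X_pow]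
    simp
    omega
  rw [← this, hp, Polynomial.coeff_zero]

/-- The binomial coefficient `(x + m choose m)`. -/
def risingBinom : ℕ → ℚ → ℚ
  | 0, _ => 1
  | m + 1, x => risingBinom m x * (x + (m + 1)) / (m + 1)

theorem risingBinom_sub (m : ℕ) (x : ℚ) :
    risingBinom (m + 1) x - risingBinom (m + 1) (x - 1) = risingBinom m x := by
  induction m generalizing x with
  | zero => simp [risingBinom]
  | succ m ih =>
    have h := ih x
    rw [risingBinom, risingBinom.eq_2 (x - 1) (m + 1)]
    have h1 : risingBinom (m + 1) (x - 1) = risingBinom (m + 1) x - risingBinom m x := by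
      linarith
    have h2 : risingBinom (m + 1) x = risingBinom m x * (x + (m + 1)) / (m + 1) := rfl
    rw [h1]
    have h3 : (m : ℚ) + 1 ≠ 0 := by positivity
    have h4 : (m : ℚ) + 1 + 1 ≠ 0 := by positivity
    have h5 : risingBinom (m + 1) x * (m + 1) = risingBinom m x * (x + (m + 1)) := by
      rw [h2]; field_simp
    push_cast
    field_simp
    linear_combination -h5

theorem risingBinom_natCast (m x : ℕ) : risingBinom m x = ((x + m).choose m : ℚ) := by
  induction m with
  | zero => simp [risingBinom]
  | succ m ih =>
    rw [risingBinom, ih]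
    have h3 : (m : ℚ) + 1 ≠ 0 := by positivity
    rw [div_eq_iff h3]
    have := Nat.add_one_mul_choose_eq (x + m) m
    have h : ((x + m + 1 : ℕ) : ℚ) * ((x + m).choose m) = ((x + (m + 1)).choose (m + 1)) * (m + 1) := by
      exact_mod_cast this
    rw [← h]
    push_cast
    ring

theorem growthSmooth_risingBinom {F : Bideg → ℚ} (hF : GrowthSmooth 1 F) (m : ℕ) :
    GrowthSmooth m (fun g => risingBinom m (F g)) := by
  induction m with
  | zero => exact growthSmooth_const 1
  | succ m ih =>
    have := (ih.mul (hF.add ((growthSmooth_const (m + 1)).mono zero_le_one))).const_mul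
      (1 / (m + 1))
    convert this using 1
    ext g
    simp only [risingBinom, Pi.mul_apply, Pi.add_apply]
    ring

theorem risingBinom_sub_pow_growthLT {F : Bideg → ℚ} (hF : GrowthSmooth 1 F) (m : ℕ) :
    GrowthLT m (fun g => risingBinom m (F g) - F g ^ m / m.factorial) := by
  induction m with
  | zero =>
    convert growthLT_zero 0 using 1
    ext g; simp [risingBinom]
  | succ m ih =>
    have h1 := (ih.mul hF.le).const_mul (1 / (m + 1))
    have h2 := (growthSmooth_risingBinom hF m).le.growthLT (Nat.lt_succ_self m)
    convert h1.add h2 using 1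
    ext g
    simp only [risingBinom, Pi.mul_apply, Pi.add_apply, Nat.factorial_succ]
    have h3 : (m : ℚ) + 1 ≠ 0 := by positivity
    have h4 : (m.factorial : ℚ) ≠ 0 := by positivity
    push_cast
    field_simp
    ring

end BidegreeGrowth

/-! ### Iterated differences of products of binomial coefficients -/

section IteratedDifference

/-- Translation of a function of the bidegree. -/
def shiftEnd (s : Bideg) : Module.End ℚ (Bideg → ℚ) where
  toFun F g := F (g - s)
  map_add' _ _ := rfl
  map_smul' _ _ := rfl

@[simp] theorem shiftEnd_apply (s : Bideg) (F : Bideg → ℚ) (g : Bideg) :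
    shiftEnd s F g = F (g - s) := rfl

/-- The backward difference operator. -/
def nablaEnd (s : Bideg) : Module.End ℚ (Bideg → ℚ) := 1 - shiftEnd s

@[simp] theorem nablaEnd_apply (s : Bideg) (F : Bideg → ℚ) (g : Bideg) :
    nablaEnd s F g = F g - F (g - s) := rfl

theorem shiftEnd_commute (s t : Bideg) : Commute (shiftEnd s) (shiftEnd t) := by
  ext F g
  change F (g - s - t) = F (g - t - s)
  rw [sub_right_comm]

theorem shiftEnd_commute_nablaEnd (s t : Bideg) : Commute (shiftEnd s) (nablaEnd t) :=
  (Commute.one_right _).sub_right (shiftEnd_commute s t)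

theorem nablaEnd_pow_shiftEnd (s t : Bideg) (l : ℕ) (F : Bideg → ℚ) :
    (nablaEnd t ^ l) (shiftEnd s F) = shiftEnd s ((nablaEnd t ^ l) F) :=
  (LinearMap.congr_fun ((shiftEnd_commute_nablaEnd s t).pow_right l) F).symm

theorem shiftEnd_eventuallyEq {F F' : Bideg → ℚ} (h : F =ᶠ[bigBideg] F') (s : Bideg) :
    shiftEnd s F =ᶠ[bigBideg] shiftEnd s F' :=
  (tendsto_sub_bigBideg s).eventually h

theorem nablaEnd_pow_eventuallyEq {F F' : Bideg → ℚ} (h : F =ᶠ[bigBideg] F') (s : Bideg) (l : ℕ) :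
    (nablaEnd s ^ l) F =ᶠ[bigBideg] (nablaEnd s ^ l) F' := by
  induction l with
  | zero => exact h
  | succ l ih =>
    rw [pow_succ', Module.End.mul_apply, Module.End.mul_apply]
    exact ih.sub (shiftEnd_eventuallyEq ih s)

theorem GrowthSmooth.shift {e : ℕ} {F : Bideg → ℚ} (h : GrowthSmooth e F) (s : Bideg) :
    GrowthSmooth e (shiftEnd s F) := by
  refine ⟨h.le.shift s, fun t => ?_⟩
  convert (h.diff t).shift s using 1
  ext g
  simp only [Pi.sub_apply, shiftEnd_apply]
  rw [sub_right_comm]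

/-- Binomial coefficients with the index shifted by one, so that index `0` gives `0`. -/
def shiftedBinom : ℕ → ℚ → ℚ
  | 0, _ => 0
  | m + 1, x => risingBinom m x

theorem shiftedBinom_sub (m : ℕ) (x : ℚ) :
    shiftedBinom m x - shiftedBinom m (x - 1) = shiftedBinom (m - 1) x := by
  rcases m with _ | _ | m
  · simp [shiftedBinom]
  · simp [shiftedBinom, risingBinom]
  · exact risingBinom_sub m x

theorem shiftedBinom_sub_natCast (m D : ℕ) (x : ℚ) :
    shiftedBinom m x - shiftedBinom m (x - D) =
      ∑ i ∈ Finset.range D, shiftedBinom (m - 1) (x - i) := by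
  induction D with
  | zero => simp
  | succ D ih =>
    rw [Finset.sum_range_succ, ← ih, ← shiftedBinom_sub m (x - D)]
    push_cast
    rw [sub_sub x]
    ring

/-- The function `(j, q) ↦ shiftedBinom a j * shiftedBinom m q`. -/
def binomProd (a m : ℕ) (g : Bideg) : ℚ := shiftedBinom a g.fst * shiftedBinom m g.snd

theorem nablaEnd_binomProd (D a m : ℕ) :
    nablaEnd (toLex ((D : ℤ), (1 : ℤ))) (binomProd a m) = binomProd a (m - 1) +
      ∑ i ∈ Finset.range D, shiftEnd (toLex ((i : ℤ), (1 : ℤ))) (binomProd (a - 1) m) := by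
  ext g
  have h1 : ∀ i : ℤ, Bideg.fst (g - toLex (i, (1 : ℤ))) = g.fst - i := fun i => by
    simp [Bideg.fst]
  have h2 : ∀ i : ℤ, Bideg.snd (g - toLex (i, (1 : ℤ))) = g.snd - 1 := fun i => by
    simp [Bideg.snd]
  simp only [nablaEnd_apply, Pi.add_apply, Finset.sum_apply, shiftEnd_apply, binomProd, h1, h2]
  rw [← Finset.sum_mul]
  push_cast
  rw [← shiftedBinom_sub_natCast, ← shiftedBinom_sub m]
  ring

theorem binomProd_zero_left (m : ℕ) : binomProd 0 m = 0 := by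
  ext g; simp [binomProd, shiftedBinom]

theorem binomProd_zero_right (a : ℕ) : binomProd a 0 = 0 := by
  ext g; simp [binomProd, shiftedBinom]

theorem growthSmooth_zero (e : ℕ) : GrowthSmooth e 0 :=
  (growthSmooth_const 0).mono (Nat.zero_le e)

theorem growthSmooth_binomProd {a m e : ℕ} (h : a + m ≤ e + 2) :
    GrowthSmooth e (binomProd a m) := by
  rcases a with _ | a
  · rw [binomProd_zero_left]; exact growthSmooth_zero e
  rcases m with _ | m
  · rw [binomProd_zero_right]; exact growthSmooth_zero e
  exact ((growthSmooth_risingBinom growthSmooth_fst a).mul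
    (growthSmooth_risingBinom growthSmooth_snd m)).mono (by omega)

theorem nablaEnd_pow_succ_binomProd (D l a m : ℕ) :
    (nablaEnd (toLex ((D : ℤ), (1 : ℤ))) ^ (l + 1)) (binomProd a m) =
      (nablaEnd (toLex ((D : ℤ), (1 : ℤ))) ^ l) (binomProd a (m - 1)) +
      ∑ i ∈ Finset.range D, shiftEnd (toLex ((i : ℤ), (1 : ℤ)))
        ((nablaEnd (toLex ((D : ℤ), (1 : ℤ))) ^ l) (binomProd (a - 1) m)) := by
  rw [pow_succ, Module.End.mul_apply, nablaEnd_binomProd, map_add, map_sum]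
  simp only [nablaEnd_pow_shiftEnd]

theorem growthSmooth_nablaEnd_pow_binomProd (D l : ℕ) : ∀ {a m e : ℕ}, a + m ≤ l + e + 2 →
    GrowthSmooth e ((nablaEnd (toLex ((D : ℤ), (1 : ℤ))) ^ l) (binomProd a m)) := by
  induction l with
  | zero => intro a m e h; exact growthSmooth_binomProd (by omega)
  | succ l ih =>
    intro a m e h
    rcases Nat.eq_zero_or_pos a with rfl | ha
    · rw [binomProd_zero_left, map_zero]; exact growthSmooth_zero e
    rcases Nat.eq_zero_or_pos m with rfl | hm
    · rw [binomProd_zero_right, map_zero]; exact growthSmooth_zero e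
    rw [nablaEnd_pow_succ_binomProd]
    exact (ih (by omega)).add (GrowthSmooth.sum _ fun i _ => (ih (by omega)).shift _)

theorem growthLT_nablaEnd_pow_binomProd (D l : ℕ) {a m e : ℕ} (h : a + m < l + e + 2) :
    GrowthLT e ((nablaEnd (toLex ((D : ℤ), (1 : ℤ))) ^ l) (binomProd a m)) := by
  rcases e with _ | e
  · rcases l with _ | l
    · rcases Nat.eq_zero_or_pos a with rfl | ha
      · rw [binomProd_zero_left, map_zero]; exact growthLT_zero 0
      · obtain rfl : m = 0 := by omega
        rw [binomProd_zero_right, map_zero]; exact growthLT_zero 0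
    · rw [pow_succ', Module.End.mul_apply]
      have := ((growthSmooth_nablaEnd_pow_binomProd D l (a := a) (m := m) (e := 0)
        (by omega)).diff (toLex ((D : ℤ), (1 : ℤ)))).neg
      convert this using 1
      ext g; simp
  · exact (growthSmooth_nablaEnd_pow_binomProd D l (a := a) (m := m) (e := e)
      (by omega)).le.growthLT (Nat.lt_succ_self e)

theorem sum_choose_succ_mul {M : Type*} [AddCommMonoid M] [Module ℚ M] (l : ℕ) (x : ℕ → M) :
    ∑ i ∈ Finset.range (l + 2), ((l + 1).choose i : ℚ) • x i =
      ∑ i ∈ Finset.range (l + 1), (l.choose i : ℚ) • x i +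
        ∑ i ∈ Finset.range (l + 1), (l.choose i : ℚ) • x (i + 1) := by
  have h : ∑ i ∈ Finset.range (l + 1), (l.choose i : ℚ) • x i =
      ∑ i ∈ Finset.range (l + 2), (l.choose i : ℚ) • x i := by
    rw [Finset.sum_range_succ _ (l + 1), Nat.choose_succ_self]
    simp
  rw [h, Finset.sum_range_succ', Finset.sum_range_succ' _ (l + 1)]
  simp only [Nat.choose_succ_succ, Nat.choose_zero_right, Nat.cast_add, add_smul,
    Finset.sum_add_distrib]
  abel

theorem nablaEnd_pow_binomProd_sub_growthLT (D l : ℕ) : ∀ {a m e : ℕ}, a + m = l + e + 2 →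
    GrowthLT e ((nablaEnd (toLex ((D : ℤ), (1 : ℤ))) ^ l) (binomProd a m) -
      ∑ i ∈ Finset.range (l + 1),
        (l.choose i : ℚ) • ((D : ℚ) ^ i • binomProd (a - i) (m - (l - i)))) := by
  induction l with
  | zero =>
    intro a m e _
    convert growthLT_zero e using 1
    simp
  | succ l ih =>
    intro a m e h
    rcases Nat.eq_zero_or_pos a with rfl | ha
    · convert growthLT_zero e using 1
      simp [binomProd_zero_left]
    rcases Nat.eq_zero_or_pos m with rfl | hm
    · convert growthLT_zero e using 1
      simp [binomProd_zero_right]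
    have h1 := ih (a := a) (m := m - 1) (e := e) (by omega)
    have h2 := ih (a := a - 1) (m := m) (e := e) (by omega)
    have h3 := growthSmooth_nablaEnd_pow_binomProd D l (a := a - 1) (m := m) (e := e) (by omega)
    set N := nablaEnd (toLex ((D : ℤ), (1 : ℤ))) ^ l
    have h4 : GrowthLT e (∑ i ∈ Finset.range D, (shiftEnd (toLex ((i : ℤ), (1 : ℤ)))
        (N (binomProd (a - 1) m)) - N (binomProd (a - 1) m))) :=
      GrowthLT.sum _ fun i _ => h3.diff _
    have h5 := (h1.add h4).add (h2.const_mul D)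
    rw [nablaEnd_pow_succ_binomProd, sum_choose_succ_mul]
    convert h5 using 1
    rw [Finset.sum_sub_distrib, Finset.sum_const, Finset.card_range]
    have h6 : ∀ i ∈ Finset.range (l + 1),
        (l.choose i : ℚ) • ((D : ℚ) ^ i • binomProd (a - i) (m - (l + 1 - i))) =
        (l.choose i : ℚ) • ((D : ℚ) ^ i • binomProd (a - i) (m - 1 - (l - i))) := by
      intro i hi
      have := Finset.mem_range.mp hi
      rw [show m - (l + 1 - i) = m - 1 - (l - i) by omega]
    have h7 : ∀ i ∈ Finset.range (l + 1),
        (l.choose i : ℚ) • ((D : ℚ) ^ (i + 1) • binomProd (a - (i + 1)) (m - (l + 1 - (i + 1)))) =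
        (D : ℚ) • ((l.choose i : ℚ) • ((D : ℚ) ^ i • binomProd (a - 1 - i) (m - (l - i)))) := by
      intro i hi
      rw [show m - (l + 1 - (i + 1)) = m - (l - i) by omega,
        show a - (i + 1) = a - 1 - i by omega, pow_succ, mul_comm, smul_comm (D : ℚ), mul_smul]
    rw [Finset.sum_congr rfl h6, Finset.sum_congr rfl h7, ← Finset.smul_sum]
    ext g
    simp only [Pi.add_apply, Pi.sub_apply, Pi.smul_apply, nsmul_eq_mul, smul_eq_mul,
      Pi.mul_apply, Pi.natCast_apply]
    ring

end IteratedDifference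

/-! ### Leading coefficients -/

section LeadingCoefficients

/-- The alternating sum `∑ (-1)^(n-m) (m choose e)` over `m ≤ n`. -/
def altChoose (e : ℕ) : ℕ → ℚ
  | 0 => (Nat.choose 0 e : ℚ)
  | n + 1 => (Nat.choose (n + 1) e : ℚ) - altChoose e n

theorem altChoose_add_two (e n : ℕ) :
    altChoose (e + 1) (n + 2) = ((n + 1).choose e : ℚ) + altChoose (e + 1) n := by
  simp only [altChoose]
  rw [Nat.choose_succ_succ (n + 1) e]
  push_cast
  ring

theorem altChoose_zero (n : ℕ) : altChoose 0 n = if Even n then 1 else 0 := by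
  induction n with
  | zero => simp [altChoose]
  | succ n ih =>
    rw [altChoose, ih]
    by_cases h : Even n <;> simp [h, Nat.even_add_one]

theorem altChoose_one (n : ℕ) : altChoose 1 n = ((n + 1) / 2 : ℕ) := by
  induction n using Nat.twoStepInduction with
  | zero => simp [altChoose]
  | one => simp [altChoose]
  | more n ih _ =>
    rw [altChoose_add_two, zero_add, ih, show (n + 2 + 1) / 2 = (n + 1) / 2 + 1 by omega]
    simp [add_comm]

theorem altChoose_two (r : ℕ) : altChoose 2 (2 * r) = (r : ℚ) ^ 2 := by
  induction r with
  | zero => simp [altChoose]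
  | succ r ih =>
    rw [mul_add, mul_one, altChoose_add_two, ih]
    simp
    ring

theorem altChoose_eq_sum (e r : ℕ) : altChoose (e + 1) (2 * r) =
    ∑ k ∈ Finset.range r, ((2 * r - 1 - 2 * k).choose e : ℚ) := by
  induction r with
  | zero => simp [altChoose]
  | succ r ih =>
    rw [mul_add, mul_one, altChoose_add_two, ih, Finset.sum_range_succ', add_comm]
    congr 1
    refine Finset.sum_congr rfl fun k _ => ?_
    rw [show 2 * r + 2 - 1 - 2 * (k + 1) = 2 * r - 1 - 2 * k by omega]

theorem altChoose_eq_sum_of_even {e n : ℕ} (he : 1 ≤ e) (hen : e ≤ n) (hn : Even n) :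
    altChoose e n = ∑ k ∈ Finset.range ((n - e) / 2 + 1), ((n - 1 - 2 * k).choose (e - 1) : ℚ) := by
  obtain ⟨r, rfl⟩ := hn
  obtain ⟨e, rfl⟩ := Nat.exists_eq_add_of_le' he
  rw [← two_mul, altChoose_eq_sum]
  symm
  refine Finset.sum_subset (fun k hk => ?_) fun k hk hk' => ?_
  · simp only [Finset.mem_range] at hk ⊢
    omega
  · simp only [Finset.mem_range] at hk hk'
    rw [Nat.choose_eq_zero_of_lt (by omega), Nat.cast_zero]

theorem altChoose_eq_sum_range (e n : ℕ) :
    altChoose e n = ∑ i ∈ Finset.range (n + 1), (-1 : ℚ) ^ i * ((n - i).choose e : ℚ) := by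
  induction n with
  | zero => simp [altChoose]
  | succ n ih =>
    rw [altChoose, ih, Finset.sum_range_succ' _ (n + 1), sub_eq_neg_add, ← Finset.sum_neg_distrib]
    congr 1
    · refine Finset.sum_congr rfl fun i _ => ?_
      rw [Nat.add_sub_add_right, pow_succ]; ring
    · simp

theorem neg_shiftEnd_pow_sub_growthLT {e : ℕ} {F : Bideg → ℚ} (hF : GrowthSmooth e F)
    (s : Bideg) (i : ℕ) : GrowthLT e (((-shiftEnd s) ^ i) F - (-1 : ℚ) ^ i • F) := by
  induction i with
  | zero => convert growthLT_zero e using 1; simp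
  | succ i ih =>
    have h1 := (ih.shift s).neg.add ((hF.diff s).const_mul (-(-1) ^ i))
    convert h1 using 1
    ext g
    rw [pow_succ', Module.End.mul_apply]
    simp only [Pi.sub_apply, Pi.smul_apply, LinearMap.neg_apply, Pi.neg_apply, shiftEnd_apply,
      Pi.add_apply, smul_eq_mul, pow_succ]
    ring

theorem binomProd_sub_growthLT (a b : ℕ) : GrowthLT (a + b) (binomProd (a + 1) (b + 1) -
    fun g : Bideg => 1 / (a.factorial * b.factorial) * (g.fst ^ a * g.snd ^ b)) := by
  have h1 := (risingBinom_sub_pow_growthLT growthSmooth_fst a).mul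
    (growthSmooth_risingBinom growthSmooth_snd b).le
  have h2 := (risingBinom_sub_pow_growthLT growthSmooth_snd b).mul
    ((growthSmooth_fst.pow a).const_mul (1 / a.factorial)).le
  rw [mul_one, add_comm] at h2
  convert h1.add h2 using 1
  ext g
  have h3 : (a.factorial : ℚ) ≠ 0 := by positivity
  have h4 : (b.factorial : ℚ) ≠ 0 := by positivity
  simp only [Pi.sub_apply, Pi.add_apply, Pi.mul_apply, binomProd, shiftedBinom]
  field_simp
  ring

/-- If an alternating sum of iterated differences of binomial products is, up to lower order
terms, a multiple of a polynomial, then this multiple has prescribed leading coefficients. -/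
theorem mul_leading_coeff_eq {d n D : ℕ} {P : MvPolynomial (Fin 2) ℚ} (hP : P.totalDegree ≤ d)
    {χ S : Bideg → ℚ} {H : ℕ → Bideg → ℚ} {c : ℚ}
    (hχP : GrowthLT d (χ - c • bieval P))
    (hχ : χ = (nablaEnd (toLex ((D : ℤ), (1 : ℤ))) ^ (n + 1)) S -
      ∑ i ∈ Finset.range (n + 1), ((-shiftEnd (toLex ((D : ℤ), (1 : ℤ)))) ^ i)
        ((nablaEnd (toLex ((D : ℤ), (1 : ℤ))) ^ (n - i)) (H i)))
    (hS : S =ᶠ[bigBideg] binomProd (d + 1) (n + 1))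
    (hH : ∀ i ≤ n, H i =ᶠ[bigBideg] binomProd (d + 1) (n - i + 1)) {e : ℕ} (he : e ≤ d) :
    c * ((d - e).factorial * e.factorial * P.coeff (expo (d - e) e)) =
      - ((D : ℚ) ^ e * altChoose e n) := by
  set s : Bideg := toLex ((D : ℤ), (1 : ℤ)) with hs
  have h1 : GrowthLT d ((nablaEnd s ^ (n + 1)) S) :=
    (growthLT_nablaEnd_pow_binomProd D (n + 1) (a := d + 1) (m := n + 1) (by omega)).congr
      (nablaEnd_pow_eventuallyEq hS.symm s _)
  have h2 : ∀ i ∈ Finset.range (n + 1), GrowthLT d ((((-shiftEnd s) ^ i)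
      ((nablaEnd s ^ (n - i)) (H i))) - (-1 : ℚ) ^ i • ∑ e ∈ Finset.range (d + 1),
        ((n - i).choose e : ℚ) • ((D : ℚ) ^ e • (fun g : Bideg => 1 / ((d - e).factorial * e.factorial : ℚ) *
          (g.fst ^ (d - e) * g.snd ^ e)))) := by
    intro i hi
    have hi' : i ≤ n := Nat.lt_succ_iff.mp (Finset.mem_range.mp hi)
    have h3 := growthSmooth_nablaEnd_pow_binomProd D (n - i) (a := d + 1) (m := n - i + 1) (e := d)
      (by omega)
    have h4 := nablaEnd_pow_binomProd_sub_growthLT D (n - i) (a := d + 1) (m := n - i + 1) (e := d)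
      (by omega)
    have h5 := neg_shiftEnd_pow_sub_growthLT h3 s i
    have h6 : GrowthLT d (∑ e ∈ Finset.range (n - i + 1), ((n - i).choose e : ℚ) •
        ((D : ℚ) ^ e • binomProd (d + 1 - e) (n - i + 1 - (n - i - e))) -
        ∑ e ∈ Finset.range (d + 1), ((n - i).choose e : ℚ) • ((D : ℚ) ^ e •
          (fun g : Bideg => 1 / ((d - e).factorial * e.factorial : ℚ) * (g.fst ^ (d - e) * g.snd ^ e)))) := by
      have h7 : ∑ e ∈ Finset.range (n - i + 1), ((n - i).choose e : ℚ) •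
          ((D : ℚ) ^ e • binomProd (d + 1 - e) (n - i + 1 - (n - i - e))) =
          ∑ e ∈ Finset.range (d + 1), ((n - i).choose e : ℚ) •
          ((D : ℚ) ^ e • binomProd (d - e + 1) (e + 1)) := by
        have h8 : ∑ e ∈ Finset.range (n - i + 1), ((n - i).choose e : ℚ) •
          ((D : ℚ) ^ e • binomProd (d + 1 - e) (n - i + 1 - (n - i - e))) =
          ∑ e ∈ Finset.range (n - i + 1), ((n - i).choose e : ℚ) •
          ((D : ℚ) ^ e • binomProd (d + 1 - e) (e + 1)) :=
          Finset.sum_congr rfl fun e he => by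
            have := Finset.mem_range.mp he
            rw [show n - i + 1 - (n - i - e) = e + 1 by omega]
        have h9 : ∑ e ∈ Finset.range (d + 1), ((n - i).choose e : ℚ) •
          ((D : ℚ) ^ e • binomProd (d - e + 1) (e + 1)) =
          ∑ e ∈ Finset.range (d + 1), ((n - i).choose e : ℚ) •
          ((D : ℚ) ^ e • binomProd (d + 1 - e) (e + 1)) :=
          Finset.sum_congr rfl fun e he => by
            have := Finset.mem_range.mp he
            rw [show d + 1 - e = d - e + 1 by omega]
        rw [h8, h9]
        trans ∑ e ∈ Finset.range (max (n - i + 1) (d + 1)), ((n - i).choose e : ℚ) •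
          ((D : ℚ) ^ e • binomProd (d + 1 - e) (e + 1))
        · refine Finset.sum_subset (fun e he => ?_) fun e _ he => ?_
          · simp only [Finset.mem_range] at he ⊢; omega
          · rw [Finset.mem_range] at he
            rw [Nat.choose_eq_zero_of_lt (by omega), Nat.cast_zero, zero_smul]
        · symm
          refine Finset.sum_subset (fun e he => ?_) fun e _ he => ?_
          · simp only [Finset.mem_range] at he ⊢; omega
          · rw [Finset.mem_range] at he
            rw [show d + 1 - e = 0 by omega, binomProd_zero_left, smul_zero, smul_zero]
      rw [h7, ← Finset.sum_sub_distrib]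
      refine GrowthLT.sum _ fun e he => ?_
      have hed := Finset.mem_range.mp he
      have h10 := binomProd_sub_growthLT (d - e) e
      rw [Nat.sub_add_cancel (by omega)] at h10
      rw [← smul_sub, ← smul_sub]
      exact (h10.const_mul _).const_mul _
    have h11 : (((-shiftEnd s) ^ i) ((nablaEnd s ^ (n - i)) (binomProd (d + 1) (n - i + 1))))
        =ᶠ[bigBideg] (((-shiftEnd s) ^ i) ((nablaEnd s ^ (n - i)) (H i))) := by
      have h12 := nablaEnd_pow_eventuallyEq (hH i hi').symm s (n - i)
      have h13 : ∀ (l : ℕ) (F F' : Bideg → ℚ), F =ᶠ[bigBideg] F' →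
          ((-shiftEnd s) ^ l) F =ᶠ[bigBideg] ((-shiftEnd s) ^ l) F' := by
        intro l F F' h
        induction l with
        | zero => exact h
        | succ l ih =>
          rw [pow_succ', Module.End.mul_apply, Module.End.mul_apply]
          exact (shiftEnd_eventuallyEq ih s).neg
      exact h13 _ _ _ h12
    have h13 := (h5.add ((h4.add h6).const_mul ((-1) ^ i))).congr
      (F' := (((-shiftEnd s) ^ i) ((nablaEnd s ^ (n - i)) (H i))) - (-1 : ℚ) ^ i •
        ∑ e ∈ Finset.range (d + 1), ((n - i).choose e : ℚ) • ((D : ℚ) ^ e •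
          (fun g : Bideg => 1 / ((d - e).factorial * e.factorial : ℚ) * (g.fst ^ (d - e) * g.snd ^ e)))) (by
        filter_upwards [h11] with g hg
        simp only [Pi.add_apply, Pi.sub_apply, Pi.smul_apply, smul_eq_mul, ← hg]
        ring)
    exact h13
  have h14 := (GrowthLT.sum _ h2).add (hχP.sub h1)
  have h15 := h14.add ((bieval_sub_leading hP).const_mul c)
  have h16 : GrowthLT d (fun g => ∑ e ∈ Finset.range (d + 1),
      (c * P.coeff (expo (d - e) e) + (D : ℚ) ^ e * altChoose e n /
        ((d - e).factorial * e.factorial)) * (g.fst ^ (d - e) * g.snd ^ e)) := by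
    convert h15.neg using 1
    rw [hχ]
    ext g
    simp only [Pi.add_apply, Pi.sub_apply, Pi.smul_apply, smul_eq_mul, Pi.neg_apply,
      Finset.sum_apply, Finset.sum_sub_distrib, add_mul, Finset.sum_add_distrib]
    have h17 : ∑ i ∈ Finset.range (n + 1), (-1 : ℚ) ^ i * ∑ e ∈ Finset.range (d + 1),
        ((n - i).choose e : ℚ) * ((D : ℚ) ^ e * (1 / ((d - e).factorial * e.factorial : ℚ) *
          (g.fst ^ (d - e) * g.snd ^ e))) =
        ∑ e ∈ Finset.range (d + 1), (D : ℚ) ^ e * altChoose e n /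
          ((d - e).factorial * e.factorial) * (g.fst ^ (d - e) * g.snd ^ e) := by
      simp only [Finset.mul_sum]
      rw [Finset.sum_comm]
      refine Finset.sum_congr rfl fun e _ => ?_
      rw [altChoose_eq_sum_range, Finset.mul_sum, Finset.sum_div, Finset.sum_mul]
      refine Finset.sum_congr rfl fun i _ => ?_
      ring
    rw [h17, mul_sub, Finset.mul_sum]
    simp only [mul_assoc]
    ring
  have h17 := eq_zero_of_growthLT h16 he
  have h3 : ((d - e).factorial : ℚ) ≠ 0 := by positivity
  have h4 : (e.factorial : ℚ) ≠ 0 := by positivity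
  field_simp at h17
  linear_combination h17

theorem even_and_leading_coeff_eq {d n D : ℕ} {P : MvPolynomial (Fin 2) ℚ} {c : ℚ}
    (h : ∀ e ≤ d, c * ((d - e).factorial * e.factorial * P.coeff (expo (d - e) e)) =
      - ((D : ℚ) ^ e * altChoose e n))
    (hd : 1 ≤ d) (hn : 1 ≤ n) (hD : 1 ≤ D) (h0 : d.factorial * P.coeff (expo d 0) = 1) :
    Even n ∧ ∀ e ≤ d, (d - e).factorial * e.factorial * P.coeff (expo (d - e) e) =
      (D : ℚ) ^ e * altChoose e n := by
  have hc : c ≠ 0 := by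
    rintro rfl
    have h1 := h 1 hd
    rw [zero_mul, altChoose_one, pow_one, eq_comm, neg_eq_zero] at h1
    have : D * ((n + 1) / 2) = 0 := by exact_mod_cast h1
    rcases mul_eq_zero.mp this with h2 | h2 <;> omega
  have h2 := h 0 (Nat.zero_le d)
  simp only [Nat.sub_zero, Nat.factorial_zero, Nat.cast_one, mul_one, pow_zero, one_mul] at h2
  rw [h0, mul_one, altChoose_zero] at h2
  have hn' : Even n := by
    by_contra hne
    rw [if_neg hne, neg_zero] at h2
    exact hc h2
  rw [if_pos hn'] at h2
  refine ⟨hn', fun e he => ?_⟩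
  have := h e he
  rw [h2] at this
  linarith

end LeadingCoefficients

/-! ### Hilbert functions of graded submodules of free modules -/

section GradedFree

set_option linter.unusedSectionVars false

open DirectSum

variable {k S G : Type*} [Field k] [CommRing S] [Algebra k S] [AddCommGroup G] [LinearOrder G]
  (𝒮 : G → Submodule k S) [GradedAlgebra 𝒮] {ι : Type*}

/-- The piece of `S` of degree `γ`, where `S` is placed in parity zero. -/
def parityPiece (γ : G × ZMod 2) : Submodule k S := if γ.2 = 0 then 𝒮 γ.1 else ⊥

/-- The projection of `S` to its piece of degree `γ`. -/
def parityProj (γ : G × ZMod 2) : S →ₗ[k] S := if γ.2 = 0 then GradedAlgebra.proj 𝒮 γ.1 else 0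

theorem parityProj_mem (γ : G × ZMod 2) (a : S) : parityProj 𝒮 γ a ∈ parityPiece 𝒮 γ := by
  unfold parityProj parityPiece
  split_ifs
  · rw [GradedAlgebra.proj_apply]
    exact (decompose 𝒮 a γ.1).2
  · simp

theorem parityProj_of_mem {γ : G × ZMod 2} {a : S} (ha : a ∈ parityPiece 𝒮 γ) :
    parityProj 𝒮 γ a = a := by
  unfold parityProj
  unfold parityPiece at ha
  split_ifs at ha ⊢
  · rw [GradedAlgebra.proj_apply, decompose_of_mem_same 𝒮 ha]
  · simpa [eq_comm] using ha

theorem parityProj_add_mul_left {s : G} {a : S} (ha : a ∈ 𝒮 s) (γ : G × ZMod 2) (b : S) :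
    parityProj 𝒮 (γ + (s, 0)) (a * b) = a * parityProj 𝒮 γ b := by
  unfold parityProj
  simp only [Prod.snd_add, add_zero, Prod.fst_add]
  split_ifs
  · rw [GradedAlgebra.proj_apply, GradedAlgebra.proj_apply, add_comm,
      coe_decompose_mul_add_of_left_mem 𝒮 ha]
  · simp

theorem parityProj_mul_right {γ : G × ZMod 2} {b : S} (hb : b ∈ parityPiece 𝒮 γ)
    (γ' : G × ZMod 2) (a : S) :
    parityProj 𝒮 (γ' + γ) (a * b) = parityProj 𝒮 γ' a * b := by
  unfold parityPiece at hb
  unfold parityProj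
  split_ifs at hb with h
  · simp only [Prod.snd_add, h, add_zero, Prod.fst_add]
    split_ifs
    · rw [GradedAlgebra.proj_apply, GradedAlgebra.proj_apply,
        coe_decompose_mul_add_of_right_mem 𝒮 hb]
    · simp
  · rw [Submodule.mem_bot] at hb
    simp [hb]

variable (dg : ι → G × ZMod 2)

/-- The homogeneous component of degree `γ` of a vector. -/
def freeComp (γ : G × ZMod 2) : (ι → S) →ₗ[k] (ι → S) :=
  LinearMap.pi fun i => (parityProj 𝒮 (γ - dg i)).comp (LinearMap.proj i)

@[simp] theorem freeComp_apply (γ : G × ZMod 2) (v : ι → S) (i : ι) :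
    freeComp 𝒮 dg γ v i = parityProj 𝒮 (γ - dg i) (v i) := rfl

/-- The homogeneous vectors of degree `γ`. -/
def freePiece (γ : G × ZMod 2) : Submodule k (ι → S) :=
  Submodule.pi Set.univ fun i => parityPiece 𝒮 (γ - dg i)

theorem mem_freePiece {γ : G × ZMod 2} {v : ι → S} :
    v ∈ freePiece 𝒮 dg γ ↔ ∀ i, v i ∈ parityPiece 𝒮 (γ - dg i) := by
  simp [freePiece, Submodule.mem_pi]

theorem freeComp_mem (γ : G × ZMod 2) (v : ι → S) : freeComp 𝒮 dg γ v ∈ freePiece 𝒮 dg γ :=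
  (mem_freePiece 𝒮 dg).mpr fun _ => parityProj_mem _ _ _

theorem freeComp_of_mem {γ : G × ZMod 2} {v : ι → S} (hv : v ∈ freePiece 𝒮 dg γ) :
    freeComp 𝒮 dg γ v = v :=
  funext fun i => parityProj_of_mem 𝒮 ((mem_freePiece 𝒮 dg).mp hv i)

theorem freeComp_add_smul {s : G} {a : S} (ha : a ∈ 𝒮 s) (γ : G × ZMod 2) (v : ι → S) :
    freeComp 𝒮 dg (γ + (s, 0)) (a • v) = a • freeComp 𝒮 dg γ v := by
  ext i
  simp only [freeComp_apply, Pi.smul_apply, smul_eq_mul]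
  rw [← parityProj_add_mul_left 𝒮 ha, sub_add_eq_add_sub]

theorem freeComp_smul_of_mem {γ : G × ZMod 2} {v : ι → S} (hv : v ∈ freePiece 𝒮 dg γ)
    (γ' : G × ZMod 2) (a : S) :
    freeComp 𝒮 dg (γ' + γ) (a • v) = parityProj 𝒮 γ' a • v := by
  ext i
  simp only [freeComp_apply, Pi.smul_apply, smul_eq_mul]
  rw [← parityProj_mul_right 𝒮 ((mem_freePiece 𝒮 dg).mp hv i), add_sub_assoc]

theorem smul_mem_freePiece {s : G} {a : S} (ha : a ∈ 𝒮 s) {γ : G × ZMod 2} {v : ι → S}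
    (hv : v ∈ freePiece 𝒮 dg γ) : a • v ∈ freePiece 𝒮 dg (γ + (s, 0)) := by
  rw [← freeComp_of_mem 𝒮 dg hv, ← freeComp_add_smul 𝒮 dg ha]
  exact freeComp_mem _ _ _ _

theorem exists_sum_freeComp_eq [Fintype ι] (v : ι → S) :
    ∃ F : Finset (G × ZMod 2), ∑ γ ∈ F, freeComp 𝒮 dg γ v = v := by
  classical
  refine ⟨Finset.univ.biUnion fun i =>
    ((decompose 𝒮 (v i)).support.image fun g => ((g, 0) : G × ZMod 2) + dg i), ?_⟩
  ext i
  rw [Finset.sum_apply]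
  simp only [freeComp_apply]
  have h1 : ((decompose 𝒮 (v i)).support.image fun g => ((g, 0) : G × ZMod 2) + dg i) ⊆
      Finset.univ.biUnion fun i =>
        ((decompose 𝒮 (v i)).support.image fun g => ((g, 0) : G × ZMod 2) + dg i) :=
    Finset.subset_biUnion_of_mem
      (fun i => (decompose 𝒮 (v i)).support.image fun g => ((g, 0) : G × ZMod 2) + dg i)
      (Finset.mem_univ i)
  rw [← Finset.sum_subset h1, Finset.sum_image]
  · conv_rhs => rw [← sum_support_decompose 𝒮 (v i)]
    refine Finset.sum_congr rfl fun g _ => ?_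
    rw [add_sub_cancel_right, parityProj, if_pos rfl, GradedAlgebra.proj_apply]
  · intro g _ g' _ h
    simpa using h
  · intro γ _ hγ
    unfold parityProj
    split_ifs with h2
    · rw [GradedAlgebra.proj_apply]
      by_contra h3
      apply hγ
      rw [Finset.mem_image]
      refine ⟨(γ - dg i).1, DFinsupp.mem_support_toFun _ _ |>.mpr fun h4 => h3 (by rw [h4]; rfl), ?_⟩
      have h5 : (((γ - dg i).1, 0) : G × ZMod 2) = γ - dg i := by rw [← h2]
      rw [h5, sub_add_cancel]
    · rfl

/-- A submodule of a free module is graded if it contains the homogeneous components of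
its elements. -/
def IsGradedSub (U : Submodule S (ι → S)) : Prop := ∀ v ∈ U, ∀ γ, freeComp 𝒮 dg γ v ∈ U

/-- The Hilbert function of a submodule of a free module. -/
noncomputable def subHilb (U : Submodule S (ι → S)) (γ : G × ZMod 2) : ℕ :=
  Module.finrank k ↥(U.restrictScalars k ⊓ freePiece 𝒮 dg γ)

theorem IsGradedSub.exists_homogeneous [Fintype ι] {U U' : Submodule S (ι → S)}
    (hU : IsGradedSub 𝒮 dg U) (h : ¬ U ≤ U') :
    ∃ z ∈ U, z ∉ U' ∧ ∃ γ, z ∈ freePiece 𝒮 dg γ := by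
  obtain ⟨v, hv, hv'⟩ := Set.not_subset.mp h
  obtain ⟨F, hF⟩ := exists_sum_freeComp_eq 𝒮 dg v
  by_contra! h1
  apply hv'
  rw [← hF]
  refine Submodule.sum_mem _ fun γ _ => ?_
  by_contra h2
  exact h1 _ (hU v hv γ) h2 γ (freeComp_mem _ _ _ _)

theorem finrank_map_eq_qdim_ker {E E' : Type*} [AddCommGroup E] [Module k E] [AddCommGroup E']
    [Module k E'] (f : E →ₗ[k] E') (V : Submodule k E) [FiniteDimensional k V] :
    Module.finrank k (V.map f) = qdim (LinearMap.ker f) V := by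
  have h := LinearMap.finrank_range_add_finrank_ker (f.comp V.subtype)
  have h1 : LinearMap.range (f.comp V.subtype) = V.map f := by
    rw [LinearMap.range_comp, Submodule.range_subtype]
  have h2 : (LinearMap.ker (f.comp V.subtype)).map V.subtype = V ⊓ LinearMap.ker f := by
    rw [LinearMap.ker_comp, Submodule.map_comap_subtype]
  have h3 := qdim_add_finrank_inf (LinearMap.ker f) V
  rw [h1] at h
  rw [← h2, Submodule.finrank_map_subtype_eq] at h3
  omega

theorem parityPiece_finiteDimensional [∀ g, FiniteDimensional k (𝒮 g)] (γ : G × ZMod 2) :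
    FiniteDimensional k (parityPiece 𝒮 γ) := by
  by_cases h : γ.2 = 0
  · rw [parityPiece, if_pos h]
    infer_instance
  · rw [parityPiece, if_neg h]
    infer_instance

instance freePiece_finiteDimensional [Finite ι] [∀ g, FiniteDimensional k (𝒮 g)]
    (γ : G × ZMod 2) : FiniteDimensional k (freePiece 𝒮 dg γ) := by
  have := fun γ => parityPiece_finiteDimensional 𝒮 γ
  let L : freePiece 𝒮 dg γ →ₗ[k] (∀ i, parityPiece 𝒮 (γ - dg i)) :=
    LinearMap.pi fun i => ((LinearMap.proj i).comp (freePiece 𝒮 dg γ).subtype).codRestrict _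
      fun v => (mem_freePiece 𝒮 dg).mp v.2 i
  refine Module.Finite.of_injective L fun v w h => ?_
  ext i
  exact congrArg Subtype.val (congrFun h i)

/-- Adding a homogeneous generator with homogeneous annihilator modulo `U'` changes the Hilbert
function by that of the cyclic module it generates. -/
theorem subHilb_sup_span [Finite ι] [∀ g, FiniteDimensional k (𝒮 g)] {U' : Submodule S (ι → S)}
    (hU' : IsGradedSub 𝒮 dg U') {z : ι → S} {γ₀ : G × ZMod 2} (hz : z ∈ freePiece 𝒮 dg γ₀)
    (𝔞 : Ideal S) (h𝔞 : ∀ a, a ∈ 𝔞 ↔ a • z ∈ U') (γ : G × ZMod 2) :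
    subHilb 𝒮 dg (U' ⊔ Submodule.span S {z}) γ =
      subHilb 𝒮 dg U' γ + qdim (𝔞.restrictScalars k) (parityPiece 𝒮 (γ - γ₀)) := by
  have := parityPiece_finiteDimensional 𝒮 (γ - γ₀)
  let L : S →ₗ[k] (ι → S) := (LinearMap.toSpanSingleton S (ι → S) z).restrictScalars k
  have hL : ∀ a, L a = a • z := fun a => rfl
  set A := (U' ⊔ Submodule.span S {z}).restrictScalars k ⊓ freePiece 𝒮 dg γ with hA
  have h1 := qdim_add_finrank_inf (U'.restrictScalars k) A
  have h2 : A ⊓ U'.restrictScalars k = U'.restrictScalars k ⊓ freePiece 𝒮 dg γ := by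
    ext v
    simp only [hA, Submodule.mem_inf, Submodule.restrictScalars_mem]
    exact ⟨fun h => ⟨h.2, h.1.2⟩, fun h => ⟨⟨Submodule.mem_sup_left h.1, h.2⟩, h.1⟩⟩
  rw [h2] at h1
  rw [subHilb, subHilb, ← h1, add_comm]
  congr 1
  have h3 : A.map (U'.restrictScalars k).mkQ =
      (parityPiece 𝒮 (γ - γ₀)).map ((U'.restrictScalars k).mkQ.comp L) := by
    ext x
    simp only [Submodule.mem_map, LinearMap.comp_apply]
    constructor
    · rintro ⟨v, hv, rfl⟩
      obtain ⟨u, hu, y, hy, rfl⟩ := Submodule.mem_sup.mp hv.1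
      obtain ⟨a, rfl⟩ := Submodule.mem_span_singleton.mp hy
      refine ⟨_, parityProj_mem 𝒮 (γ - γ₀) a, ?_⟩
      have h4 := freeComp_of_mem 𝒮 dg hv.2
      have h5 := freeComp_smul_of_mem 𝒮 dg hz (γ - γ₀) a
      rw [sub_add_cancel] at h5
      rw [map_add, h5] at h4
      rw [← h4, map_add, hL, right_eq_add]
      exact (Submodule.Quotient.mk_eq_zero _).mpr (hU' u hu γ)
    · rintro ⟨a, ha, rfl⟩
      refine ⟨L a, ⟨Submodule.mem_sup_right (Submodule.mem_span_singleton.mpr ⟨a, rfl⟩), ?_⟩, rfl⟩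
      have h5 := freeComp_smul_of_mem 𝒮 dg hz (γ - γ₀) a
      rw [sub_add_cancel, parityProj_of_mem 𝒮 ha] at h5
      rw [hL, ← h5]
      exact freeComp_mem _ _ _ _
  rw [qdim, h3, finrank_map_eq_qdim_ker]
  congr 1
  ext a
  rw [LinearMap.mem_ker, LinearMap.comp_apply, Submodule.mkQ_apply,
    Submodule.Quotient.mk_eq_zero, Submodule.restrictScalars_mem, hL, ← h𝔞]
  rfl

theorem IsGradedSub.sup_span {U' : Submodule S (ι → S)}
    (hU' : IsGradedSub 𝒮 dg U') {z : ι → S} {γ₀ : G × ZMod 2} (hz : z ∈ freePiece 𝒮 dg γ₀) :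
    IsGradedSub 𝒮 dg (U' ⊔ Submodule.span S {z}) := by
  intro v hv γ
  obtain ⟨u, hu, y, hy, rfl⟩ := Submodule.mem_sup.mp hv
  obtain ⟨a, rfl⟩ := Submodule.mem_span_singleton.mp hy
  have h5 := freeComp_smul_of_mem 𝒮 dg hz (γ - γ₀) a
  rw [sub_add_cancel] at h5
  rw [map_add, h5]
  exact Submodule.add_mem_sup (hU' u hu γ) (Submodule.mem_span_singleton.mpr ⟨_, rfl⟩)

/-- If the cyclic modules `S ⧸ 𝔓` with `𝔓` a homogeneous prime containing `J` have Hilbert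
functions in `𝒞`, then so do all subquotients of graded free modules annihilated by `J`. -/
theorem subHilb_sub_mem [IsOrderedCancelAddMonoid G] [Fintype ι] [∀ g, FiniteDimensional k (𝒮 g)] [IsNoetherianRing S]
    (𝒞 : Submodule ℚ (G → ℚ)) (hshift : ∀ F ∈ 𝒞, ∀ s, (fun g => F (g - s)) ∈ 𝒞) (J : Ideal S)
    (hprime : ∀ 𝔓 : Ideal S, 𝔓.IsPrime → 𝔓.IsHomogeneous 𝒮 → J ≤ 𝔓 →
      (fun g => (qdim (𝔓.restrictScalars k) (𝒮 g) : ℚ)) ∈ 𝒞)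
    {U U' : Submodule S (ι → S)} (hU : IsGradedSub 𝒮 dg U) (hU' : IsGradedSub 𝒮 dg U')
    (hle : U' ≤ U) (hJ : ∀ a ∈ J, ∀ u ∈ U, a • u ∈ U') (p : ZMod 2) :
    (fun g => (subHilb 𝒮 dg U (g, p) - subHilb 𝒮 dg U' (g, p) : ℚ)) ∈ 𝒞 := by
  induction U' using WellFoundedGT.induction with
  | ind U' ih =>
  rcases hle.eq_or_lt with rfl | hlt
  · simp only [sub_self]
    exact 𝒞.zero_mem
  let colon : (ι → S) → Ideal S := fun z => U'.comap (LinearMap.toSpanSingleton S (ι → S) z)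
  have hcolon : ∀ z a, a ∈ colon z ↔ a • z ∈ U' := fun z a => Iff.rfl
  obtain ⟨z₀, hz₀, hz₀', hz₀''⟩ := hU.exists_homogeneous 𝒮 dg (not_le_of_gt hlt)
  obtain ⟨𝔞, ⟨z, hzU, hzU', ⟨γ₀, hzγ⟩, rfl⟩, hmax⟩ := set_has_maximal_iff_noetherian.mpr
    (inferInstance : IsNoetherian S S)
    {𝔞 | ∃ z ∈ U, z ∉ U' ∧ (∃ γ, z ∈ freePiece 𝒮 dg γ) ∧ colon z = 𝔞}
    ⟨_, z₀, hz₀, hz₀', hz₀'', rfl⟩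
  have hhom : (colon z).IsHomogeneous 𝒮 := by
    intro g a ha
    rw [hcolon] at ha ⊢
    have h1 := freeComp_smul_of_mem 𝒮 dg hzγ (g, 0) a
    rw [parityProj, if_pos rfl, GradedAlgebra.proj_apply] at h1
    rw [← h1]
    exact hU' _ ha _
  have hprime' : (colon z).IsPrime := by
    refine hhom.isPrime_of_homogeneous_mem_or_mem (fun h => hzU' ?_) ?_
    · have : (1 : S) ∈ colon z := h ▸ Submodule.mem_top
      rwa [hcolon, one_smul] at this
    · rintro a b ha ⟨g, hb⟩ hab
      by_contra! h
      have h1 : colon z ≤ colon (b • z) := fun x hx => by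
        rw [hcolon] at hx ⊢
        rw [smul_comm]
        exact U'.smul_mem b hx
      have h2 := eq_of_le_of_not_lt h1 (hmax _ ⟨b • z, U.smul_mem b hzU, h.2,
        ⟨_, smul_mem_freePiece 𝒮 dg hb hzγ⟩, rfl⟩)
      apply h.1
      rw [h2, hcolon, smul_smul]
      exact hab
  have h1 := ih (U' ⊔ Submodule.span S {z})
    (left_lt_sup.mpr fun h => hzU' (h (Submodule.mem_span_singleton_self z)))
    (hU'.sup_span 𝒮 dg hzγ)
    (sup_le hle ((Submodule.span_singleton_le_iff_mem _ _).mpr hzU))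
    fun a ha u hu => Submodule.mem_sup_left (hJ a ha u hu)
  have h2 : (fun g => (qdim ((colon z).restrictScalars k)
      (parityPiece 𝒮 ((g, p) - γ₀)) : ℚ)) ∈ 𝒞 := by
    unfold parityPiece
    simp only [Prod.snd_sub, Prod.fst_sub]
    split_ifs
    · exact hshift _ (hprime _ hprime' hhom fun a ha => hJ a ha z hzU) γ₀.1
    · convert 𝒞.zero_mem using 1
      ext g
      simp [qdim]
  convert 𝒞.add_mem h1 h2 using 1
  ext g
  rw [Pi.add_apply, subHilb_sup_span 𝒮 dg hU' hzγ (colon z) (hcolon z)]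
  push_cast
  ring

end GradedFree

/-! ### Exterior algebras of free modules -/

section Koszul

/-- The basis of the exterior algebra of a free module of rank `m`. -/
def KosIndex : ℕ → Type
  | 0 => Unit
  | m + 1 => KosIndex m ⊕ KosIndex m

namespace KosIndex

/-- Basis elements not involving the first basis vector. -/
def lo {m : ℕ} (i : KosIndex m) : KosIndex (m + 1) := (Sum.inl i : KosIndex m ⊕ KosIndex m)

/-- Basis elements involving the first basis vector. -/
def hi {m : ℕ} (i : KosIndex m) : KosIndex (m + 1) := (Sum.inr i : KosIndex m ⊕ KosIndex m)

instance instFintype : ∀ m, Fintype (KosIndex m)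
  | 0 => inferInstanceAs (Fintype Unit)
  | m + 1 =>
    have := instFintype m
    inferInstanceAs (Fintype (KosIndex m ⊕ KosIndex m))

theorem forall_succ {m : ℕ} {p : KosIndex (m + 1) → Prop} :
    (∀ i, p i) ↔ (∀ i, p (lo i)) ∧ ∀ i, p (hi i) := Sum.forall

/-- A vector given by its two halves. -/
def join {S : Type*} {m : ℕ} (α β : KosIndex m → S) : KosIndex (m + 1) → S :=
  fun i => Sum.elim (α := KosIndex m) (β := KosIndex m) α β i

@[simp] theorem join_lo {S : Type*} {m : ℕ} (α β : KosIndex m → S) (i : KosIndex m) :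
    join α β (lo i) = α i := rfl

@[simp] theorem join_hi {S : Type*} {m : ℕ} (α β : KosIndex m → S) (i : KosIndex m) :
    join α β (hi i) = β i := rfl

end KosIndex

open KosIndex

theorem KosIndex.ext_halves {S : Type*} {m : ℕ} {v w : KosIndex (m + 1) → S}
    (h : v ∘ lo = w ∘ lo) (h' : v ∘ hi = w ∘ hi) : v = w :=
  funext (forall_succ.mpr ⟨congrFun h, congrFun h'⟩)

variable {S : Type*} [CommRing S]

/-- Left multiplication by the vector `(t c, t (c + 1), …)` on an exterior algebra. -/
def kosWedge (t : ℕ → S) : (m c : ℕ) → (KosIndex m → S) →ₗ[S] (KosIndex m → S)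
  | 0, _ => 0
  | m + 1, c => LinearMap.pi fun i => Sum.elim (α := KosIndex m) (β := KosIndex m)
      (fun i => (LinearMap.proj i).comp ((kosWedge t m (c + 1)).comp (LinearMap.funLeft S S lo)))
      (fun i => t c • LinearMap.proj (lo i) -
        (LinearMap.proj i).comp ((kosWedge t m (c + 1)).comp (LinearMap.funLeft S S hi))) i

/-- Contraction with the linear form `(l c, l (c + 1), …)` on an exterior algebra. -/
def kosContract (l : ℕ → S) : (m c : ℕ) → (KosIndex m → S) →ₗ[S] (KosIndex m → S)
  | 0, _ => 0
  | m + 1, c => LinearMap.pi fun i => Sum.elim (α := KosIndex m) (β := KosIndex m)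
      (fun i => (LinearMap.proj i).comp ((kosContract l m (c + 1)).comp (LinearMap.funLeft S S lo))
        + l c • LinearMap.proj (hi i))
      (fun i => -
        (LinearMap.proj i).comp ((kosContract l m (c + 1)).comp (LinearMap.funLeft S S hi))) i

theorem kosWedge_comp_lo (t : ℕ → S) (m c : ℕ) (v : KosIndex (m + 1) → S) :
    kosWedge t (m + 1) c v ∘ lo = kosWedge t m (c + 1) (v ∘ lo) := rfl

theorem kosWedge_comp_hi (t : ℕ → S) (m c : ℕ) (v : KosIndex (m + 1) → S) :
    kosWedge t (m + 1) c v ∘ hi = t c • (v ∘ lo) - kosWedge t m (c + 1) (v ∘ hi) := rfl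

theorem kosContract_comp_lo (l : ℕ → S) (m c : ℕ) (v : KosIndex (m + 1) → S) :
    kosContract l (m + 1) c v ∘ lo = kosContract l m (c + 1) (v ∘ lo) + l c • (v ∘ hi) := rfl

theorem kosContract_comp_hi (l : ℕ → S) (m c : ℕ) (v : KosIndex (m + 1) → S) :
    kosContract l (m + 1) c v ∘ hi = -kosContract l m (c + 1) (v ∘ hi) := rfl

theorem kosWedge_kosWedge_add (s t : ℕ → S) : ∀ (m c : ℕ) (v : KosIndex m → S),
    kosWedge s m c (kosWedge t m c v) + kosWedge t m c (kosWedge s m c v) = 0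
  | 0, _, _ => add_zero 0
  | m + 1, c, v => by
    have h1 := kosWedge_kosWedge_add s t m (c + 1) (v ∘ lo)
    have h2 := kosWedge_kosWedge_add s t m (c + 1) (v ∘ hi)
    refine KosIndex.ext_halves h1 ?_
    change (kosWedge s (m + 1) c (kosWedge t (m + 1) c v)) ∘ hi +
      (kosWedge t (m + 1) c (kosWedge s (m + 1) c v)) ∘ hi = 0
    rw [kosWedge_comp_hi, kosWedge_comp_hi, kosWedge_comp_hi, kosWedge_comp_hi, kosWedge_comp_lo,
      kosWedge_comp_lo, map_sub, map_sub, map_smul, map_smul]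
    linear_combination (exp := 1) h2

theorem kosWedge_kosWedge_self (t : ℕ → S) : ∀ (m c : ℕ) (v : KosIndex m → S),
    kosWedge t m c (kosWedge t m c v) = 0
  | 0, _, _ => rfl
  | m + 1, c, v => by
    refine KosIndex.ext_halves (kosWedge_kosWedge_self t m (c + 1) (v ∘ lo)) ?_
    rw [kosWedge_comp_hi, kosWedge_comp_hi, kosWedge_comp_lo, map_sub, map_smul,
      kosWedge_kosWedge_self t m (c + 1) (v ∘ hi), sub_zero, sub_self]
    rfl

theorem kosContract_kosContract (l : ℕ → S) : ∀ (m c : ℕ) (v : KosIndex m → S),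
    kosContract l m c (kosContract l m c v) = 0
  | 0, _, _ => rfl
  | m + 1, c, v => by
    refine KosIndex.ext_halves ?_ ?_
    · rw [kosContract_comp_lo, kosContract_comp_lo, kosContract_comp_hi, map_add, map_smul,
        kosContract_kosContract l m (c + 1), smul_neg, zero_add, add_neg_cancel]
      rfl
    · rw [kosContract_comp_hi, kosContract_comp_hi, map_neg,
        kosContract_kosContract l m (c + 1), neg_zero, neg_zero]
      rfl

/-- Multiplication by a vector and contraction with a form anticommute up to the pairing. -/
theorem kosWedge_kosContract_add (t l : ℕ → S) : ∀ (m c : ℕ) (v : KosIndex m → S),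
    kosWedge t m c (kosContract l m c v) + kosContract l m c (kosWedge t m c v) =
      (∑ i ∈ Finset.range m, t (c + i) * l (c + i)) • v
  | 0, _, v => by simp [kosWedge, kosContract]
  | m + 1, c, v => by
    have h1 := kosWedge_kosContract_add t l m (c + 1) (v ∘ lo)
    have h2 := kosWedge_kosContract_add t l m (c + 1) (v ∘ hi)
    have h3 : ∑ i ∈ Finset.range (m + 1), t (c + i) * l (c + i) =
        ∑ i ∈ Finset.range m, t (c + 1 + i) * l (c + 1 + i) + t c * l c := by
      rw [Finset.sum_range_succ', add_zero]
      simp only [add_assoc, add_comm 1]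
    rw [h3, add_smul]
    generalize ∑ i ∈ Finset.range m, t (c + 1 + i) * l (c + 1 + i) = a at h1 h2 ⊢
    refine KosIndex.ext_halves ?_ ?_
    · change (kosWedge t (m + 1) c (kosContract l (m + 1) c v)) ∘ lo +
        (kosContract l (m + 1) c (kosWedge t (m + 1) c v)) ∘ lo = a • (v ∘ lo) + (t c * l c) • (v ∘ lo)
      rw [← h1, kosWedge_comp_lo, kosContract_comp_lo, kosContract_comp_lo, kosWedge_comp_lo,
        kosWedge_comp_hi, map_add, map_smul, smul_sub, smul_smul, mul_comm (t c)]
      abel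
    · change (kosWedge t (m + 1) c (kosContract l (m + 1) c v)) ∘ hi +
        (kosContract l (m + 1) c (kosWedge t (m + 1) c v)) ∘ hi = a • (v ∘ hi) + (t c * l c) • (v ∘ hi)
      rw [← h2, kosWedge_comp_hi, kosContract_comp_lo, kosContract_comp_hi, kosContract_comp_hi,
        kosWedge_comp_hi, map_neg, map_sub, map_smul, smul_add, smul_smul]
      abel

theorem kosWedge_mem_pi (t : ℕ → S) (𝔞 : Ideal S) : ∀ (m c : ℕ) (v : KosIndex m → S),
    (∀ i, v i ∈ 𝔞) → ∀ i, kosWedge t m c v i ∈ 𝔞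
  | 0, _, _, _ => fun _ => 𝔞.zero_mem
  | m + 1, c, v, hv => forall_succ.mpr
      ⟨kosWedge_mem_pi t 𝔞 m (c + 1) (v ∘ lo) fun i => hv (lo i), fun i =>
        𝔞.sub_mem (𝔞.mul_mem_left _ (hv (lo i)))
          (kosWedge_mem_pi t 𝔞 m (c + 1) (v ∘ hi) (fun i => hv (hi i)) i)⟩

end Koszul

/-! ### Hilbert functions of Koszul complexes -/

section KoszulHilbert

set_option linter.unusedSectionVars false

open DirectSum KosIndex

variable {k S G : Type*} [Field k] [CommRing S] [Algebra k S] [AddCommGroup G] [LinearOrder G]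
  (𝒮 : G → Submodule k S) [GradedAlgebra 𝒮]

/-- Degrees of the basis elements of an exterior algebra whose generators have degree `ε`. -/
def kosDeg (ε : G × ZMod 2) : (m : ℕ) → KosIndex m → G × ZMod 2
  | 0, _ => 0
  | m + 1, i => Sum.elim (α := KosIndex m) (β := KosIndex m) (kosDeg ε m)
      (fun i => kosDeg ε m i + ε) i

@[simp] theorem kosDeg_lo (ε : G × ZMod 2) {m : ℕ} (i : KosIndex m) :
    kosDeg ε (m + 1) (lo i) = kosDeg ε m i := rfl

@[simp] theorem kosDeg_hi (ε : G × ZMod 2) {m : ℕ} (i : KosIndex m) :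
    kosDeg ε (m + 1) (hi i) = kosDeg ε m i + ε := rfl

theorem freeComp_comp_lo (ε γ : G × ZMod 2) (m : ℕ) (v : KosIndex (m + 1) → S) :
    freeComp 𝒮 (kosDeg ε (m + 1)) γ v ∘ lo = freeComp 𝒮 (kosDeg ε m) γ (v ∘ lo) := rfl

theorem freeComp_comp_hi (ε γ : G × ZMod 2) (m : ℕ) (v : KosIndex (m + 1) → S) :
    freeComp 𝒮 (kosDeg ε (m + 1)) γ v ∘ hi = freeComp 𝒮 (kosDeg ε m) (γ - ε) (v ∘ hi) := by
  ext i
  simp only [Function.comp_apply, freeComp_apply, kosDeg_hi]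
  rw [sub_sub, add_comm ε]

theorem mem_freePiece_kosDeg_succ {ε γ : G × ZMod 2} {m : ℕ} {v : KosIndex (m + 1) → S} :
    v ∈ freePiece 𝒮 (kosDeg ε (m + 1)) γ ↔
      v ∘ lo ∈ freePiece 𝒮 (kosDeg ε m) γ ∧ v ∘ hi ∈ freePiece 𝒮 (kosDeg ε m) (γ - ε) := by
  simp only [mem_freePiece, forall_succ, kosDeg_lo, kosDeg_hi, Function.comp_apply, sub_sub,
    add_comm ε]

theorem kosWedge_freeComp {t : ℕ → S} {τ e : G} (ht : ∀ i, t i ∈ 𝒮 τ) :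
    ∀ (m c : ℕ) (γ : G × ZMod 2) (v : KosIndex m → S),
    kosWedge t m c (freeComp 𝒮 (kosDeg (e, 1) m) γ v) =
      freeComp 𝒮 (kosDeg (e, 1) m) (γ + (e, 1) + (τ, 0)) (kosWedge t m c v)
  | 0, _, _, _ => (map_zero _).symm
  | m + 1, c, γ, v => by
    have h1 : γ + (e, 1) + (τ, 0) - (e, 1) = γ + (τ, 0) := by abel
    refine KosIndex.ext_halves ?_ ?_
    · rw [kosWedge_comp_lo, freeComp_comp_lo, freeComp_comp_lo, kosWedge_freeComp ht,
        kosWedge_comp_lo]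
    · rw [kosWedge_comp_hi, freeComp_comp_hi, freeComp_comp_lo, freeComp_comp_hi,
        kosWedge_freeComp ht, kosWedge_comp_hi, map_sub, sub_add_cancel, h1,
        freeComp_add_smul 𝒮 _ (ht c)]

theorem kosContract_freeComp {l : ℕ → S} {e : G} (hl : ∀ i, l i ∈ 𝒮 e) :
    ∀ (m c : ℕ) (γ : G × ZMod 2) (v : KosIndex m → S),
    kosContract l m c (freeComp 𝒮 (kosDeg (e, 1) m) γ v) =
      freeComp 𝒮 (kosDeg (e, 1) m) (γ + (0, 1)) (kosContract l m c v)
  | 0, _, _, _ => (map_zero _).symm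
  | m + 1, c, γ, v => by
    have h1 : γ + (0, 1) = γ - (e, 1) + (e, 0) := by
      ext
      · simp
      · simp [sub_eq_add_neg, ZMod.neg_eq_self_mod_two]
    refine KosIndex.ext_halves ?_ ?_
    · rw [kosContract_comp_lo, freeComp_comp_lo, freeComp_comp_lo, freeComp_comp_hi,
        kosContract_freeComp hl, kosContract_comp_lo, map_add,
        ← freeComp_add_smul 𝒮 _ (hl c), h1]
    · rw [kosContract_comp_hi, freeComp_comp_hi, freeComp_comp_hi,
        kosContract_freeComp hl, kosContract_comp_hi, map_neg, sub_add_eq_add_sub]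

theorem finrank_map_add_finrank_inf_ker {E E' : Type*} [AddCommGroup E] [Module k E]
    [AddCommGroup E'] [Module k E'] (f : E →ₗ[k] E') (V : Submodule k E) [FiniteDimensional k V] :
    Module.finrank k (V.map f) + Module.finrank k ↥(V ⊓ LinearMap.ker f) = Module.finrank k V := by
  rw [finrank_map_eq_qdim_ker, qdim_add_finrank_inf]

/-- Additivity of Hilbert functions for the projection to the second half. -/
theorem subHilb_kosDeg_succ [∀ g, FiniteDimensional k (𝒮 g)] {ε : G × ZMod 2} {m : ℕ}
    {U : Submodule S (KosIndex (m + 1) → S)} {A B : Submodule S (KosIndex m → S)}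
    (hA : ∀ α, α ∈ A ↔ join α 0 ∈ U) (hB : ∀ v ∈ U, v ∘ hi ∈ B) (γ : G × ZMod 2)
    (hB' : ∀ β ∈ B, β ∈ freePiece 𝒮 (kosDeg ε m) (γ - ε) →
      ∃ α ∈ freePiece 𝒮 (kosDeg ε m) γ, join α β ∈ U) :
    subHilb 𝒮 (kosDeg ε (m + 1)) U γ =
      subHilb 𝒮 (kosDeg ε m) A γ + subHilb 𝒮 (kosDeg ε m) B (γ - ε) := by
  let f : (KosIndex (m + 1) → S) →ₗ[k] (KosIndex m → S) := LinearMap.funLeft k S hi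
  let j : (KosIndex m → S) →ₗ[k] (KosIndex (m + 1) → S) :=
    { toFun := fun α => join α 0
      map_add' := fun α β => KosIndex.ext_halves rfl (add_zero 0).symm
      map_smul' := fun a α => KosIndex.ext_halves rfl (smul_zero a).symm }
  have hj : Function.Injective j := fun α α' h => congrArg (· ∘ lo) h
  have hker : U.restrictScalars k ⊓ freePiece 𝒮 (kosDeg ε (m + 1)) γ ⊓ LinearMap.ker f =
      (A.restrictScalars k ⊓ freePiece 𝒮 (kosDeg ε m) γ).map j := by
    ext v
    simp only [Submodule.mem_inf, Submodule.mem_map, LinearMap.mem_ker,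
      Submodule.restrictScalars_mem, mem_freePiece_kosDeg_succ]
    constructor
    · rintro ⟨⟨h1, h2, _⟩, h4⟩
      have h5 : join (v ∘ lo) 0 = v := KosIndex.ext_halves rfl h4.symm
      exact ⟨v ∘ lo, ⟨(hA _).mpr (h5 ▸ h1), h2⟩, h5⟩
    · rintro ⟨α, ⟨h1, h2⟩, rfl⟩
      exact ⟨⟨(hA _).mp h1, h2, Submodule.zero_mem _⟩, rfl⟩
  have hmap : (U.restrictScalars k ⊓ freePiece 𝒮 (kosDeg ε (m + 1)) γ).map f =
      B.restrictScalars k ⊓ freePiece 𝒮 (kosDeg ε m) (γ - ε) := by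
    ext β
    simp only [Submodule.mem_inf, Submodule.mem_map,
      Submodule.restrictScalars_mem, mem_freePiece_kosDeg_succ]
    constructor
    · rintro ⟨v, ⟨h1, h2, h3⟩, rfl⟩
      exact ⟨hB v h1, h3⟩
    · rintro ⟨h1, h2⟩
      obtain ⟨α, h3, h4⟩ := hB' β h1 h2
      exact ⟨join α β, ⟨h4, h3, h2⟩, rfl⟩
  rw [subHilb, ← finrank_map_add_finrank_inf_ker f, hker, hmap, add_comm,
    ← (Submodule.equivMapOfInjective j hj _).finrank_eq]
  rfl

/-- Vectors with entries in an ideal. -/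
def idealVec (𝔞 : Ideal S) (m : ℕ) : Submodule S (KosIndex m → S) :=
  Submodule.pi Set.univ fun _ => 𝔞

theorem mem_idealVec {𝔞 : Ideal S} {m : ℕ} {v : KosIndex m → S} :
    v ∈ idealVec 𝔞 m ↔ ∀ i, v i ∈ 𝔞 := by
  simp [idealVec, Submodule.mem_pi]

theorem mem_idealVec_succ {𝔞 : Ideal S} {m : ℕ} {v : KosIndex (m + 1) → S} :
    v ∈ idealVec 𝔞 (m + 1) ↔ v ∘ lo ∈ idealVec 𝔞 m ∧ v ∘ hi ∈ idealVec 𝔞 m := by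
  simp only [mem_idealVec, forall_succ, Function.comp_apply]

theorem freeComp_mem_idealVec {𝔞 : Ideal S} (h𝔞 : 𝔞.IsHomogeneous 𝒮) {m : ℕ}
    {dg : KosIndex m → G × ZMod 2} {v : KosIndex m → S} (hv : v ∈ idealVec 𝔞 m)
    (γ : G × ZMod 2) : freeComp 𝒮 dg γ v ∈ idealVec 𝔞 m := by
  rw [mem_idealVec] at hv ⊢
  intro i
  rw [freeComp_apply, parityProj]
  split_ifs
  · exact h𝔞 _ (hv i)
  · exact 𝔞.zero_mem

theorem subHilb_idealVec_succ [∀ g, FiniteDimensional k (𝒮 g)] (ε : G × ZMod 2) (𝔞 : Ideal S)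
    (m : ℕ) (γ : G × ZMod 2) : subHilb 𝒮 (kosDeg ε (m + 1)) (idealVec 𝔞 (m + 1)) γ =
      subHilb 𝒮 (kosDeg ε m) (idealVec 𝔞 m) γ +
        subHilb 𝒮 (kosDeg ε m) (idealVec 𝔞 m) (γ - ε) := by
  refine subHilb_kosDeg_succ 𝒮 (fun α => ?_) (fun v hv => (mem_idealVec_succ.mp hv).2) γ
    fun β hβ _ => ⟨0, Submodule.zero_mem _, ?_⟩
  · rw [mem_idealVec_succ]
    exact ⟨fun h => ⟨h, Submodule.zero_mem _⟩, fun h => h.1⟩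
  · rw [mem_idealVec_succ]
    exact ⟨Submodule.zero_mem _, hβ⟩

/-- Vectors whose product with `(t c, t (c + 1), …)` has entries in `𝔞`. -/
def wedgeColon (t : ℕ → S) (𝔞 : Ideal S) (m c : ℕ) : Submodule S (KosIndex m → S) :=
  (idealVec 𝔞 m).comap (kosWedge t m c)

theorem subHilb_wedgeColon_succ [∀ g, FiniteDimensional k (𝒮 g)] {t : ℕ → S} {τ e : G}
    (ht : ∀ i, t i ∈ 𝒮 τ) {𝔞 𝔟 : Ideal S} (h𝔞 : 𝔞.IsHomogeneous 𝒮) (m c : ℕ)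
    (h𝔟 : 𝔟 = 𝔞 ⊔ Ideal.span {t c}) (hreg : ∀ a, t c * a ∈ 𝔞 → a ∈ 𝔞) (γ : G × ZMod 2) :
    subHilb 𝒮 (kosDeg (e, 1) (m + 1)) (wedgeColon t 𝔞 (m + 1) c) γ =
      subHilb 𝒮 (kosDeg (e, 1) m) (idealVec 𝔞 m) γ +
        subHilb 𝒮 (kosDeg (e, 1) m) (wedgeColon t 𝔟 m (c + 1)) (γ - (e, 1)) := by
  have h𝔟mem : ∀ a, a ∈ 𝔟 ↔ ∃ b, a - t c * b ∈ 𝔞 := by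
    intro a
    rw [h𝔟, Submodule.mem_sup]
    constructor
    · rintro ⟨x, hx, y, hy, rfl⟩
      obtain ⟨b, rfl⟩ := Ideal.mem_span_singleton'.mp hy
      exact ⟨b, by rwa [mul_comm b, add_sub_cancel_right]⟩
    · rintro ⟨b, hb⟩
      exact ⟨_, hb, t c * b, Ideal.mem_span_singleton.mpr (dvd_mul_right _ _), by ring⟩
  have hmem : ∀ v, v ∈ wedgeColon t 𝔞 (m + 1) c ↔
      kosWedge t m (c + 1) (v ∘ lo) ∈ idealVec 𝔞 m ∧
      t c • (v ∘ lo) - kosWedge t m (c + 1) (v ∘ hi) ∈ idealVec 𝔞 m := by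
    intro v
    rw [wedgeColon, Submodule.mem_comap, mem_idealVec_succ, kosWedge_comp_lo, kosWedge_comp_hi]
  have hreg' : ∀ v : KosIndex m → S, t c • v ∈ idealVec 𝔞 m → v ∈ idealVec 𝔞 m := by
    intro v hv
    rw [mem_idealVec] at hv ⊢
    exact fun i => hreg _ (hv i)
  refine subHilb_kosDeg_succ 𝒮 (fun α => ?_) (fun v hv => ?_) γ fun β hβ hβγ => ?_
  · rw [hmem]
    change _ ↔ kosWedge t m (c + 1) α ∈ _ ∧ t c • α - kosWedge t m (c + 1) 0 ∈ _
    rw [map_zero, sub_zero]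
    refine ⟨fun h => ⟨?_, Submodule.smul_mem _ _ h⟩, fun h => hreg' _ h.2⟩
    rw [mem_idealVec] at h ⊢
    exact kosWedge_mem_pi t 𝔞 m (c + 1) α h
  · obtain ⟨_, h2⟩ := (hmem v).mp hv
    rw [wedgeColon, Submodule.mem_comap, mem_idealVec]
    rw [mem_idealVec] at h2
    refine fun i => (h𝔟mem _).mpr ⟨v (lo i), ?_⟩
    rw [← neg_sub]
    exact 𝔞.neg_mem (h2 i)
  · rw [wedgeColon, Submodule.mem_comap, mem_idealVec] at hβ
    choose a ha using fun i => (h𝔟mem _).mp (hβ i)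
    have h1 : t c • a - kosWedge t m (c + 1) β ∈ idealVec 𝔞 m := by
      rw [mem_idealVec]
      intro i
      have := 𝔞.neg_mem (ha i)
      rwa [neg_sub] at this
    have h2 : t c • freeComp 𝒮 (kosDeg (e, 1) m) γ a - kosWedge t m (c + 1) β ∈
        idealVec 𝔞 m := by
      have h3 := freeComp_mem_idealVec 𝒮 h𝔞 (dg := kosDeg (e, 1) m) h1 (γ + (τ, 0))
      have h4 := kosWedge_freeComp 𝒮 (e := e) ht m (c + 1) (γ - (e, 1)) β
      rw [freeComp_of_mem 𝒮 _ hβγ, sub_add_cancel] at h4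
      rwa [map_sub, freeComp_add_smul 𝒮 _ (ht c), ← h4] at h3
    refine ⟨_, freeComp_mem 𝒮 (kosDeg (e, 1) m) γ a, (hmem _).mpr ⟨hreg' _ ?_, h2⟩⟩
    rw [← map_smul]
    have h5 := mem_idealVec.mpr (kosWedge_mem_pi t 𝔞 m (c + 1) _ (mem_idealVec.mp h2))
    rwa [map_sub, kosWedge_kosWedge_self, sub_zero] at h5

theorem subHilb_kosDeg_zero (ε : G × ZMod 2) (U : Submodule S (KosIndex 0 → S)) (𝔞 : Ideal S)
    (hU : ∀ v, v ∈ U ↔ v () ∈ 𝔞) (g : G) :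
    subHilb 𝒮 (kosDeg ε 0) U (g, 0) = Module.finrank k ↥(𝔞.restrictScalars k ⊓ 𝒮 g) ∧
    subHilb 𝒮 (kosDeg ε 0) U (g, 1) = 0 := by
  let j : S →ₗ[k] (KosIndex 0 → S) := LinearMap.pi fun _ => LinearMap.id
  have hj : Function.Injective j := fun a b h => congrFun h ()
  have h1 : ∀ γ, U.restrictScalars k ⊓ freePiece 𝒮 (kosDeg ε 0) γ =
      (𝔞.restrictScalars k ⊓ parityPiece 𝒮 γ).map j := by
    intro γ
    ext v
    simp only [Submodule.mem_inf, Submodule.mem_map, Submodule.restrictScalars_mem, mem_freePiece,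
      kosDeg, sub_zero, hU]
    constructor
    · rintro ⟨h1, h2⟩
      exact ⟨v (), ⟨h1, h2 ()⟩, rfl⟩
    · rintro ⟨a, ⟨h1, h2⟩, rfl⟩
      exact ⟨h1, fun _ => h2⟩
  rw [subHilb, subHilb, h1, h1, ← (Submodule.equivMapOfInjective j hj _).finrank_eq,
    ← (Submodule.equivMapOfInjective j hj _).finrank_eq, parityPiece, parityPiece, if_pos rfl,
    if_neg (show ¬ ((g, (1 : ZMod 2)) : G × ZMod 2).2 = 0 from one_ne_zero), inf_bot_eq,
    finrank_bot]
  exact ⟨rfl, rfl⟩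

end KoszulHilbert

section KoszulEuler

set_option linter.unusedSectionVars false

open DirectSum KosIndex

variable {k S : Type*} [Field k] [CommRing S] [Algebra k S]
  (𝒮 : Bideg → Submodule k S) [GradedAlgebra 𝒮] [∀ g, FiniteDimensional k (𝒮 g)]

/-- The difference of the Hilbert functions of the even and of the odd part. -/
noncomputable def eulerHilb {ι : Type*} (dg : ι → Bideg × ZMod 2) (U : Submodule S (ι → S))
    (g : Bideg) : ℚ := subHilb 𝒮 dg U (g, 0) - subHilb 𝒮 dg U (g, 1)

theorem eulerHilb_succ {e : Bideg} {m : ℕ} {U : Submodule S (KosIndex (m + 1) → S)}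
    {A B : Submodule S (KosIndex m → S)}
    (h : ∀ γ, subHilb 𝒮 (kosDeg (e, 1) (m + 1)) U γ =
      subHilb 𝒮 (kosDeg (e, 1) m) A γ + subHilb 𝒮 (kosDeg (e, 1) m) B (γ - (e, 1))) :
    eulerHilb 𝒮 (kosDeg (e, 1) (m + 1)) U =
      eulerHilb 𝒮 (kosDeg (e, 1) m) A - shiftEnd e (eulerHilb 𝒮 (kosDeg (e, 1) m) B) := by
  ext g
  rw [Pi.sub_apply, shiftEnd_apply, eulerHilb, eulerHilb, eulerHilb, h, h]
  rw [show ((g, 0) : Bideg × ZMod 2) - (e, 1) = (g - e, 1) from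
      Prod.ext rfl (show (0 : ZMod 2) - 1 = 1 by decide),
    show ((g, 1) : Bideg × ZMod 2) - (e, 1) = (g - e, 0) from
      Prod.ext rfl (sub_self (1 : ZMod 2))]
  push_cast
  ring

theorem eulerHilb_idealVec (e : Bideg) (𝔞 : Ideal S) (m : ℕ) :
    eulerHilb 𝒮 (kosDeg (e, 1) m) (idealVec 𝔞 m) =
      (nablaEnd e ^ m) fun g => (Module.finrank k ↥(𝔞.restrictScalars k ⊓ 𝒮 g) : ℚ) := by
  induction m with
  | zero =>
    ext g
    have h := subHilb_kosDeg_zero 𝒮 (e, 1) (idealVec 𝔞 0) 𝔞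
      (fun v => mem_idealVec.trans ⟨fun h => h (), fun h _ => h⟩) g
    simp [eulerHilb, h.1, h.2]
  | succ m ih =>
    rw [eulerHilb_succ 𝒮 (subHilb_idealVec_succ 𝒮 (e, 1) 𝔞 m), ih, pow_succ']
    rfl

/-- The Euler characteristic of the kernel of multiplication by a vector whose entries form a
regular sequence. -/
theorem eulerHilb_wedgeColon {t : ℕ → S} {τ e : Bideg} (ht : ∀ i, t i ∈ 𝒮 τ) {N : ℕ}
    (𝔞 : ℕ → Ideal S) (h𝔞 : ∀ c, (𝔞 c).IsHomogeneous 𝒮)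
    (hsucc : ∀ c, 𝔞 (c + 1) = 𝔞 c ⊔ Ideal.span {t c})
    (hreg : ∀ c < N, ∀ a, t c * a ∈ 𝔞 c → a ∈ 𝔞 c) : ∀ m c : ℕ, c + m ≤ N →
    eulerHilb 𝒮 (kosDeg (e, 1) m) (wedgeColon t (𝔞 c) m c) =
      (nablaEnd e ^ m) (fun g => (Module.finrank k (𝒮 g) : ℚ)) -
      ∑ i ∈ Finset.range m, ((-shiftEnd e) ^ i) ((nablaEnd e ^ (m - 1 - i))
        fun g => (qdim ((𝔞 (c + i)).restrictScalars k) (𝒮 g) : ℚ)) := by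
  intro m
  induction m with
  | zero =>
    intro c _
    ext g
    have h := subHilb_kosDeg_zero 𝒮 (e, 1) (wedgeColon t (𝔞 c) 0 c) ⊤
      (fun v => iff_of_true (show _ ∈ wedgeColon _ _ _ _ from
        (Submodule.zero_mem (idealVec (𝔞 c) 0) :)) Submodule.mem_top) g
    rw [Submodule.restrictScalars_top, top_inf_eq] at h
    simp [eulerHilb, h.1, h.2]
  | succ m ih =>
    intro c hc
    rw [eulerHilb_succ 𝒮 (subHilb_wedgeColon_succ 𝒮 ht (h𝔞 c) m c (hsucc c)
      (hreg c (by omega))), ih (c + 1) (by omega), eulerHilb_idealVec, Finset.sum_range_succ']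
    have h1 : (fun g => (Module.finrank k ↥((𝔞 c).restrictScalars k ⊓ 𝒮 g) : ℚ)) =
        (fun g => (Module.finrank k (𝒮 g) : ℚ)) -
          fun g => (qdim ((𝔞 c).restrictScalars k) (𝒮 g) : ℚ) := by
      ext g
      rw [Pi.sub_apply, ← qdim_add_finrank_inf ((𝔞 c).restrictScalars k) (𝒮 g), inf_comm]
      push_cast
      ring
    have h2 : ∑ i ∈ Finset.range m, ((-shiftEnd e) ^ (i + 1)) ((nablaEnd e ^ (m + 1 - 1 - (i + 1)))
        fun g => (qdim ((𝔞 (c + (i + 1))).restrictScalars k) (𝒮 g) : ℚ)) =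
        (-shiftEnd e) (∑ i ∈ Finset.range m, ((-shiftEnd e) ^ i) ((nablaEnd e ^ (m - 1 - i))
        fun g => (qdim ((𝔞 (c + 1 + i)).restrictScalars k) (𝒮 g) : ℚ))) := by
      rw [map_sum]
      refine Finset.sum_congr rfl fun i _ => ?_
      rw [pow_succ', Module.End.mul_apply, show m + 1 - 1 - (i + 1) = m - 1 - i by omega,
        show c + (i + 1) = c + 1 + i by ring]
    rw [h1, h2, map_sub, map_sub, pow_succ', Module.End.mul_apply, pow_zero,
      Module.End.one_apply]
    simp only [LinearMap.neg_apply, add_tsub_cancel_right, tsub_zero, add_zero]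
    conv_rhs => rw [nablaEnd, LinearMap.sub_apply, Module.End.one_apply]
    rw [← nablaEnd]
    abel

/-- The Euler characteristic of the kernel of multiplication by a vector `t` agrees, up to
Hilbert functions of subquotients annihilated by the `l i`, with zero, for every vector `l`
orthogonal to `t`. -/
theorem eulerHilb_ker_mem [IsNoetherianRing S] {t l : ℕ → S} {τ e : Bideg}
    (ht : ∀ i, t i ∈ 𝒮 τ) (hl : ∀ i, l i ∈ 𝒮 e) {N : ℕ}
    (htl : ∑ i ∈ Finset.range N, t i * l i = 0)
    (𝒞 : Submodule ℚ (Bideg → ℚ)) (hshift : ∀ F ∈ 𝒞, ∀ s, (fun g => F (g - s)) ∈ 𝒞)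
    (hprime : ∀ 𝔓 : Ideal S, 𝔓.IsPrime → 𝔓.IsHomogeneous 𝒮 → (∀ i < N, l i ∈ 𝔓) →
      (fun g => (qdim (𝔓.restrictScalars k) (𝒮 g) : ℚ)) ∈ 𝒞) :
    eulerHilb 𝒮 (kosDeg (e, 1) N) (LinearMap.ker (kosWedge t N 0)) ∈ 𝒞 := by
  set dg := kosDeg ((e, 1) : Bideg × ZMod 2) N
  set Q := LinearMap.ker (kosWedge t N 0) with hQ
  have hQg : IsGradedSub 𝒮 dg Q := by
    intro v hv γ
    rw [hQ, LinearMap.mem_ker] at hv ⊢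
    rw [kosWedge_freeComp 𝒮 ht, hv, map_zero]
  have hlQ : ∀ v ∈ Q, kosContract l N 0 v ∈ Q := by
    intro v hv
    have h1 := kosWedge_kosContract_add t l N 0 v
    simp only [zero_add, htl, zero_smul] at h1
    rw [LinearMap.mem_ker.mp hv, map_zero, add_zero] at h1
    exact LinearMap.mem_ker.mpr h1
  set Z := LinearMap.ker (kosContract l N 0) ⊓ Q
  set B := Q.map (kosContract l N 0)
  have hZg : IsGradedSub 𝒮 dg Z := by
    intro v hv γ
    refine ⟨?_, hQg v hv.2 γ⟩
    have h1 := hv.1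
    rw [SetLike.mem_coe, LinearMap.mem_ker] at h1 ⊢
    rw [kosContract_freeComp 𝒮 hl, h1, map_zero]
  have hBg : IsGradedSub 𝒮 dg B := by
    rintro _ ⟨v, hv, rfl⟩ γ
    refine ⟨freeComp 𝒮 dg (γ - (0, 1)) v, hQg v hv _, ?_⟩
    rw [kosContract_freeComp 𝒮 hl, sub_add_cancel]
  have hBZ : B ≤ Z := by
    rintro _ ⟨v, hv, rfl⟩
    exact ⟨kosContract_kosContract l N 0 v, hlQ v hv⟩
  have hJ : ∀ a ∈ Ideal.span (l '' Set.Iio N), ∀ u ∈ Z, a • u ∈ B := by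
    intro a ha u hu
    have h1 : Ideal.span (l '' Set.Iio N) ≤ B.comap (LinearMap.toSpanSingleton S _ u) := by
      rw [Ideal.span_le]
      rintro _ ⟨i, hi, rfl⟩
      refine ⟨kosWedge (Pi.single i 1) N 0 u, ?_, ?_⟩
      · have h2 := kosWedge_kosWedge_add t (Pi.single i 1) N 0 u
        rw [LinearMap.mem_ker.mp hu.2, map_zero, add_zero] at h2
        exact LinearMap.mem_ker.mpr h2
      · have h2 := kosWedge_kosContract_add (Pi.single i 1) l N 0 u
        rw [LinearMap.mem_ker.mp hu.1, map_zero, zero_add] at h2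
        rw [h2, Finset.sum_eq_single i]
        · simp
        · intro j _ hj
          simp [hj]
        · intro h
          exact absurd (Finset.mem_range.mpr hi) h
    exact h1 ha
  have hdim : ∀ g p, subHilb 𝒮 dg Q (g, p) = subHilb 𝒮 dg Z (g, p) + subHilb 𝒮 dg B (g, p + 1) := by
    intro g p
    rw [subHilb, ← finrank_map_add_finrank_inf_ker ((kosContract l N 0).restrictScalars k),
      add_comm]
    congr 1
    · rw [subHilb]
      have : Q.restrictScalars k ⊓ freePiece 𝒮 dg (g, p) ⊓
          LinearMap.ker ((kosContract l N 0).restrictScalars k) =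
          Z.restrictScalars k ⊓ freePiece 𝒮 dg (g, p) := by
        ext v
        exact ⟨fun h => ⟨⟨h.2, h.1.1⟩, h.1.2⟩, fun h => ⟨⟨h.1.2, h.2⟩, h.1.1⟩⟩
      rw [this]
    · rw [subHilb]
      have : (Q.restrictScalars k ⊓ freePiece 𝒮 dg (g, p)).map
          ((kosContract l N 0).restrictScalars k) =
          B.restrictScalars k ⊓ freePiece 𝒮 dg (g, p + 1) := by
        have h0 : ((g, p + 1) : Bideg × ZMod 2) = (g, p) + (0, 1) :=
          Prod.ext (add_zero g).symm rfl
        ext w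
        constructor
        · rintro ⟨v, ⟨h1, h2⟩, rfl⟩
          refine ⟨⟨v, h1, rfl⟩, ?_⟩
          have h3 := kosContract_freeComp 𝒮 hl N 0 (g, p) v
          rw [freeComp_of_mem 𝒮 _ h2, ← h0] at h3
          rw [LinearMap.restrictScalars_apply, h3]
          exact freeComp_mem _ _ _ _
        · rintro ⟨⟨v, h1, rfl⟩, h2⟩
          refine ⟨freeComp 𝒮 dg (g, p) v, ⟨hQg v h1 _, freeComp_mem _ _ _ _⟩, ?_⟩
          have h3 := kosContract_freeComp 𝒮 hl N 0 (g, p) v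
          rw [← h0, freeComp_of_mem 𝒮 _ h2] at h3
          exact h3
      rw [this]
  have hmem := fun p => subHilb_sub_mem 𝒮 dg 𝒞 hshift _ (fun 𝔓 h1 h2 (h3 : Ideal.span (l '' Set.Iio N) ≤ 𝔓) =>
    hprime 𝔓 h1 h2 fun i hi => h3 (Ideal.subset_span ⟨i, hi, rfl⟩)) hZg hBg hBZ hJ p
  convert 𝒞.sub_mem (hmem 0) (hmem 1) using 1
  ext g
  rw [Pi.sub_apply, eulerHilb, hdim, hdim, zero_add, show (1 : ZMod 2) + 1 = 0 by decide]
  push_cast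
  ring

end KoszulEuler

section BigradedRing

open MvPolynomial

/-- The degrees of the variables of `k[x₀,…,x_d,T₀,…,T_n]`. -/
def biWeight (d n : ℕ) : Fin (d + 1) ⊕ Fin (n + 1) → Bideg :=
  Sum.elim (fun _ => toLex (1, 0)) fun _ => toLex (0, 1)

theorem weight_biWeight {d n : ℕ} (s : Fin (d + 1) ⊕ Fin (n + 1) →₀ ℕ) :
    Finsupp.weight (biWeight d n) s =
      toLex (((∑ i, s (Sum.inl i) : ℕ) : ℤ), ((∑ i, s (Sum.inr i) : ℕ) : ℤ)) := by
  have h1 : ∀ (ι : Type) (S : Finset ι) (f : ι → ℕ) (a b : ℤ),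
      ∑ i ∈ S, f i • (toLex (a, b) : Bideg) =
        toLex ((∑ i ∈ S, f i : ℕ) * a, (∑ i ∈ S, f i : ℕ) * b) := by
    intro ι S f a b
    rw [← Finset.sum_smul]
    change toLex ((∑ i ∈ S, f i) • (a, b)) = _
    rw [Prod.smul_mk, nsmul_eq_mul, nsmul_eq_mul]
  rw [Finsupp.weight_eq_sum, Fintype.sum_sum_type]
  simp only [biWeight, Sum.elim_inl, Sum.elim_inr]
  rw [h1, h1]
  refine congrArg toLex ((Prod.mk_add_mk _ _ _ _).trans ?_)
  rw [mul_zero, mul_zero, mul_one, mul_one, add_zero, zero_add]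

variable (k : Type*) [Field k] (d n : ℕ)

/-- The bigraded pieces of `k[x₀,…,x_d,T₀,…,T_n]`. -/
noncomputable def biPiece (g : Bideg) : Submodule k (MvPolynomial (Fin (d + 1) ⊕ Fin (n + 1)) k) :=
  weightedHomogeneousSubmodule k (biWeight d n) g

noncomputable instance gradedAlgebra_biPiece : GradedAlgebra (biPiece k d n) :=
  weightedGradedAlgebra k (biWeight d n)

variable {k d n}

theorem mem_biPiece {g : Bideg} {x : MvPolynomial (Fin (d + 1) ⊕ Fin (n + 1)) k} :
    x ∈ biPiece k d n g ↔ ∀ s ∈ x.support, Finsupp.weight (biWeight d n) s = g := by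
  rw [biPiece, mem_weightedHomogeneousSubmodule, IsWeightedHomogeneous]
  simp only [mem_support_iff]

theorem biPiece_eq_restrictSupport (g : Bideg) :
    biPiece k d n g = restrictSupport k {s | Finsupp.weight (biWeight d n) s = g} := by
  ext x
  rw [mem_biPiece, mem_restrictSupport_iff]
  exact Iff.rfl

theorem finite_biWeight_eq (g : Bideg) :
    {s : Fin (d + 1) ⊕ Fin (n + 1) →₀ ℕ | Finsupp.weight (biWeight d n) s = g}.Finite := by
  refine (Finsupp.finite_of_degree_le (σ := Fin (d + 1) ⊕ Fin (n + 1))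
    ((ofLex g).1 + (ofLex g).2).toNat).subset ?_
  rintro s rfl
  rw [weight_biWeight, Set.mem_ofPred_eq, Finsupp.degree_eq_sum, Fintype.sum_sum_type]
  simp only [ofLex_toLex]
  omega

instance finiteDimensional_biPiece (g : Bideg) : FiniteDimensional k (biPiece k d n g) := by
  rw [biPiece_eq_restrictSupport]
  have := (finite_biWeight_eq (d := d) (n := n) g).to_subtype
  exact Module.Finite.of_basis (basisRestrictSupport k _)

theorem finrank_restrictSupport {σ : Type*} (s : Set (σ →₀ ℕ)) :
    Module.finrank k (restrictSupport k s) = s.ncard :=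
  Module.finrank_eq_nat_card_basis (basisRestrictSupport k s)

variable (k d n) in
/-- The ideal generated by the first `c` of the variables `T₀,…,T_n`. -/
noncomputable def varIdeal (c : ℕ) : Ideal (MvPolynomial (Fin (d + 1) ⊕ Fin (n + 1)) k) :=
  Ideal.span (X '' (Sum.inr '' {i | i.val < c}))

theorem mem_varIdeal {c : ℕ} {x : MvPolynomial (Fin (d + 1) ⊕ Fin (n + 1)) k} :
    x ∈ varIdeal k d n c ↔ ∀ s ∈ x.support, ∃ i : Fin (n + 1), i.val < c ∧ s (Sum.inr i) ≠ 0 := by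
  rw [varIdeal, mem_ideal_span_X_image]
  simp

variable (k d n) in
/-- The variables `T₀,…,T_n`. -/
noncomputable def tVar (i : ℕ) : MvPolynomial (Fin (d + 1) ⊕ Fin (n + 1)) k :=
  if h : i < n + 1 then X (Sum.inr ⟨i, h⟩) else 0

theorem X_inr_mem (i : Fin (n + 1)) :
    (X (Sum.inr i) : MvPolynomial (Fin (d + 1) ⊕ Fin (n + 1)) k) ∈
      biPiece k d n (toLex (0, 1)) :=
  isWeightedHomogeneous_X k (biWeight d n) (Sum.inr i)

theorem tVar_mem (i : ℕ) : tVar k d n i ∈ biPiece k d n (toLex (0, 1)) := by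
  rw [tVar]
  split_ifs
  · exact X_inr_mem _
  · exact Submodule.zero_mem _

theorem varIdeal_zero : varIdeal k d n 0 = ⊥ := by
  simp [varIdeal]

theorem varIdeal_succ (c : ℕ) :
    varIdeal k d n (c + 1) = varIdeal k d n c ⊔ Ideal.span {tVar k d n c} := by
  rw [varIdeal, varIdeal, ← Ideal.span_union]
  apply le_antisymm
  · rw [Ideal.span_le]
    rintro _ ⟨_, ⟨i, hi, rfl⟩, rfl⟩
    rcases Nat.lt_succ_iff_lt_or_eq.mp hi with h | h
    · exact Ideal.subset_span (Or.inl ⟨_, ⟨i, h, rfl⟩, rfl⟩)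
    · refine Ideal.subset_span (Or.inr ?_)
      subst h
      rw [Set.mem_singleton_iff, tVar, dif_pos i.2]
  · rw [Ideal.span_le]
    rintro x (⟨_, ⟨i, hi, rfl⟩, rfl⟩ | hx)
    · exact Ideal.subset_span ⟨_, ⟨i, Nat.lt_succ_of_lt hi, rfl⟩, rfl⟩
    · rw [Set.mem_singleton_iff.mp hx, tVar]
      split_ifs with h
      · exact Ideal.subset_span ⟨_, ⟨⟨c, h⟩, Nat.lt_succ_self c, rfl⟩, rfl⟩
      · exact Ideal.zero_mem _

theorem isHomogeneous_varIdeal (c : ℕ) : (varIdeal k d n c).IsHomogeneous (biPiece k d n) := by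
  refine Ideal.homogeneous_span _ _ ?_
  rintro _ ⟨_, ⟨i, _, rfl⟩, rfl⟩
  exact ⟨_, X_inr_mem i⟩

theorem mem_varIdeal_of_mul_mem {c : ℕ} (hc : c < n + 1)
    (a : MvPolynomial (Fin (d + 1) ⊕ Fin (n + 1)) k)
    (h : tVar k d n c * a ∈ varIdeal k d n c) : a ∈ varIdeal k d n c := by
  rw [tVar, dif_pos hc, mem_varIdeal] at h
  rw [mem_varIdeal]
  intro s hs
  obtain ⟨i, hi, hsi⟩ := h (Finsupp.single (Sum.inr ⟨c, hc⟩) 1 + s) (by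
    rw [mem_support_iff, coeff_X_mul]
    exact mem_support_iff.mp hs)
  refine ⟨i, hi, ?_⟩
  rwa [Finsupp.add_apply, Finsupp.single_eq_of_ne, zero_add] at hsi
  intro h1
  rw [Sum.inr.inj h1] at hi
  exact lt_irrefl _ hi

theorem ncard_biWeight_eq (c j q : ℕ) (hc : c ≤ n) :
    {s | Finsupp.weight (biWeight d n) s = toLex ((j : ℤ), (q : ℤ)) ∧
      ∀ i : Fin (n + 1), i.val < c → s (Sum.inr i) = 0}.ncard =
    (j + d).choose d * (q + (n - c)).choose (n - c) := by
  classical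
  have h1 : {s | Finsupp.weight (biWeight d n) s = toLex ((j : ℤ), (q : ℤ)) ∧
      ∀ i : Fin (n + 1), i.val < c → s (Sum.inr i) = 0} =
      Finsupp.sumFinsuppEquivProdFinsupp ⁻¹'
        ((Finset.univ.finsuppAntidiag j ×ˢ
          (Finset.univ.filter fun i : Fin (n + 1) => c ≤ i.val).finsuppAntidiag q :
          Finset ((Fin (d + 1) →₀ ℕ) × (Fin (n + 1) →₀ ℕ))) : Set _) := by
    ext s
    simp only [Set.mem_ofPred_eq, Set.mem_preimage, Finset.mem_coe, Finset.mem_product,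
      Finset.mem_finsuppAntidiag, Finset.subset_univ, and_true, weight_biWeight,
      Finsupp.fst_sumFinsuppEquivProdFinsupp, Finsupp.snd_sumFinsuppEquivProdFinsupp]
    have h2 : (Finsupp.sumFinsuppEquivProdFinsupp s).2.support ⊆
        (Finset.univ.filter fun i : Fin (n + 1) => c ≤ i.val) ↔
        ∀ i : Fin (n + 1), i.val < c → s (Sum.inr i) = 0 := by
      constructor
      · intro h i hi
        by_contra h3
        have := h (Finsupp.mem_support_iff.mpr h3)
        simp at this
        omega
      · intro h i hi
        simp only [Finset.mem_filter, Finset.mem_univ, true_and]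
        by_contra h3
        exact Finsupp.mem_support_iff.mp hi (h i (by omega))
    rw [h2, ← and_assoc]
    refine and_congr_left fun h3 => ?_
    rw [Finset.sum_filter_of_ne]
    · rw [toLex_inj, Prod.mk.injEq, Nat.cast_inj, Nat.cast_inj]
      exact Iff.rfl
    · intro i _ hi
      by_contra h4
      exact hi (h3 i (by omega))
  have h3 : (Finset.univ.filter fun i : Fin (n + 1) => c ≤ i.val).card = n + 1 - c := by
    have h4 := Finset.card_filter_add_card_filter_not (s := (Finset.univ : Finset (Fin (n + 1))))
      (fun i => c ≤ i.val)
    have h5 : (Finset.univ.filter fun i : Fin (n + 1) => ¬ c ≤ i.val).card = c := by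
      simp only [not_le]
      rw [Fin.card_filter_val_lt]
      omega
    rw [h5, Finset.card_univ, Fintype.card_fin] at h4
    omega
  rw [h1, Set.ncard_preimage_of_injective_subset_range (Equiv.injective _)
    (by rw [Equiv.range_eq_univ]; exact Set.subset_univ _), Set.ncard_coe_finset,
    Finset.card_product, Finset.card_finsuppAntidiag_nat_eq_choose,
    Finset.card_finsuppAntidiag_nat_eq_choose, h3, Finset.card_univ, Fintype.card_fin,
    show d + 1 + j - 1 = j + d by omega, show n + 1 - c + q - 1 = q + (n - c) by omega,
    Nat.choose_symm_add, Nat.choose_symm_add]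

theorem qdim_varIdeal (c j q : ℕ) (hc : c ≤ n) :
    qdim ((varIdeal k d n c).restrictScalars k) (biPiece k d n (toLex ((j : ℤ), (q : ℤ)))) =
      (j + d).choose d * (q + (n - c)).choose (n - c) := by
  have h1 := qdim_add_finrank_inf ((varIdeal k d n c).restrictScalars k)
    (biPiece k d n (toLex ((j : ℤ), (q : ℤ))))
  set A := {s : Fin (d + 1) ⊕ Fin (n + 1) →₀ ℕ | Finsupp.weight (biWeight d n) s = toLex ((j : ℤ), (q : ℤ))} with hA
  set B := {s : Fin (d + 1) ⊕ Fin (n + 1) →₀ ℕ |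
      Finsupp.weight (biWeight d n) s = toLex ((j : ℤ), (q : ℤ)) ∧
      ∀ i : Fin (n + 1), i.val < c → s (Sum.inr i) = 0} with hB
  have h2 : biPiece k d n (toLex ((j : ℤ), (q : ℤ))) ⊓ (varIdeal k d n c).restrictScalars k =
      restrictSupport k (A \ B) := by
    ext x
    rw [Submodule.mem_inf, mem_biPiece, Submodule.restrictScalars_mem, mem_varIdeal,
      mem_restrictSupport_iff, ← forall₂_and]
    refine forall₂_congr fun s _ => ?_
    rw [Set.mem_sdiff, hA, hB, Set.mem_ofPred_eq, Set.mem_ofPred_eq]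
    push Not
    exact and_congr_right fun h => ⟨fun h' _ => h', fun h' => h' h⟩
  have hBA : B ⊆ A := fun s hs => hs.1
  have h3 := Set.ncard_sdiff_add_ncard_of_subset hBA (finite_biWeight_eq _)
  rw [h2, biPiece_eq_restrictSupport, finrank_restrictSupport, finrank_restrictSupport,
    ← hA] at h1
  rw [← ncard_biWeight_eq c j q hc, ← hB, biPiece_eq_restrictSupport, ← hA]
  omega

theorem qdim_varIdeal_eventuallyEq (c : ℕ) (hc : c ≤ n) :
    (fun g => (qdim ((varIdeal k d n c).restrictScalars k) (biPiece k d n g) : ℚ)) =ᶠ[bigBideg]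
      binomProd (d + 1) (n - c + 1) := by
  refine eventually_bigBideg.mpr ⟨0, fun j q hj hq => ?_⟩
  lift j to ℕ using hj
  lift q to ℕ using hq
  simp only [qdim_varIdeal c j q hc]
  have h1 : Bideg.fst (toLex ((j : ℤ), (q : ℤ))) = (j : ℚ) := Int.cast_natCast j
  have h2 : Bideg.snd (toLex ((j : ℤ), (q : ℤ))) = (q : ℚ) := Int.cast_natCast q
  rw [binomProd, h1, h2, shiftedBinom, shiftedBinom, risingBinom_natCast, risingBinom_natCast]
  push_cast
  rfl

theorem finrank_biPiece_eventuallyEq :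
    (fun g => (Module.finrank k (biPiece k d n g) : ℚ)) =ᶠ[bigBideg] binomProd (d + 1) (n + 1) := by
  have h1 := qdim_varIdeal_eventuallyEq (k := k) (d := d) (n := n) 0 (Nat.zero_le n)
  rw [varIdeal_zero] at h1
  refine Filter.EventuallyEq.trans (Filter.Eventually.of_forall fun g => ?_) h1
  have h2 := qdim_add_finrank_inf ((⊥ : Ideal _).restrictScalars k) (biPiece k d n g)
  rw [Submodule.restrictScalars_bot, inf_bot_eq, finrank_bot, add_zero] at h2
  rw [Submodule.restrictScalars_bot, h2]

end BigradedRing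

section ReesMap

open MvPolynomial

variable {k : Type*} [Field k] {d n : ℕ}

/-- The map `k[x,T] → k[x][t]` sending `T_b` to `f_b t`, whose image is the Rees algebra. -/
noncomputable def reesMap (f : Fin (n + 1) → MvPolynomial (Fin (d + 1)) k) :
    MvPolynomial (Fin (d + 1) ⊕ Fin (n + 1)) k →ₐ[k] Polynomial (MvPolynomial (Fin (d + 1)) k) :=
  aeval (Sum.elim (fun i => Polynomial.C (X i)) fun b => Polynomial.C (f b) * Polynomial.X)

theorem reesMap_monomial (f : Fin (n + 1) → MvPolynomial (Fin (d + 1)) k)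
    (s : Fin (d + 1) ⊕ Fin (n + 1) →₀ ℕ) (a : k) :
    reesMap f (monomial s a) = Polynomial.monomial (∑ b, s (Sum.inr b))
      (C a * ((∏ i, X i ^ s (Sum.inl i)) * ∏ b, f b ^ s (Sum.inr b))) := by
  rw [reesMap, aeval_monomial, Finsupp.prod_fintype _ _ (fun _ => pow_zero _),
    Fintype.prod_sum_type]
  simp only [Sum.elim_inl, Sum.elim_inr, mul_pow, Finset.prod_mul_distrib,
    Finset.prod_pow_eq_pow_sum]
  rw [← Polynomial.C_mul_X_pow_eq_monomial, Polynomial.C_mul, Polynomial.C_mul, map_prod, map_prod]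
  simp only [map_pow]
  rw [mul_assoc, mul_assoc]
  rfl

theorem reesMap_rename (f : Fin (n + 1) → MvPolynomial (Fin (d + 1)) k)
    (r : MvPolynomial (Fin (d + 1)) k) :
    reesMap f (rename Sum.inl r) = Polynomial.C r := by
  have h : (reesMap f).comp (rename Sum.inl) =
      (Polynomial.CAlgHom : MvPolynomial (Fin (d + 1)) k →ₐ[k] _) := by
    ext i
    simp [reesMap]
  exact DFunLike.congr_fun h r

theorem reesMap_X_inr (f : Fin (n + 1) → MvPolynomial (Fin (d + 1)) k) (b : Fin (n + 1)) :
    reesMap f (X (Sum.inr b)) = Polynomial.C (f b) * Polynomial.X := by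
  simp [reesMap]

theorem isHomogeneous_reesMap_coeff {δ : ℕ} {f : Fin (n + 1) → MvPolynomial (Fin (d + 1)) k}
    (hf : ∀ b, (f b).IsHomogeneous δ) (s : Fin (d + 1) ⊕ Fin (n + 1) →₀ ℕ) (a : k) :
    (C a * ((∏ i, X i ^ s (Sum.inl i)) * ∏ b, f b ^ s (Sum.inr b)) :
      MvPolynomial (Fin (d + 1)) k).IsHomogeneous
      (∑ i, s (Sum.inl i) + (∑ b, s (Sum.inr b)) * δ) := by
  have h1 : (∏ i, X i ^ s (Sum.inl i) : MvPolynomial (Fin (d + 1)) k).IsHomogeneous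
      (∑ i, s (Sum.inl i)) :=
    IsHomogeneous.prod _ _ _ fun i _ => by
      simpa using (isHomogeneous_X k i).pow (s (Sum.inl i))
  have h2 : (∏ b, f b ^ s (Sum.inr b)).IsHomogeneous ((∑ b, s (Sum.inr b)) * δ) := by
    rw [Finset.sum_mul]
    refine IsHomogeneous.prod _ _ _ fun b _ => ?_
    rw [mul_comm]
    exact (hf b).pow _
  simpa using (isHomogeneous_C _ a).mul (h1.mul h2)

theorem reesMap_coeff_mem (f : Fin (n + 1) → MvPolynomial (Fin (d + 1)) k)
    (x : MvPolynomial (Fin (d + 1) ⊕ Fin (n + 1)) k) (q : ℕ) :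
    (reesMap f x).coeff q ∈ Ideal.span (Set.range f) ^ q := by
  suffices h : reesMap f x ∈ reesAlgebra (Ideal.span (Set.range f)) from h q
  induction x using MvPolynomial.induction_on with
  | C a =>
    have : (C a : MvPolynomial (Fin (d + 1) ⊕ Fin (n + 1)) k) = rename Sum.inl (C a) := by simp
    rw [this, reesMap_rename]
    exact (reesAlgebra _).algebraMap_mem _
  | add x y hx hy => rw [map_add]; exact add_mem hx hy
  | mul_X x i hx =>
    rw [map_mul]
    refine mul_mem hx ?_
    rcases i with i | b
    · rw [← rename_X, reesMap_rename]
      exact (reesAlgebra _).algebraMap_mem _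
    · rw [reesMap_X_inr, Polynomial.C_mul_X_eq_monomial, reesAlgebra.monomial_mem, pow_one]
      exact Ideal.subset_span ⟨b, rfl⟩

theorem exists_reesMap_eq (f : Fin (n + 1) → MvPolynomial (Fin (d + 1)) k) (q : ℕ) :
    ∀ r ∈ Ideal.span (Set.range f) ^ q, ∃ x, reesMap f x = Polynomial.monomial q r := by
  induction q with
  | zero => exact fun r _ => ⟨rename Sum.inl r, reesMap_rename f r⟩
  | succ q ih =>
    intro r hr
    rw [pow_succ'] at hr
    induction hr using Submodule.mul_induction_on' with
    | mem_mul_mem a ha b hb =>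
      obtain ⟨c, rfl⟩ := (Ideal.mem_span_range_iff_exists_fun).mp ha
      obtain ⟨x, hx⟩ := ih b hb
      refine ⟨(∑ i, rename Sum.inl (c i) * X (Sum.inr i)) * x, ?_⟩
      rw [map_mul, hx, map_sum]
      simp only [map_mul, reesMap_rename, reesMap_X_inr]
      rw [← Polynomial.C_mul_X_pow_eq_monomial, ← Polynomial.C_mul_X_pow_eq_monomial,
        Polynomial.C_mul, map_sum, Finset.sum_mul, Finset.sum_mul, Finset.sum_mul]
      refine Finset.sum_congr rfl fun i _ => ?_
      rw [Polynomial.C_mul]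
      ring
    | add a _ b _ h1 h2 =>
      obtain ⟨x, hx⟩ := h1
      obtain ⟨y, hy⟩ := h2
      exact ⟨x + y, by rw [map_add, hx, hy, map_add]⟩

theorem homogeneousComponent_reesMap_coeff {δ : ℕ}
    {f : Fin (n + 1) → MvPolynomial (Fin (d + 1)) k} (hf : ∀ b, (f b).IsHomogeneous δ) (j q : ℕ)
    (x : MvPolynomial (Fin (d + 1) ⊕ Fin (n + 1)) k) :
    homogeneousComponent (j + q * δ) ((reesMap f x).coeff q) =
      (reesMap f (GradedRing.proj (biPiece k d n) (toLex ((j : ℤ), (q : ℤ))) x)).coeff q := by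
  induction x using MvPolynomial.induction_on' with
  | add x y hx hy => simp only [map_add, Polynomial.coeff_add, hx, hy]
  | monomial s a =>
    have hmem : monomial s a ∈ biPiece k d n (Finsupp.weight (biWeight d n) s) :=
      isWeightedHomogeneous_monomial (biWeight d n) s a rfl
    rw [GradedRing.proj_apply]
    by_cases hs : Finsupp.weight (biWeight d n) s = toLex ((j : ℤ), (q : ℤ))
    · rw [hs] at hmem
      rw [weight_biWeight, toLex_inj, Prod.mk.injEq, Nat.cast_inj, Nat.cast_inj] at hs
      rw [DirectSum.decompose_of_mem_same _ hmem, reesMap_monomial, ← hs.1, ← hs.2,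
        Polynomial.coeff_monomial_same, homogeneousComponent_of_mem
          (isHomogeneous_reesMap_coeff hf s a), if_pos rfl]
    · rw [DirectSum.decompose_of_mem_ne _ hmem hs, map_zero, Polynomial.coeff_zero,
        reesMap_monomial, Polynomial.coeff_monomial]
      split_ifs with h
      · rw [homogeneousComponent_of_mem (isHomogeneous_reesMap_coeff hf s a), if_neg]
        intro h1
        rw [← h] at h1
        refine hs ?_
        rw [weight_biWeight, ← h, show j = ∑ i, s (Sum.inl i) by omega]
      · rw [map_zero]

theorem reesMap_eq_monomial {q : ℕ} {j : ℤ} {f : Fin (n + 1) → MvPolynomial (Fin (d + 1)) k}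
    {x : MvPolynomial (Fin (d + 1) ⊕ Fin (n + 1)) k}
    (hx : x ∈ biPiece k d n (toLex (j, (q : ℤ)))) :
    reesMap f x = Polynomial.monomial q ((reesMap f x).coeff q) := by
  ext1 m
  rw [Polynomial.coeff_monomial]
  split_ifs with h
  · rw [h]
  · rw [as_sum x, map_sum, Polynomial.finsetSum_coeff]
    refine Finset.sum_eq_zero fun s hs => ?_
    have h1 := mem_biPiece.mp hx s hs
    rw [weight_biWeight, toLex_inj, Prod.mk.injEq, Nat.cast_inj] at h1
    rw [reesMap_monomial, Polynomial.coeff_monomial, if_neg (by rw [h1.2]; exact h)]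

theorem qdim_ker_reesMap {δ : ℕ} {f : Fin (n + 1) → MvPolynomial (Fin (d + 1)) k}
    (hf : ∀ b, (f b).IsHomogeneous δ) (j q : ℕ) :
    qdim ((RingHom.ker (reesMap f)).restrictScalars k)
      (biPiece k d n (toLex ((j : ℤ), (q : ℤ)))) =
    Module.finrank k ↥((Ideal.span (Set.range f) ^ q).restrictScalars k ⊓
      homogeneousSubmodule (Fin (d + 1)) k (j + q * δ)) := by
  have h1 : (RingHom.ker (reesMap f)).restrictScalars k = LinearMap.ker (reesMap f).toLinearMap := by
    ext x
    exact Iff.rfl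
  have hinj : Function.Injective ((Polynomial.monomial q : MvPolynomial (Fin (d + 1)) k →ₗ[_]
      Polynomial (MvPolynomial (Fin (d + 1)) k)).restrictScalars k) :=
    Polynomial.monomial_injective q
  rw [h1, ← finrank_map_eq_qdim_ker, (Submodule.equivMapOfInjective _ hinj _).finrank_eq]
  have : (biPiece k d n (toLex ((j : ℤ), (q : ℤ)))).map (reesMap f).toLinearMap =
      ((Ideal.span (Set.range f) ^ q).restrictScalars k ⊓
        homogeneousSubmodule (Fin (d + 1)) k (j + q * δ)).map
        ((Polynomial.monomial q : MvPolynomial (Fin (d + 1)) k →ₗ[_]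
          Polynomial (MvPolynomial (Fin (d + 1)) k)).restrictScalars k) := by
    ext y
    constructor
    · rintro ⟨x, hx, rfl⟩
      refine ⟨(reesMap f x).coeff q, ⟨reesMap_coeff_mem f x q, ?_⟩, (reesMap_eq_monomial hx).symm⟩
      have h2 := homogeneousComponent_reesMap_coeff hf j q x
      rw [GradedRing.proj_apply, DirectSum.decompose_of_mem_same _ hx] at h2
      rw [← h2]
      exact homogeneousComponent_mem _ _
    · rintro ⟨r, ⟨hr, hr'⟩, rfl⟩
      obtain ⟨x, hx⟩ := exists_reesMap_eq f q r hr
      have h3 : GradedRing.proj (biPiece k d n) (toLex ((j : ℤ), (q : ℤ))) x ∈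
          biPiece k d n (toLex ((j : ℤ), (q : ℤ))) := by
        rw [GradedRing.proj_apply]
        exact SetLike.coe_mem _
      refine ⟨_, h3, ?_⟩
      have h2 := homogeneousComponent_reesMap_coeff hf j q x
      rw [hx, Polynomial.coeff_monomial_same, homogeneousComponent_of_mem hr', if_pos rfl] at h2
      rw [AlgHom.toLinearMap_apply, reesMap_eq_monomial h3, ← h2]
      rfl
  rw [this]

end ReesMap

section GrowthComparison

open Asymptotics Filter

theorem GrowthLT.of_le {e : ℕ} {F F' : Bideg → ℚ} (h : GrowthLT e F') (h0 : ∀ g, 0 ≤ F g)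
    (hle : F ≤ᶠ[bigBideg] F') : GrowthLT e F := by
  refine IsBigO.trans (IsBigO.of_bound 1 ?_) h
  filter_upwards [hle] with g hg
  rw [one_mul, norm_mul, norm_mul]
  refine mul_le_mul_of_nonneg_right ?_ (norm_nonneg _)
  rw [← Rat.norm_cast_real, ← Rat.norm_cast_real, Real.norm_eq_abs, Real.norm_eq_abs]
  exact abs_le_abs_of_nonneg (by exact_mod_cast h0 g) (by exact_mod_cast hg)

end GrowthComparison

section PrimesOffBase

open MvPolynomial

variable {k : Type*} [Field k]

theorem qdim_eq_add_of_le {E : Type*} [AddCommGroup E] [Module k E] {W W' : Submodule k E}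
    (h : W ≤ W') (V : Submodule k E) [FiniteDimensional k V] :
    qdim W V = qdim W' V + qdim W (V ⊓ W') := by
  have : FiniteDimensional k ↥(V ⊓ W') := Submodule.finiteDimensional_of_le inf_le_left
  have h1 := qdim_add_finrank_inf W V
  have h2 := qdim_add_finrank_inf W' V
  have h3 := qdim_add_finrank_inf W (V ⊓ W')
  rw [inf_assoc, inf_eq_right.mpr h] at h3
  omega

variable {d n : ℕ}

/-- The form `∑ v_b T_b` attached to a vector `v` of polynomials. -/
noncomputable def symForm (v : Fin (n + 1) → MvPolynomial (Fin (d + 1)) k) :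
    MvPolynomial (Fin (d + 1) ⊕ Fin (n + 1)) k :=
  ∑ b, rename Sum.inl (v b) * X (Sum.inr b)

theorem ker_reesMap_le {f : Fin (n + 1) → MvPolynomial (Fin (d + 1)) k}
    {𝔓 : Ideal (MvPolynomial (Fin (d + 1) ⊕ Fin (n + 1)) k)} [𝔓.IsPrime]
    (hlin : ∀ v, ∑ b, v b * f b = 0 → symForm v ∈ 𝔓) {a : Fin (n + 1)}
    (ha : rename Sum.inl (f a) ∉ 𝔓) : RingHom.ker (reesMap f) ≤ 𝔓 := by
  classical
  let K := FractionRing (MvPolynomial (Fin (d + 1) ⊕ Fin (n + 1)) k ⧸ 𝔓)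
  let π : MvPolynomial (Fin (d + 1) ⊕ Fin (n + 1)) k →+* K :=
    (algebraMap (MvPolynomial (Fin (d + 1) ⊕ Fin (n + 1)) k ⧸ 𝔓) K).comp (Ideal.Quotient.mk 𝔓)
  have hπ : ∀ x, π x = 0 ↔ x ∈ 𝔓 := by
    intro x
    rw [← Ideal.Quotient.eq_zero_iff_mem]
    exact map_eq_zero_iff _ (IsFractionRing.injective
      (MvPolynomial (Fin (d + 1) ⊕ Fin (n + 1)) k ⧸ 𝔓) K)
  let θ : Polynomial (MvPolynomial (Fin (d + 1)) k) →+* K :=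
    Polynomial.eval₂RingHom (π.comp (rename Sum.inl : MvPolynomial (Fin (d + 1)) k →ₐ[k] _).toRingHom)
      (π (X (Sum.inr a)) / π (rename Sum.inl (f a)))
  have hfa : π (rename Sum.inl (f a)) ≠ 0 := fun h => ha ((hπ _).mp h)
  have hC : ∀ r, θ (Polynomial.C r) = π (rename Sum.inl r) := fun r =>
    Polynomial.eval₂_C _ _
  have hrel : ∀ b, π (rename Sum.inl (f b)) * π (X (Sum.inr a)) =
      π (rename Sum.inl (f a)) * π (X (Sum.inr b)) := by
    intro b
    have h1 := hlin (Pi.single a (f b) - Pi.single b (f a)) (by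
      simp only [Pi.sub_apply, sub_mul, Finset.sum_sub_distrib, Pi.single_apply, ite_mul, zero_mul,
        Finset.sum_ite_eq', Finset.mem_univ, if_true]
      ring)
    have h2 : symForm (Pi.single a (f b) - Pi.single b (f a)) =
        rename Sum.inl (f b) * X (Sum.inr a) - rename Sum.inl (f a) * X (Sum.inr b) := by
      simp only [symForm, Pi.sub_apply, map_sub, sub_mul, Finset.sum_sub_distrib]
      congr 1
      · rw [Finset.sum_eq_single a] <;> simp +contextual
      · rw [Finset.sum_eq_single b] <;> simp +contextual
    rw [h2, ← hπ, map_sub, map_mul, map_mul, sub_eq_zero] at h1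
    exact h1
  have hθ : θ.comp (reesMap f).toRingHom = π := by
    refine MvPolynomial.ringHom_ext (fun r => ?_) fun i => ?_
    · have : (C r : MvPolynomial (Fin (d + 1) ⊕ Fin (n + 1)) k) = rename Sum.inl (C r) := by simp
      change θ (reesMap f (C r)) = _
      rw [this, reesMap_rename, hC]
    · change θ (reesMap f (X i)) = _
      rcases i with i | b
      · rw [← rename_X, reesMap_rename, hC]
      · rw [reesMap_X_inr, map_mul, hC]
        change _ * Polynomial.eval₂ _ _ Polynomial.X = _
        rw [Polynomial.eval₂_X, ← mul_div_assoc, hrel, mul_div_cancel_left₀ _ hfa]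
  intro x hx
  rw [← hπ, ← hθ]
  change θ (reesMap f x) = 0
  rw [show reesMap f x = 0 from hx, map_zero]

theorem growth_qdim_of_notMem {f : Fin (n + 1) → MvPolynomial (Fin (d + 1)) k}
    {𝔓 : Ideal (MvPolynomial (Fin (d + 1) ⊕ Fin (n + 1)) k)} [𝔓.IsPrime]
    (h𝔓 : 𝔓.IsHomogeneous (biPiece k d n))
    (hlin : ∀ v, ∑ b, v b * f b = 0 → symForm v ∈ 𝔓) {a : Fin (n + 1)}
    (ha : rename Sum.inl (f a) ∉ 𝔓) {H : Bideg → ℚ} {e : ℕ} (hH : GrowthSmooth e H)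
    (hfH : (fun g => (qdim ((RingHom.ker (reesMap f)).restrictScalars k) (biPiece k d n g) : ℚ))
      =ᶠ[bigBideg] H) :
    ∃ c : ℚ, GrowthLT e ((fun g => (qdim (𝔓.restrictScalars k) (biPiece k d n g) : ℚ)) - c • H) := by
  have hle := ker_reesMap_le hlin ha
  by_cases heq : 𝔓 ≤ RingHom.ker (reesMap f)
  · refine ⟨1, (growthLT_zero e).congr ?_⟩
    rw [le_antisymm heq hle]
    filter_upwards [hfH] with g hg
    rw [Pi.sub_apply, hg]
    simp
  · have : ∃ s, ∃ y ∈ biPiece k d n s, y ∈ 𝔓 ∧ y ∉ RingHom.ker (reesMap f) := by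
      by_contra! hcon
      refine heq fun x hx => ?_
      classical
      rw [← DirectSum.sum_support_decompose (biPiece k d n) x]
      exact Ideal.sum_mem _ fun s _ => hcon s _ (SetLike.coe_mem _) (h𝔓 s hx)
    obtain ⟨s, y, hys, hy, hy'⟩ := this
    have hker : (RingHom.ker (reesMap f)).IsPrime := RingHom.ker_isPrime _
    have hbound : ∀ g, qdim (𝔓.restrictScalars k) (biPiece k d n g) +
        qdim ((RingHom.ker (reesMap f)).restrictScalars k) (biPiece k d n (g - s)) ≤
        qdim ((RingHom.ker (reesMap f)).restrictScalars k) (biPiece k d n g) := by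
      intro g
      have : FiniteDimensional k ↥(biPiece k d n g ⊓ 𝔓.restrictScalars k) :=
        Submodule.finiteDimensional_of_le inf_le_left
      rw [qdim_eq_add_of_le (show (RingHom.ker (reesMap f)).restrictScalars k ≤
        𝔓.restrictScalars k from hle) (biPiece k d n g)]
      refine Nat.add_le_add_left (qdim_le_qdim _ _ _ _ (LinearMap.mulLeft k y) ?_ ?_) _
      · intro x hx
        refine ⟨?_, 𝔓.mul_mem_right _ hy⟩
        have := SetLike.mul_mem_graded hys hx
        rwa [add_sub_cancel] at this
      · intro x _ hx
        exact (hker.mem_or_mem hx).resolve_left hy'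
    refine ⟨0, ?_⟩
    rw [zero_smul, sub_zero]
    refine ((hH.diff s).neg).of_le (fun g => Nat.cast_nonneg _) ?_
    filter_upwards [hfH, (tendsto_sub_bigBideg s).eventually hfH] with g h1 h2
    simp only [Pi.neg_apply, Pi.sub_apply]
    rw [← h1, ← h2]
    have := hbound g
    have h3 : (qdim (𝔓.restrictScalars k) (biPiece k d n g) : ℚ) +
        qdim ((RingHom.ker (reesMap f)).restrictScalars k) (biPiece k d n (g - s)) ≤
        qdim ((RingHom.ker (reesMap f)).restrictScalars k) (biPiece k d n g) := by
      exact_mod_cast this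
    linarith

end PrimesOffBase

section LocalGenerators

/-- Over a local ring, a family generating an ideal contains a subfamily of cardinality at most that
of any other generating set. -/
theorem exists_finset_card_le_span_image_eq {A ι : Type*} [CommRing A] [IsLocalRing A] [Finite ι]
    (f : ι → A) (s : Finset A) (hs : Ideal.span (s : Set A) = Ideal.span (Set.range f)) :
    ∃ B : Finset ι, B.card ≤ s.card ∧ Ideal.span (f '' B) = Ideal.span (Set.range f) := by
  classical
  have := Fintype.ofFinite ι
  obtain ⟨B, hB, hmin⟩ := Finset.exists_min_image
    ((Finset.univ : Finset (Finset ι)).filter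
      fun B : Finset ι => Ideal.span (f '' (B : Set ι)) = Ideal.span (Set.range f)) Finset.card
    ⟨(Finset.univ : Finset ι), by simp⟩
  simp only [Finset.mem_filter, Finset.mem_univ, true_and] at hB hmin
  refine ⟨B, ?_, hB⟩
  have hB' : Ideal.span (Set.range fun b : B => f b) = Ideal.span (Set.range f) := by
    rw [← hB]
    congr 1
    ext x
    simp
  have hs' : Ideal.span (Set.range fun x : s => (x : A)) = Ideal.span (Set.range f) := by
    rw [← hs]
    congr 1
    ext x
    simp
  have h1 : ∀ b : B, ∃ c : s → A, ∑ x, c x * (x : A) = f b := fun b => by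
    rw [← Ideal.mem_span_range_iff_exists_fun, hs']
    exact Ideal.subset_span ⟨b, rfl⟩
  have h2 : ∀ x : s, ∃ c : B → A, ∑ b, c b * f b = (x : A) := fun x => by
    rw [← Ideal.mem_span_range_iff_exists_fun, hB', ← hs]
    exact Ideal.subset_span x.2
  choose C hC using h1
  choose E hE using h2
  let M : Matrix B B A := Matrix.of C * Matrix.of E
  have hM : ∀ b, ∑ b', M b b' * f b' = f b := by
    intro b
    rw [← hC b]
    simp only [M, Matrix.mul_apply, Finset.sum_mul, Matrix.of_apply]
    rw [Finset.sum_comm]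
    refine Finset.sum_congr rfl fun x _ => ?_
    rw [← hE x, Finset.mul_sum]
    exact Finset.sum_congr rfl fun b' _ => mul_assoc _ _ _
  have hnon : ∀ b b', M b b' - (1 : Matrix B B A) b b' ∈ IsLocalRing.maximalIdeal A := by
    intro b b'
    rw [IsLocalRing.mem_maximalIdeal, mem_nonunits_iff]
    rintro ⟨u, hu⟩
    have hsum : ∑ x, (M b x - (1 : Matrix B B A) b x) * f x = 0 := by
      simp only [sub_mul, Finset.sum_sub_distrib, hM, Matrix.one_apply, ite_mul, one_mul, zero_mul,
        Finset.sum_ite_eq, Finset.mem_univ, if_true, sub_self]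
    rw [← Finset.add_sum_erase _ _ (Finset.mem_univ b'), ← hu] at hsum
    have hmem : f b' ∈ Ideal.span (f '' (B.erase b' : Finset ι)) := by
      have : f b' = (↑u⁻¹ : A) * -∑ x ∈ Finset.univ.erase b',
          (M b x - (1 : Matrix B B A) b x) * f x := by
        rw [← eq_neg_of_add_eq_zero_left hsum, ← mul_assoc, Units.inv_mul, one_mul]
      rw [this]
      refine Ideal.mul_mem_left _ _ (neg_mem (Ideal.sum_mem _ fun x hx => ?_))
      refine Ideal.mul_mem_left _ _ (Ideal.subset_span ⟨x, ?_, rfl⟩)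
      rw [Finset.mem_coe, Finset.mem_erase]
      exact ⟨fun h => (Finset.mem_erase.mp hx).1 (Subtype.ext h), x.2⟩
    have hspan : Ideal.span (f '' (B.erase b' : Finset ι)) = Ideal.span (Set.range f) := by
      rw [← hB]
      refine le_antisymm (Ideal.span_mono (Set.image_mono (by simp))) (Ideal.span_le.mpr ?_)
      rintro _ ⟨x, hx, rfl⟩
      by_cases hxb : x = b'
      · rw [hxb]
        exact hmem
      · exact Ideal.subset_span ⟨x, by simpa [hxb] using hx, rfl⟩
    have := hmin _ hspan
    have := Finset.card_erase_lt_of_mem b'.2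
    omega
  have hone : (Matrix.of C).map (IsLocalRing.residue A) * (Matrix.of E).map (IsLocalRing.residue A) =
      1 := by
    rw [← Matrix.map_mul]
    ext b b'
    have := (IsLocalRing.residue_eq_zero_iff _).mpr (hnon b b')
    rw [map_sub, sub_eq_zero] at this
    rw [Matrix.map_apply]
    refine this.trans ?_
    simp [Matrix.one_apply, apply_ite]
  have hrank := Matrix.rank_mul_le_left ((Matrix.of C).map (IsLocalRing.residue A))
    ((Matrix.of E).map (IsLocalRing.residue A))
  rw [hone, Matrix.rank_one] at hrank
  have := hrank.trans (Matrix.rank_le_card_width _)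
  simpa using this

/-- If the localization of `I = (f_i)` at a prime `p` can be generated by `h` elements, then `h` of
the `f_i` generate `I` up to multiplication by an element outside `p`. -/
theorem exists_finset_mul_mem_span_image {R ι : Type*} [CommRing R] [Finite ι] (f : ι → R)
    (p : Ideal R) [p.IsPrime] (s : Finset (Localization.AtPrime p))
    (hs : Ideal.span (s : Set (Localization.AtPrime p)) =
      (Ideal.span (Set.range f)).map (algebraMap R (Localization.AtPrime p))) :
    ∃ B : Finset ι, B.card ≤ s.card ∧ ∃ g ∉ p, ∀ a, g * f a ∈ Ideal.span (f '' B) := by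
  classical
  have := Fintype.ofFinite ι
  rw [Ideal.map_span, ← Set.range_comp] at hs
  obtain ⟨B, hcard, hB⟩ := exists_finset_card_le_span_image_eq _ s hs
  refine ⟨B, hcard, ?_⟩
  have h1 : ∀ a, ∃ g ∉ p, g * f a ∈ Ideal.span (f '' B) := by
    intro a
    have h2 : algebraMap R (Localization.AtPrime p) (f a) ∈
        (Ideal.span (f '' B)).map (algebraMap R (Localization.AtPrime p)) := by
      rw [Ideal.map_span, ← Set.image_comp, hB]
      exact Ideal.subset_span ⟨a, rfl⟩
    rw [IsLocalization.algebraMap_mem_map_algebraMap_iff p.primeCompl] at h2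
    obtain ⟨g, hg, hga⟩ := h2
    exact ⟨g, hg, hga⟩
  choose g hg hga using h1
  refine ⟨∏ a, g a, fun h => ?_, fun a => ?_⟩
  · obtain ⟨a, _, ha⟩ := (Ideal.IsPrime.prod_mem_iff (p := p)).mp h
    exact hg a ha
  · rw [← Finset.prod_erase_mul _ _ (Finset.mem_univ a), mul_assoc]
    exact Ideal.mul_mem_left _ _ (hga a)

end LocalGenerators

section PrimesOverBase

open MvPolynomial

variable {k : Type*} [Field k] {d n : ℕ}

theorem homogeneousComponent_mul_of_isHomogeneous {σ : Type*} {δ : ℕ} (M : ℕ)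
    (c : MvPolynomial σ k) {f : MvPolynomial σ k} (hf : f.IsHomogeneous δ) :
    homogeneousComponent (M + δ) (c * f) = homogeneousComponent M c * f := by
  let := MvPolynomial.gradedAlgebra (σ := σ) (R := k)
  have := DirectSum.coe_decompose_mul_add_of_right_mem (homogeneousSubmodule σ k) (i := M)
    (a := c) (b := f) hf
  exact (decomposition.decompose'_apply (c * f) (M + δ)).symm.trans
    (this.trans (congrArg (· * f) (decomposition.decompose'_apply c M)))

/-- Homogeneous version of `exists_finset_mul_mem_span_image`. -/
theorem exists_homogeneous_mul_eq_sum {σ ι : Type*} [Finite ι] {δ : ℕ} {f : ι → MvPolynomial σ k}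
    (hf : ∀ a, (f a).IsHomogeneous δ) (p : Ideal (MvPolynomial σ k)) [p.IsPrime]
    (s : Finset (Localization.AtPrime p))
    (hs : Ideal.span (s : Set (Localization.AtPrime p)) =
      (Ideal.span (Set.range f)).map (algebraMap _ (Localization.AtPrime p))) :
    ∃ B : Finset ι, B.card ≤ s.card ∧ ∃ (M : ℕ) (g : MvPolynomial σ k), g ∉ p ∧
      g.IsHomogeneous M ∧ ∃ c : ι → ι → MvPolynomial σ k, (∀ a b, (c a b).IsHomogeneous M) ∧
        ∀ a, g * f a = ∑ b ∈ B, c a b * f b := by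
  obtain ⟨B, hB, g, hg, hga⟩ := exists_finset_mul_mem_span_image f p s hs
  refine ⟨B, hB, ?_⟩
  have hM : ∃ M, homogeneousComponent M g ∉ p := by
    by_contra! hcon
    refine hg ?_
    rw [← sum_homogeneousComponent g]
    exact Ideal.sum_mem _ fun i _ => hcon i
  obtain ⟨M, hM⟩ := hM
  have hc : ∀ a, ∃ c : ι → MvPolynomial σ k, ∑ b ∈ B, c b * f b = g * f a := fun a =>
    (Submodule.mem_span_image_finset_iff_exists_fun' _).mp (hga a)
  choose c hc using hc
  refine ⟨M, homogeneousComponent M g, hM, homogeneousComponent_isHomogeneous M g,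
    fun a b => homogeneousComponent M (c a b), fun a b => homogeneousComponent_isHomogeneous M _,
    fun a => ?_⟩
  rw [← homogeneousComponent_mul_of_isHomogeneous M g (hf a), ← hc a, map_sum]
  exact Finset.sum_congr rfl fun b _ => homogeneousComponent_mul_of_isHomogeneous M _ (hf b)

/-- The span of the products of a form of degree `j` in the `x_i` and a monomial of degree `q` in
the `T_b` with `b ∈ B`. -/
noncomputable def subFormPiece (k : Type*) [Field k] (d : ℕ) {n : ℕ} (B : Finset (Fin (n + 1)))
    (g : ℕ × ℕ) : Submodule k (MvPolynomial (Fin (d + 1) ⊕ Fin (n + 1)) k) :=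
  Submodule.span k {y | ∃ r : MvPolynomial (Fin (d + 1)) k, r.IsHomogeneous g.1 ∧
    ∃ β ∈ B.finsuppAntidiag g.2, y = rename Sum.inl r * ∏ b ∈ B, X (Sum.inr b) ^ β b}

theorem mul_mem_subFormPiece {B : Finset (Fin (n + 1))} {g g' : ℕ × ℕ}
    {y y' : MvPolynomial (Fin (d + 1) ⊕ Fin (n + 1)) k} (hy : y ∈ subFormPiece k d B g)
    (hy' : y' ∈ subFormPiece k d B g') : y * y' ∈ subFormPiece k d B (g + g') := by
  have h := Submodule.mul_mem_mul hy hy'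
  rw [subFormPiece, subFormPiece, Submodule.span_mul_span] at h
  refine Submodule.span_mono ?_ h
  rintro _ ⟨_, ⟨r, hr, β, hβ, rfl⟩, _, ⟨r', hr', β', hβ', rfl⟩, rfl⟩
  rw [Finset.mem_finsuppAntidiag] at hβ hβ'
  refine ⟨r * r', hr.mul hr', β + β', Finset.mem_finsuppAntidiag.mpr ⟨?_, ?_⟩, ?_⟩
  · rw [Prod.snd_add, ← hβ.1, ← hβ'.1, ← Finset.sum_add_distrib]
    rfl
  · exact Finsupp.support_add.trans (Finset.union_subset hβ.2 hβ'.2)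
  · simp only [map_mul, Finsupp.add_apply, pow_add, Finset.prod_mul_distrib]
    ring

theorem rename_mem_subFormPiece (B : Finset (Fin (n + 1))) {j : ℕ}
    {r : MvPolynomial (Fin (d + 1)) k} (hr : r.IsHomogeneous j) :
    rename Sum.inl r ∈ subFormPiece k d B (j, 0) :=
  Submodule.subset_span ⟨r, hr, 0, by simp, by simp⟩

theorem X_inr_mem_subFormPiece {B : Finset (Fin (n + 1))} {b : Fin (n + 1)} (hb : b ∈ B) :
    X (Sum.inr b) ∈ subFormPiece k d B (0, 1) := by
  refine Submodule.subset_span ⟨1, isHomogeneous_one _ _, Finsupp.single b 1, ?_, ?_⟩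
  · rw [Finset.mem_finsuppAntidiag]
    refine ⟨?_, Finsupp.support_single_subset.trans (Finset.singleton_subset_iff.mpr hb)⟩
    simp [Finsupp.single_apply, hb]
  · rw [map_one, one_mul, Finset.prod_eq_single b]
    · simp
    · intro b' _ hb'
      simp [hb'.symm]
    · exact fun h => absurd hb h

instance gradedMonoid_subFormPiece (B : Finset (Fin (n + 1))) :
    SetLike.GradedMonoid (subFormPiece k d B) where
  one_mem := by
    have := rename_mem_subFormPiece (k := k) (d := d) B (isHomogeneous_one _ _)
    rwa [map_one] at this
  mul_mem _ _ _ _ := mul_mem_subFormPiece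

theorem exists_eq_sum_of_mem_subFormPiece {B : Finset (Fin (n + 1))} {g : ℕ × ℕ}
    {y : MvPolynomial (Fin (d + 1) ⊕ Fin (n + 1)) k} (hy : y ∈ subFormPiece k d B g) :
    ∃ r : B.finsuppAntidiag g.2 → MvPolynomial (Fin (d + 1)) k,
      (∀ β, r β ∈ homogeneousSubmodule (Fin (d + 1)) k g.1) ∧
      y = ∑ β, rename Sum.inl (r β) * ∏ b ∈ B, X (Sum.inr b) ^ β.1 b := by
  classical
  induction hy using Submodule.span_induction with
  | mem y hy =>
    obtain ⟨r, hr, β, hβ, rfl⟩ := hy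
    refine ⟨Pi.single ⟨β, hβ⟩ r, fun β' => ?_, ?_⟩
    · rw [Pi.single_apply]
      split_ifs
      · exact hr
      · exact Submodule.zero_mem _
    · rw [Finset.sum_eq_single ⟨β, hβ⟩]
      · simp
      · intro β' _ h
        simp [h]
      · simp
  | zero => exact ⟨0, fun _ => Submodule.zero_mem _, by simp⟩
  | add y y' _ _ h h' =>
    obtain ⟨r, hr, rfl⟩ := h
    obtain ⟨r', hr', rfl⟩ := h'
    refine ⟨r + r', fun β => Submodule.add_mem _ (hr β) (hr' β), ?_⟩
    simp only [Pi.add_apply, map_add, add_mul, Finset.sum_add_distrib]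
  | smul a y _ h =>
    obtain ⟨r, hr, rfl⟩ := h
    refine ⟨a • r, fun β => Submodule.smul_mem _ _ (hr β), ?_⟩
    simp only [Pi.smul_apply, map_smul, smul_mul_assoc, Finset.smul_sum]

/-- The substitution `T_a ↦ ∑_{b ∈ B} c_ab T_b`. -/
noncomputable def substT (B : Finset (Fin (n + 1)))
    (c : Fin (n + 1) → Fin (n + 1) → MvPolynomial (Fin (d + 1)) k) :
    MvPolynomial (Fin (d + 1) ⊕ Fin (n + 1)) k →ₐ[k]
      MvPolynomial (Fin (d + 1) ⊕ Fin (n + 1)) k :=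
  aeval (Sum.elim (fun i => X (Sum.inl i))
    fun a => ∑ b ∈ B, rename Sum.inl (c a b) * X (Sum.inr b))

theorem substT_monomial (B : Finset (Fin (n + 1)))
    (c : Fin (n + 1) → Fin (n + 1) → MvPolynomial (Fin (d + 1)) k)
    (s : Fin (d + 1) ⊕ Fin (n + 1) →₀ ℕ) (a : k) :
    substT B c (monomial s a) = rename Sum.inl (C a * ∏ i, X i ^ s (Sum.inl i)) *
      ∏ a, (∑ b ∈ B, rename Sum.inl (c a b) * X (Sum.inr b)) ^ s (Sum.inr a) := by
  rw [substT, aeval_monomial, Finsupp.prod_fintype _ _ (fun _ => pow_zero _),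
    Fintype.prod_sum_type]
  simp only [Sum.elim_inl, Sum.elim_inr, map_mul, map_prod, map_pow, rename_X, rename_C, mul_assoc]
  rfl

theorem substT_mem {B : Finset (Fin (n + 1))} {M : ℕ}
    {c : Fin (n + 1) → Fin (n + 1) → MvPolynomial (Fin (d + 1)) k}
    (hc : ∀ a b, (c a b).IsHomogeneous M) {j q : ℕ}
    {x : MvPolynomial (Fin (d + 1) ⊕ Fin (n + 1)) k}
    (hx : x ∈ biPiece k d n (toLex ((j : ℤ), (q : ℤ)))) :
    substT B c x ∈ subFormPiece k d B (j + q * M, q) := by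
  rw [as_sum x, map_sum]
  refine Submodule.sum_mem _ fun s hs => ?_
  have h1 := mem_biPiece.mp hx s hs
  rw [weight_biWeight, toLex_inj, Prod.mk.injEq, Nat.cast_inj, Nat.cast_inj] at h1
  rw [substT_monomial]
  have h2 : rename Sum.inl (C (coeff s x) * ∏ i, X i ^ s (Sum.inl i)) ∈
      subFormPiece k d B (j, 0) := by
    refine rename_mem_subFormPiece B ?_
    rw [← h1.1, ← zero_add (∑ i, s (Sum.inl i))]
    refine (isHomogeneous_C _ _).mul (IsHomogeneous.prod _ _ _ fun i _ => ?_)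
    simpa using (isHomogeneous_X k i).pow (s (Sum.inl i))
  have h3 := SetLike.prod_pow_mem_graded (subFormPiece k d B)
    (fun _ : Fin (n + 1) => ((M, 1) : ℕ × ℕ))
    (fun a => ∑ b ∈ B, rename Sum.inl (c a b) * X (Sum.inr b)) (F := Finset.univ)
    (fun a => s (Sum.inr a)) (fun a _ => Submodule.sum_mem _ fun b hb => by
      simpa using mul_mem_subFormPiece (rename_mem_subFormPiece B (hc a b))
        (X_inr_mem_subFormPiece hb))
  have h4 := mul_mem_subFormPiece h2 h3
  rw [← Finset.sum_smul, h1.2] at h4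
  simpa using h4

theorem substT_sub_mem {B : Finset (Fin (n + 1))}
    {c : Fin (n + 1) → Fin (n + 1) → MvPolynomial (Fin (d + 1)) k}
    {g : MvPolynomial (Fin (d + 1)) k}
    {𝔓 : Ideal (MvPolynomial (Fin (d + 1) ⊕ Fin (n + 1)) k)}
    (hrel : ∀ a, rename Sum.inl g * X (Sum.inr a) -
      ∑ b ∈ B, rename Sum.inl (c a b) * X (Sum.inr b) ∈ 𝔓) {j q : ℕ}
    {x : MvPolynomial (Fin (d + 1) ⊕ Fin (n + 1)) k}
    (hx : x ∈ biPiece k d n (toLex ((j : ℤ), (q : ℤ)))) :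
    rename Sum.inl g ^ q * x - substT B c x ∈ 𝔓 := by
  rw [as_sum x, map_sum, Finset.mul_sum, ← Finset.sum_sub_distrib]
  refine Ideal.sum_mem _ fun s hs => ?_
  have h1 := mem_biPiece.mp hx s hs
  rw [weight_biWeight, toLex_inj, Prod.mk.injEq, Nat.cast_inj, Nat.cast_inj] at h1
  have h2 : monomial s (coeff s x) = rename Sum.inl (C (coeff s x) * ∏ i, X i ^ s (Sum.inl i)) *
      ∏ a, X (Sum.inr a) ^ s (Sum.inr a) := by
    rw [monomial_eq, Finsupp.prod_fintype _ _ (fun _ => pow_zero _), Fintype.prod_sum_type]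
    simp only [map_mul, map_prod, map_pow, rename_X, rename_C, mul_assoc]
  rw [substT_monomial, h2, ← h1.2, mul_left_comm, ← mul_sub, ← Finset.prod_pow_eq_pow_sum,
    ← Finset.prod_mul_distrib]
  refine Ideal.mul_mem_left _ _ ?_
  rw [← Ideal.Quotient.eq, map_prod, map_prod]
  refine Finset.prod_congr rfl fun a _ => ?_
  rw [← mul_pow, map_pow, map_pow, Ideal.Quotient.eq.mpr (hrel a)]

theorem qdim_biPiece_le {B : Finset (Fin (n + 1))} {M : ℕ}
    {c : Fin (n + 1) → Fin (n + 1) → MvPolynomial (Fin (d + 1)) k}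
    (hc : ∀ a b, (c a b).IsHomogeneous M) {g : MvPolynomial (Fin (d + 1)) k}
    {𝔓 : Ideal (MvPolynomial (Fin (d + 1) ⊕ Fin (n + 1)) k)} [h𝔓 : 𝔓.IsPrime]
    (hg : rename Sum.inl g ∉ 𝔓)
    (hrel : ∀ a, rename Sum.inl g * X (Sum.inr a) -
      ∑ b ∈ B, rename Sum.inl (c a b) * X (Sum.inr b) ∈ 𝔓) (j q : ℕ) :
    qdim (𝔓.restrictScalars k) (biPiece k d n (toLex ((j : ℤ), (q : ℤ)))) ≤
      (B.card + q - 1).choose q *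
        qdim ((𝔓.comap (rename Sum.inl : MvPolynomial (Fin (d + 1)) k →ₐ[k] _)).restrictScalars k)
          (homogeneousSubmodule (Fin (d + 1)) k (j + q * M)) := by
  classical
  set V := biPiece k d n (toLex ((j : ℤ), (q : ℤ)))
  let L := LinearMap.mulLeft k ((rename Sum.inl g : MvPolynomial (Fin (d + 1) ⊕ Fin (n + 1)) k) ^ q)
  refine (qdim_le_qdim _ _ (𝔓.restrictScalars k) (V.map L) L
    (fun x hx => Submodule.mem_map_of_mem hx) fun x _ hx => ?_).trans ?_
  · exact (h𝔓.mem_or_mem hx).resolve_left fun h => hg (h𝔓.mem_of_pow_mem _ h)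
  · rw [← Finset.card_finsuppAntidiag_nat_eq_choose, ← Fintype.card_coe]
    refine qdim_le_card_mul _ _ _ _
      (fun β => (LinearMap.mulRight k (∏ b ∈ B, X (Sum.inr b) ^ β.1 b)).comp
        (rename Sum.inl : MvPolynomial (Fin (d + 1)) k →ₐ[k] _).toLinearMap) ?_ ?_
    · intro β y hy
      exact 𝔓.mul_mem_right _ hy
    · rintro _ ⟨x, hx, rfl⟩
      obtain ⟨r, hr, hxr⟩ := exists_eq_sum_of_mem_subFormPiece (substT_mem (B := B) hc hx)
      refine ⟨r, hr, ?_⟩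
      have := substT_sub_mem hrel hx
      rw [hxr] at this
      exact this

end PrimesOverBase

section PrimesOverBaseGrowth

open MvPolynomial

variable {k : Type*} [Field k] {d n : ℕ}

theorem eventually_bigBideg_natCast {p : Bideg → Prop}
    (h : ∀ j q : ℕ, 1 ≤ j → p (toLex ((j : ℤ), (q : ℤ)))) : ∀ᶠ g in bigBideg, p g := by
  rw [eventually_bigBideg]
  refine ⟨1, fun j q hj hq => ?_⟩
  have := h j.toNat q.toNat (by omega)
  rwa [Int.toNat_of_nonneg (by omega), Int.toNat_of_nonneg (by omega)] at this

theorem map_mkQ_eq_bot_iff_le {E : Type*} [AddCommGroup E] [Module k E] {W V : Submodule k E} :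
    V.map W.mkQ = ⊥ ↔ V ≤ W := by
  rw [← le_bot_iff, Submodule.map_le_iff_le_comap, Submodule.comap_bot, Submodule.ker_mkQ]

theorem growthLT_qdim_of_forall_X_mem {𝔓 : Ideal (MvPolynomial (Fin (d + 1) ⊕ Fin (n + 1)) k)}
    (h : ∀ i, X (Sum.inl i) ∈ 𝔓) (e : ℕ) :
    GrowthLT e (fun g => (qdim (𝔓.restrictScalars k) (biPiece k d n g) : ℚ)) := by
  refine (growthLT_zero e).congr (eventually_bigBideg_natCast fun j q hj => ?_)
  have hle : biPiece k d n (toLex ((j : ℤ), (q : ℤ))) ≤ 𝔓.restrictScalars k := by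
    intro x hx
    rw [Submodule.restrictScalars_mem, as_sum x]
    refine Ideal.sum_mem _ fun s hs => ?_
    have h1 := mem_biPiece.mp hx s hs
    rw [weight_biWeight, toLex_inj, Prod.mk.injEq, Nat.cast_inj, Nat.cast_inj] at h1
    obtain ⟨i, hi⟩ : ∃ i, s (Sum.inl i) ≠ 0 := by
      by_contra! hcon
      have := h1.1
      simp only [hcon, Finset.sum_const_zero] at this
      omega
    exact 𝔓.mem_of_dvd (X_dvd_monomial.mpr (Or.inr hi)) (h i)
  have : qdim (𝔓.restrictScalars k) (biPiece k d n (toLex ((j : ℤ), (q : ℤ)))) = 0 := by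
    rw [qdim, map_mkQ_eq_bot_iff_le.mpr hle, finrank_bot]
  change (0 : ℚ) = (qdim (𝔓.restrictScalars k) (biPiece k d n (toLex ((j : ℤ), (q : ℤ)))) : ℚ)
  rw [this, Nat.cast_zero]

/-- A homogeneous prime of a polynomial ring in `d + 1` variables that does not contain all the
variables has height at most `d`. -/
theorem height_lt_of_X_notMem (p : PrimeSpectrum (MvPolynomial (Fin (d + 1)) k))
    (hhom : ∀ g ∈ p.asIdeal, ∀ i, homogeneousComponent i g ∈ p.asIdeal)
    (l : Fin (d + 1)) (hl : X l ∉ p.asIdeal) : Order.height p < ((d + 1 : ℕ) : ℕ∞) := by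
  by_contra! hcon
  obtain ⟨C, hC⟩ := exists_qdim_homogeneousSubmodule_mul_le (d + 1) p hcon hhom l hl
  have h1 : 1 ≤ qdim (p.asIdeal.restrictScalars k) (homogeneousSubmodule (Fin (d + 1)) k C) := by
    by_contra! h0
    have h2 : (homogeneousSubmodule (Fin (d + 1)) k C).map (p.asIdeal.restrictScalars k).mkQ = ⊥ := by
      rw [← Submodule.finrank_eq_zero (R := k)]
      exact Nat.lt_one_iff.mp h0
    rw [map_mkQ_eq_bot_iff_le] at h2
    have h3 : X l ^ C ∈ p.asIdeal := h2 (show (X l ^ C) ∈ homogeneousSubmodule (Fin (d + 1)) k C by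
      simpa using (isHomogeneous_X k l).pow C)
    exact hl (p.2.mem_of_pow_mem _ h3)
  have h2 := hC C
  rw [pow_succ, ← mul_assoc, mul_right_comm] at h2
  have h3 := Nat.le_of_mul_le_mul_right h2 (by positivity)
  have := Nat.mul_le_mul_right (C + 1) h1
  omega

theorem rename_inl_mem_biPiece {m : ℕ} {r : MvPolynomial (Fin (d + 1)) k} (hr : r.IsHomogeneous m) :
    rename Sum.inl r ∈ biPiece k d n (toLex ((m : ℤ), 0)) := by
  rw [as_sum r, map_sum]
  refine Submodule.sum_mem _ fun s hs => ?_
  rw [rename_monomial]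
  refine isWeightedHomogeneous_monomial (biWeight d n) _ _ ?_
  rw [weight_biWeight]
  have h1 := hr (mem_support_iff.mp hs)
  have h2 : ∀ i, (s.mapDomain Sum.inl : Fin (d + 1) ⊕ Fin (n + 1) →₀ ℕ) (Sum.inl i) = s i :=
    fun i => Finsupp.mapDomain_apply Sum.inl_injective _ _
  have h3 : ∀ i, (s.mapDomain Sum.inl : Fin (d + 1) ⊕ Fin (n + 1) →₀ ℕ) (Sum.inr i) = 0 :=
    fun i => Finsupp.mapDomain_of_notMem_range _ _ (by simp)
  simp only [h2, h3, Finset.sum_const_zero]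
  have h4 : ∑ x, s x = m := by
    rw [← h1, Finsupp.weight_apply, Finsupp.sum_fintype _ _ (by simp)]
    simp
  rw [h4, Nat.cast_zero]

theorem homogeneousComponent_mem_comap
    {𝔓 : Ideal (MvPolynomial (Fin (d + 1) ⊕ Fin (n + 1)) k)}
    (h𝔓 : 𝔓.IsHomogeneous (biPiece k d n)) {g : MvPolynomial (Fin (d + 1)) k}
    (hg : rename Sum.inl g ∈ 𝔓) (i : ℕ) : rename Sum.inl (homogeneousComponent i g) ∈ 𝔓 := by
  have key : (DirectSum.decompose (biPiece k d n) (rename Sum.inl g) (toLex ((i : ℤ), 0)) :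
      MvPolynomial (Fin (d + 1) ⊕ Fin (n + 1)) k) = rename Sum.inl (homogeneousComponent i g) := by
    conv_lhs => rw [← sum_homogeneousComponent g]
    rw [map_sum, ← GradedRing.proj_apply, map_sum]
    by_cases hi : i ∈ Finset.range (g.totalDegree + 1)
    · rw [Finset.sum_eq_single i]
      · rw [GradedRing.proj_apply, DirectSum.decompose_of_mem_same _
          (rename_inl_mem_biPiece (homogeneousComponent_isHomogeneous i g))]
      · intro m _ hm
        rw [GradedRing.proj_apply, DirectSum.decompose_of_mem_ne _
          (rename_inl_mem_biPiece (homogeneousComponent_isHomogeneous m g))]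
        intro h
        rw [toLex_inj, Prod.mk.injEq, Nat.cast_inj] at h
        exact hm h.1
      · exact fun h => absurd hi h
    · rw [homogeneousComponent_eq_zero _ _ (by simpa using hi), map_zero]
      refine Finset.sum_eq_zero fun m hm => ?_
      rw [GradedRing.proj_apply, DirectSum.decompose_of_mem_ne _
        (rename_inl_mem_biPiece (homogeneousComponent_isHomogeneous m g))]
      intro h
      rw [toLex_inj, Prod.mk.injEq, Nat.cast_inj] at h
      exact hi (h.1 ▸ hm)
  rw [← key]
  exact h𝔓 _ hg

theorem growthLT_qdim_of_forall_mem {δ : ℕ} {f : Fin (n + 1) → MvPolynomial (Fin (d + 1)) k}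
    (hf : ∀ a, (f a).IsHomogeneous δ)
    (hht : ∀ p : PrimeSpectrum (MvPolynomial (Fin (d + 1)) k),
      Ideal.span (Set.range f) ≤ p.asIdeal → 1 ≤ Order.height p)
    (hG : ∀ p : PrimeSpectrum (MvPolynomial (Fin (d + 1)) k),
      Ideal.span (Set.range f) ≤ p.asIdeal → Order.height p < ((d + 1 : ℕ) : ℕ∞) →
        ∃ s : Finset (Localization.AtPrime p.asIdeal),
          Ideal.span (s : Set (Localization.AtPrime p.asIdeal)) =
            (Ideal.span (Set.range f)).map (algebraMap _ (Localization.AtPrime p.asIdeal)) ∧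
          (s.card : ℕ∞) ≤ Order.height p)
    {𝔓 : Ideal (MvPolynomial (Fin (d + 1) ⊕ Fin (n + 1)) k)} [h𝔓p : 𝔓.IsPrime]
    (h𝔓 : 𝔓.IsHomogeneous (biPiece k d n))
    (hlin : ∀ v, ∑ b, v b * f b = 0 → symForm v ∈ 𝔓) (hmem : ∀ a, rename Sum.inl (f a) ∈ 𝔓) :
    GrowthLT d (fun g => (qdim (𝔓.restrictScalars k) (biPiece k d n g) : ℚ)) := by
  classical
  by_cases hX : ∀ i, X (Sum.inl i) ∈ 𝔓
  · exact growthLT_qdim_of_forall_X_mem hX d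
  push Not at hX
  obtain ⟨l, hl⟩ := hX
  let p : PrimeSpectrum (MvPolynomial (Fin (d + 1)) k) :=
    ⟨𝔓.comap (rename Sum.inl : MvPolynomial (Fin (d + 1)) k →ₐ[k] _), inferInstance⟩
  have hIp : Ideal.span (Set.range f) ≤ p.asIdeal := by
    rw [Ideal.span_le]
    rintro _ ⟨a, rfl⟩
    exact hmem a
  have hhom : ∀ g ∈ p.asIdeal, ∀ i, homogeneousComponent i g ∈ p.asIdeal := fun g hg i =>
    homogeneousComponent_mem_comap h𝔓 hg i
  have hlp : X l ∉ p.asIdeal := fun h => hl (by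
    have h' : rename Sum.inl (X l) ∈ 𝔓 := h
    rwa [rename_X] at h')
  have hlt := height_lt_of_X_notMem p hhom l hlp
  obtain ⟨h, hh⟩ := ENat.ne_top_iff_exists.mp hlt.ne_top
  obtain ⟨s, hs, hcard⟩ := hG p hIp hlt
  have h1 := hht p hIp
  rw [← hh] at hlt hcard h1
  have h1' : 1 ≤ h := by exact_mod_cast h1
  have hd : h ≤ d := Nat.lt_succ_iff.mp (by exact_mod_cast hlt)
  have hcard' : s.card ≤ h := by exact_mod_cast hcard
  obtain ⟨B, hB, M, g, hgp, hgM, c, hc, hgc⟩ := exists_homogeneous_mul_eq_sum hf p.asIdeal s hs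
  have hrel : ∀ a, rename Sum.inl g * X (Sum.inr a) -
      ∑ b ∈ B, rename Sum.inl (c a b) * X (Sum.inr b) ∈ 𝔓 := by
    intro a
    have h2 := hlin (Pi.single a g - fun b => if b ∈ B then c a b else 0) (by
      simp only [Pi.sub_apply, sub_mul, Finset.sum_sub_distrib, Pi.single_apply, ite_mul, zero_mul,
        Finset.sum_ite_eq', Finset.mem_univ, if_true, Finset.sum_ite_mem, Finset.univ_inter]
      rw [hgc a, sub_self])
    convert h2 using 1
    simp only [symForm, Pi.sub_apply, map_sub, sub_mul, Finset.sum_sub_distrib]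
    congr 1
    · rw [Finset.sum_eq_single a] <;> simp +contextual
    · simp only [apply_ite (rename Sum.inl : MvPolynomial (Fin (d + 1)) k →ₐ[k] _), map_zero,
        ite_mul, zero_mul, Finset.sum_ite_mem, Finset.univ_inter]
  obtain ⟨C, hC⟩ := exists_qdim_homogeneousSubmodule_mul_le h p hh.le hhom l hlp
  have hbound : ∀ j q : ℕ,
      qdim (𝔓.restrictScalars k) (biPiece k d n (toLex ((j : ℤ), (q : ℤ)))) ≤
        (q + (h - 1)).choose (h - 1) * (C * (j + q * M + 1) ^ (d - h)) := by
    intro j q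
    refine (qdim_biPiece_le hc hgp hrel j q).trans (Nat.mul_le_mul ?_ ?_)
    · rw [← Nat.choose_symm_add]
      exact Nat.choose_le_choose _ (by omega)
    · have h2 := hC (j + q * M)
      have h3 : (j + q * M + 1) ^ (d + 1) = (j + q * M + 1) ^ (d - h) * (j + q * M + 1) ^ (h + 1) := by
        rw [← pow_add]
        congr 1
        omega
      rw [h3, ← mul_assoc] at h2
      exact Nat.le_of_mul_le_mul_right h2 (by positivity)
  have hgrow := (growthSmooth_risingBinom growthSmooth_snd (h - 1)).mul
    ((((growthSmooth_fst.add (growthSmooth_snd.const_mul M)).add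
      ((growthSmooth_const 1).mono (Nat.zero_le 1))).pow (d - h)).const_mul C)
  have hlt' : h - 1 + (d - h) * 1 < d := by omega
  refine (hgrow.le.growthLT hlt').of_le (fun _ => Nat.cast_nonneg _)
    (eventually_bigBideg_natCast fun j q _ => ?_)
  have h2 : (qdim (𝔓.restrictScalars k) (biPiece k d n (toLex ((j : ℤ), (q : ℤ)))) : ℚ) ≤
      (((q + (h - 1)).choose (h - 1) * (C * (j + q * M + 1) ^ (d - h)) : ℕ) : ℚ) := by
    exact_mod_cast hbound j q
  refine h2.trans (le_of_eq ?_)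
  have h3 : Bideg.snd (toLex ((j : ℤ), (q : ℤ))) = (q : ℚ) := by simp [Bideg.snd]
  have h4 : Bideg.fst (toLex ((j : ℤ), (q : ℤ))) = (j : ℚ) := by simp [Bideg.fst]
  simp only [Pi.mul_apply, Pi.add_apply, h3, h4, risingBinom_natCast]
  push_cast
  ring

end PrimesOverBaseGrowth

section LeadingCoefficientsOfReesAlgebra

open MvPolynomial

/-- The functions that agree with a multiple of `H` up to functions of growth less than `e`. -/
def growthMultiples (e : ℕ) (H : Bideg → ℚ) : Submodule ℚ (Bideg → ℚ) where
  carrier := {F | ∃ c : ℚ, GrowthLT e (F - c • H)}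
  zero_mem' := ⟨0, by simpa using growthLT_zero e⟩
  add_mem' := by
    rintro F F' ⟨c, h⟩ ⟨c', h'⟩
    refine ⟨c + c', ?_⟩
    rw [add_smul, add_sub_add_comm]
    exact h.add h'
  smul_mem' := by
    rintro a F ⟨c, h⟩
    refine ⟨a * c, ?_⟩
    rw [mul_smul, ← smul_sub]
    exact h.const_mul a

theorem shift_mem_growthMultiples {e : ℕ} {F H : Bideg → ℚ} (hH : GrowthSmooth e H)
    (hF : F ∈ growthMultiples e H) (s : Bideg) : (fun g => F (g - s)) ∈ growthMultiples e H := by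
  obtain ⟨c, h⟩ := hF
  refine ⟨c, ?_⟩
  have h1 := (h.shift s).add ((hH.diff s).const_mul c)
  convert h1 using 1
  ext g
  simp only [Pi.add_apply, Pi.sub_apply, Pi.smul_apply, smul_eq_mul]
  ring

variable {k : Type*} [Field k] {d n : ℕ}

theorem symForm_mem_biPiece {D : ℕ} {v : Fin (n + 1) → MvPolynomial (Fin (d + 1)) k}
    (hv : ∀ b, (v b).IsHomogeneous D) : symForm v ∈ biPiece k d n (toLex ((D : ℤ), (1 : ℤ))) := by
  refine Submodule.sum_mem _ fun b _ => ?_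
  have h := SetLike.GradedMul.mul_mem (A := biPiece k d n) (rename_inl_mem_biPiece (hv b))
    (X_inr_mem b)
  rw [← toLex_add, Prod.mk_add_mk, add_zero, zero_add] at h
  exact h

theorem symForm_mulVec (φ : Matrix (Fin (n + 1)) (Fin (n + 1)) (MvPolynomial (Fin (d + 1)) k))
    (u : Fin (n + 1) → MvPolynomial (Fin (d + 1)) k) :
    symForm (φ.mulVec u) = ∑ a, rename Sum.inl (u a) * symForm (fun b => φ b a) := by
  simp only [symForm, Matrix.mulVec, dotProduct, map_sum, map_mul, Finset.sum_mul, Finset.mul_sum]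
  rw [Finset.sum_comm]
  refine Finset.sum_congr rfl fun a _ => Finset.sum_congr rfl fun b _ => ?_
  ring

theorem sum_X_mul_symForm_eq_zero
    {φ : Matrix (Fin (n + 1)) (Fin (n + 1)) (MvPolynomial (Fin (d + 1)) k)}
    (hφ : φ.transpose = -φ) (hφ0 : ∀ a, φ a a = 0) :
    ∑ a, X (Sum.inr a) * symForm (fun b => φ b a) = 0 := by
  simp only [symForm, Finset.mul_sum]
  rw [← Finset.sum_product']
  refine Finset.sum_involution (fun x _ => x.swap) ?_ ?_ (fun _ _ => Finset.mem_univ _)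
    (fun _ _ => rfl)
  · rintro ⟨a, b⟩ -
    have h : φ a b = -φ b a := congrFun (congrFun hφ b) a
    simp only [Prod.swap_prod_mk, h, map_neg]
    ring
  · rintro ⟨a, b⟩ - h h'
    rw [Prod.swap_prod_mk, Prod.mk.injEq] at h'
    obtain rfl := h'.1
    exact h (by simp [hφ0])

/-- The relation between the bigraded Hilbert polynomial of the Rees algebra and alternating sums
of binomial coefficients. -/
theorem exists_mul_leading_coeff_eq {δ D : ℕ} {f : Fin (n + 1) → MvPolynomial (Fin (d + 1)) k}
    (hf : ∀ a, (f a).IsHomogeneous δ)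
    (hht : ∀ p : PrimeSpectrum (MvPolynomial (Fin (d + 1)) k),
      Ideal.span (Set.range f) ≤ p.asIdeal → 1 ≤ Order.height p)
    (hG : ∀ p : PrimeSpectrum (MvPolynomial (Fin (d + 1)) k),
      Ideal.span (Set.range f) ≤ p.asIdeal → Order.height p < ((d + 1 : ℕ) : ℕ∞) →
        ∃ s : Finset (Localization.AtPrime p.asIdeal),
          Ideal.span (s : Set (Localization.AtPrime p.asIdeal)) =
            (Ideal.span (Set.range f)).map (algebraMap _ (Localization.AtPrime p.asIdeal)) ∧
          (s.card : ℕ∞) ≤ Order.height p)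
    {φ : Matrix (Fin (n + 1)) (Fin (n + 1)) (MvPolynomial (Fin (d + 1)) k)}
    (hφ : φ.transpose = -φ) (hφ0 : ∀ a, φ a a = 0) (hφdeg : ∀ a b, (φ a b).IsHomogeneous D)
    (hker2 : ∀ v : Fin (n + 1) → MvPolynomial (Fin (d + 1)) k,
      ∑ j, v j * f j = 0 → ∃ u, φ.mulVec u = v)
    {P : MvPolynomial (Fin 2) ℚ} (hPdeg : P.totalDegree ≤ d)
    (hP : (fun g => (qdim ((RingHom.ker (reesMap f)).restrictScalars k) (biPiece k d n g) : ℚ))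
      =ᶠ[bigBideg] bieval P) :
    ∃ c : ℚ, ∀ e ≤ d, c * ((d - e).factorial * e.factorial * P.coeff (expo (d - e) e)) =
      -((D : ℚ) ^ e * altChoose e n) := by
  set ε : Bideg := toLex ((D : ℤ), (1 : ℤ)) with hε
  let l : ℕ → MvPolynomial (Fin (d + 1) ⊕ Fin (n + 1)) k := fun i =>
    if h : i < n + 1 then symForm (fun b => φ b ⟨i, h⟩) else 0
  have hl : ∀ i, l i ∈ biPiece k d n ε := by
    intro i
    dsimp only [l]
    split_ifs with h
    · exact symForm_mem_biPiece fun b => hφdeg _ _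
    · exact Submodule.zero_mem _
  have htl : ∑ i ∈ Finset.range (n + 1), tVar k d n i * l i = 0 := by
    rw [← sum_X_mul_symForm_eq_zero hφ hφ0, Finset.sum_range]
    refine Finset.sum_congr rfl fun a _ => ?_
    simp only [tVar, l, dif_pos a.2]
  have hsm := growthSmooth_bieval hPdeg
  obtain ⟨c, hc⟩ := eulerHilb_ker_mem (biPiece k d n) tVar_mem hl htl
    (growthMultiples d (bieval P)) (fun F hF s => shift_mem_growthMultiples hsm hF s) (by
      intro 𝔓 h𝔓p h𝔓 hl𝔓
      have hlin : ∀ v, ∑ b, v b * f b = 0 → symForm v ∈ 𝔓 := by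
        intro v hv
        obtain ⟨u, rfl⟩ := hker2 v hv
        rw [symForm_mulVec]
        refine Ideal.sum_mem _ fun a _ => Ideal.mul_mem_left _ _ ?_
        have := hl𝔓 a a.2
        simpa only [l, dif_pos a.2] using this
      by_cases hmem : ∀ a, rename Sum.inl (f a) ∈ 𝔓
      · refine ⟨0, ?_⟩
        rw [zero_smul, sub_zero]
        exact growthLT_qdim_of_forall_mem hf hht hG h𝔓 hlin hmem
      · push Not at hmem
        obtain ⟨a, ha⟩ := hmem
        exact growth_qdim_of_notMem h𝔓 hlin ha hsm hP)
  refine ⟨c, fun e he => ?_⟩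
  have hχ := eulerHilb_wedgeColon (biPiece k d n) (e := ε) tVar_mem (varIdeal k d n)
    isHomogeneous_varIdeal varIdeal_succ (N := n + 1)
    (fun c hc a => mem_varIdeal_of_mul_mem hc a) (n + 1) 0 (by omega)
  have hbot : wedgeColon (tVar k d n) (varIdeal k d n 0) (n + 1) 0 =
      LinearMap.ker (kosWedge (tVar k d n) (n + 1) 0) := by
    ext v
    rw [wedgeColon, Submodule.mem_comap, mem_idealVec, LinearMap.mem_ker, varIdeal_zero, funext_iff]
    exact Iff.rfl
  rw [hbot] at hχ
  simp only [zero_add, Nat.add_sub_cancel] at hχ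
  exact mul_leading_coeff_eq hPdeg hc hχ finrank_biPiece_eventuallyEq
    (fun i hi => qdim_varIdeal_eventuallyEq i hi) he

end LeadingCoefficientsOfReesAlgebra

section TopCoefficient

open Filter Topology Polynomial

theorem Polynomial.coeff_nonneg_of_eventually_eval_natCast_nonneg {T : ℚ[X]} {d : ℕ}
    (hT : T.natDegree ≤ d) (h : ∀ᶠ j : ℕ in atTop, 0 ≤ T.eval (j : ℚ)) : 0 ≤ T.coeff d := by
  rcases hT.lt_or_eq with hlt | rfl
  · rw [coeff_eq_zero_of_natDegree_lt hlt]
  rcases eq_or_ne T 0 with rfl | h0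
  · simp
  have h1 := (Polynomial.div_tendsto_atTop_leadingCoeff_div_of_degree_eq T (X ^ T.natDegree)
    (by rw [degree_X_pow, degree_eq_natDegree h0])).comp (tendsto_natCast_atTop_atTop (R := ℚ))
  rw [leadingCoeff_X_pow, div_one] at h1
  refine ge_of_tendsto h1 ?_
  filter_upwards [h] with j hj
  simp only [Function.comp_apply, eval_pow, eval_X]
  positivity

/-- A polynomial of degree at most `d` lying between `(j + a) ^ d` and `(j + b) ^ d` has leading
coefficient one. -/
theorem Polynomial.coeff_eq_one_of_eventually_le {T : ℚ[X]} {d a b : ℕ} (hT : T.natDegree ≤ d)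
    (h : ∀ᶠ j : ℕ in atTop, ((j + a) ^ d : ℚ) ≤ T.eval (j : ℚ) ∧ T.eval (j : ℚ) ≤ (j + b) ^ d) :
    T.coeff d = 1 := by
  have hmon : ∀ c : ℕ, ((X + C (c : ℚ)) ^ d).natDegree = d ∧ ((X + C (c : ℚ)) ^ d).coeff d = 1 := by
    intro c
    have h1 : ((X + C (c : ℚ)) ^ d).natDegree = d := by
      rw [natDegree_pow, natDegree_X_add_C, mul_one]
    have h2 := ((monic_X_add_C (c : ℚ)).pow d).coeff_natDegree
    rw [h1] at h2
    exact ⟨h1, h2⟩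
  have h1 := coeff_nonneg_of_eventually_eval_natCast_nonneg (T := T - (X + C (a : ℚ)) ^ d) (d := d)
    ((natDegree_sub_le _ _).trans (max_le hT (hmon a).1.le))
    (h.mono fun j hj => by simpa using hj.1)
  have h2 := coeff_nonneg_of_eventually_eval_natCast_nonneg (T := (X + C (b : ℚ)) ^ d - T) (d := d)
    ((natDegree_sub_le _ _).trans (max_le (hmon b).1.le hT))
    (h.mono fun j hj => by simpa using hj.2)
  rw [coeff_sub, (hmon _).2] at h1 h2
  linarith

end TopCoefficient

section TopCoefficientOfReesAlgebra

open MvPolynomial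

theorem finrank_homogeneousSubmodule {k : Type*} [Field k] (d j : ℕ) :
    Module.finrank k (homogeneousSubmodule (Fin (d + 1)) k j) = (j + d).choose d := by
  have h1 : homogeneousSubmodule (Fin (d + 1)) k j =
      restrictSupport k ((Finset.univ.finsuppAntidiag j : Finset (Fin (d + 1) →₀ ℕ)) : Set _) := by
    rw [homogeneousSubmodule_eq_finsupp_supported, restrictSupport]
    congr 1
    ext s
    simp [Finsupp.degree_eq_sum]
  rw [h1, finrank_restrictSupport, Set.ncard_coe_finset, Finset.card_finsuppAntidiag_nat_eq_choose,
    Finset.card_univ, Fintype.card_fin, show d + 1 + j - 1 = j + d by omega, Nat.choose_symm_add]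

theorem choose_le_finrank_pow_inf {k : Type*} [Field k] {d n δ : ℕ}
    {f : Fin (n + 1) → MvPolynomial (Fin (d + 1)) k} (a : Fin (n + 1)) (ha : f a ≠ 0)
    (hf : (f a).IsHomogeneous δ) (j q : ℕ) :
    (j + d).choose d ≤ Module.finrank k ↥((Ideal.span (Set.range f) ^ q).restrictScalars k ⊓
      homogeneousSubmodule (Fin (d + 1)) k (j + q * δ)) := by
  rw [← finrank_homogeneousSubmodule (k := k) d j]
  have hle : (homogeneousSubmodule (Fin (d + 1)) k j).map (LinearMap.mulLeft k (f a ^ q)) ≤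
      (Ideal.span (Set.range f) ^ q).restrictScalars k ⊓
        homogeneousSubmodule (Fin (d + 1)) k (j + q * δ) := by
    rintro _ ⟨x, hx, rfl⟩
    refine ⟨Ideal.mul_mem_right _ _
      (Ideal.pow_mem_pow (Ideal.subset_span (Set.mem_range_self a)) q), ?_⟩
    have h : (f a ^ q * x).IsHomogeneous (δ * q + j) := (hf.pow q).mul hx
    rwa [show δ * q + j = j + q * δ by ring] at h
  have : FiniteDimensional k ↥((Ideal.span (Set.range f) ^ q).restrictScalars k ⊓
      homogeneousSubmodule (Fin (d + 1)) k (j + q * δ)) :=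
    Submodule.finiteDimensional_of_le inf_le_right
  rw [(Submodule.equivMapOfInjective (LinearMap.mulLeft k (f a ^ q))
    (mul_right_injective₀ (pow_ne_zero q ha)) _).finrank_eq]
  exact Submodule.finrank_mono hle

theorem factorial_mul_choose_add_le (j d : ℕ) :
    (j + 1) ^ d ≤ d.factorial * (j + d).choose d ∧ d.factorial * (j + d).choose d ≤ (j + d) ^ d := by
  rw [← Nat.descFactorial_eq_factorial_mul_choose]
  refine ⟨?_, Nat.descFactorial_le_pow _ _⟩
  have := Nat.pow_sub_le_descFactorial (j + d) d
  rwa [show j + d + 1 - d = j + 1 by omega] at this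

/-- The leading coefficient in the first variable of the bigraded Hilbert polynomial. -/
theorem factorial_mul_coeff_eq_one {k : Type*} [Field k] {d n δ : ℕ}
    {f : Fin (n + 1) → MvPolynomial (Fin (d + 1)) k} (a : Fin (n + 1)) (ha : f a ≠ 0)
    (hf : (f a).IsHomogeneous δ) {P : MvPolynomial (Fin 2) ℚ} (hPdeg : P.totalDegree ≤ d)
    {j₀ q : ℕ} (hP : ∀ j, j₀ ≤ j → eval ![(j : ℚ), (q : ℚ)] P =
      Module.finrank k ↥((Ideal.span (Set.range f) ^ q).restrictScalars k ⊓
        homogeneousSubmodule (Fin (d + 1)) k (j + q * δ))) :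
    d.factorial * P.coeff (expo d 0) = 1 := by
  let T : Polynomial ℚ := aeval ![Polynomial.X, Polynomial.C (q : ℚ)] P
  have hsum : T = ∑ m ∈ P.support, Polynomial.C (P.coeff m * (q : ℚ) ^ m 1) * Polynomial.X ^ m 0 := by
    dsimp only [T]
    rw [aeval_def, eval₂_eq']
    refine Finset.sum_congr rfl fun m _ => ?_
    rw [Fin.prod_univ_two]
    simp only [Matrix.cons_val_zero, Matrix.cons_val_one, Polynomial.algebraMap_eq, map_mul, map_pow]
    ring
  have hdeg : ∀ m ∈ P.support, m 0 + m 1 ≤ d := fun m hm => totalDegree_fin_two hPdeg hm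
  have hT : T.natDegree ≤ d := by
    rw [hsum]
    refine Polynomial.natDegree_sum_le_of_forall_le _ _ fun m hm => ?_
    exact (Polynomial.natDegree_C_mul_X_pow_le _ _).trans (by have := hdeg m hm; omega)
  have hcoeff : T.coeff d = P.coeff (expo d 0) := by
    rw [hsum, Polynomial.finsetSum_coeff]
    simp only [Polynomial.coeff_C_mul_X_pow]
    have h0 : expo d 0 0 = d := by simp [expo]
    have h1 : expo d 0 1 = 0 := by simp [expo]
    rw [Finset.sum_eq_single (expo d 0)]
    · rw [h0, h1, if_pos rfl, pow_zero, mul_one]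
    · intro m hm hne
      rw [if_neg]
      intro h
      apply hne
      have := hdeg m hm
      ext i
      fin_cases i
      · exact h.symm.trans h0.symm
      · exact (show m 1 = 0 by omega).trans h1.symm
    · intro h
      rw [notMem_support_iff.mp h, zero_mul, ite_self]
  have heval : ∀ x : ℚ, T.eval x = eval ![x, (q : ℚ)] P := by
    intro x
    rw [hsum, eval_eq', Polynomial.eval_finsetSum]
    refine Finset.sum_congr rfl fun m _ => ?_
    rw [Fin.prod_univ_two]
    simp only [Matrix.cons_val_zero, Matrix.cons_val_one, Polynomial.eval_mul, Polynomial.eval_C,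
      Polynomial.eval_pow, Polynomial.eval_X]
    ring
  rw [← hcoeff, ← Polynomial.coeff_C_mul]
  refine Polynomial.coeff_eq_one_of_eventually_le (a := 1) (b := q * δ + d)
    ((Polynomial.natDegree_C_mul_le _ _).trans hT) (Filter.eventually_atTop.mpr ⟨j₀, fun j hj => ?_⟩)
  rw [Polynomial.eval_mul, Polynomial.eval_C, heval, hP j hj]
  have h1 := choose_le_finrank_pow_inf a ha hf j q
  have h2 := Submodule.finrank_mono (inf_le_right :
    (Ideal.span (Set.range f) ^ q).restrictScalars k ⊓
      homogeneousSubmodule (Fin (d + 1)) k (j + q * δ) ≤ _)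
  rw [finrank_homogeneousSubmodule] at h2
  have h3 := (factorial_mul_choose_add_le j d).1.trans (Nat.mul_le_mul_left _ h1)
  have h4 := (Nat.mul_le_mul_left d.factorial h2).trans (factorial_mul_choose_add_le _ d).2
  rw [add_assoc] at h4
  exact ⟨by exact_mod_cast h3, by exact_mod_cast h4⟩

end TopCoefficientOfReesAlgebra

section HeightAndGenerators

theorem le_height_of_le_idealHeight {R : Type} [CommRing R] {I : Ideal R} {m : ℕ∞}
    (h : m ≤ idealHeight I) (p : PrimeSpectrum R) (hp : I ≤ p.asIdeal) : m ≤ Order.height p :=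
  h.trans (iInf₂_le p hp)

theorem exists_card_le_of_minGens_le {R : Type} [CommRing R] {I : Ideal R} {m : ℕ∞}
    (hm : m ≠ ⊤) (h : minGens I ≤ m) :
    ∃ s : Finset R, Ideal.span (s : Set R) = I ∧ (s.card : ℕ∞) ≤ m := by
  have h1 : minGens I < m + 1 := h.trans_lt (ENat.lt_add_one_iff hm |>.mpr le_rfl)
  rw [minGens, iInf_lt_iff] at h1
  obtain ⟨s, hs⟩ := h1
  rw [iInf_lt_iff] at hs
  obtain ⟨hs, hlt⟩ := hs
  exact ⟨s, hs, (ENat.lt_add_one_iff hm).mp hlt⟩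

/-- An irreducible element of a Noetherian factorial domain cannot divide all the generators of an
ideal of height at least two. -/
theorem exists_not_dvd_of_two_le_idealHeight {R : Type} [CommRing R] [IsDomain R]
    [IsNoetherianRing R] [UniqueFactorizationMonoid R] {ι : Type*} {f : ι → R}
    (h : 2 ≤ idealHeight (Ideal.span (Set.range f))) {π : R} (hπ : Irreducible π) :
    ∃ i, ¬ π ∣ f i := by
  by_contra! hcon
  have hp : (Ideal.span {π}).IsPrime :=
    (Ideal.span_singleton_prime hπ.ne_zero).mpr (UniqueFactorizationMonoid.irreducible_iff_prime.mp hπ)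
  have h1 := le_height_of_le_idealHeight h ⟨_, hp⟩ (by
    rw [Ideal.span_le]
    rintro _ ⟨i, rfl⟩
    exact Ideal.mem_span_singleton.mpr (hcon i))
  have h2 := Ideal.height_le_one_of_isPrincipal_of_mem_minimalPrimes (Ideal.span {π}) (Ideal.span {π})
    (by rw [Ideal.minimalPrimes_eq_subsingleton_self]; rfl)
  rw [PrimeSpectrum.height_eq_orderHeight ⟨_, hp⟩] at h2
  have h3 : (2 : ℕ∞) ≤ 1 := h1.trans h2
  exact absurd h3 (by decide)

end HeightAndGenerators

section

variable {d : ℕ} (k : Type) [Field k]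

/-- **Projective degrees for Gorenstein ideals of height three** (Theorem 5.7 / Theorem C).
Suppose `I = (f₀,…,f_n)` is a Gorenstein ideal of height three with Buchsbaum–Eisenbud
resolution `0 → R(−2δ−D) → R(−δ−D)^{n+1} →^φ R(−δ)^{n+1} → I → 0`, where `φ` is an
alternating matrix all of whose nonzero entries are homogeneous of degree `D ≥ 1`, and `I`
satisfies `G_{d+1}`.  Then `d_i(F) = D^{d-i}·∑_{k=0}^{⌊(n-d+i)/2⌋} C(n-1-2k, d-i-1)` for
`0 ≤ i ≤ d−3`, and `d_i(F) = δ^{d-i}` for `d−2 ≤ i ≤ d`. -/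
theorem projDeg_gorenstein_height_three
    {n : ℕ} (hdn : d ≤ n) (δ : ℕ) (hδ : 0 < δ)
    (f : Fin (n + 1) → MvPolynomial (Fin (d + 1)) k)
    (hf : ∀ j, f j ≠ 0 ∧ (f j).IsHomogeneous δ)
    (P : MvPolynomial (Fin 2) ℚ)
    (hP : IsBigradedHilbPoly (reesHilbFn k δ f) P)
    (hPdeg : P.totalDegree = d)
    (hht : idealHeight (Ideal.span (Set.range f)) = (3 : ℕ∞))
    (D : ℕ) (hD : 1 ≤ D)
    (φ : Matrix (Fin (n + 1)) (Fin (n + 1)) (MvPolynomial (Fin (d + 1)) k))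
    (hφalt : φ.transpose = -φ ∧ ∀ a, φ a a = 0)
    (hφdeg : ∀ a b, φ a b ≠ 0 → (φ a b).IsHomogeneous D)
    (w : Fin (n + 1) → MvPolynomial (Fin (d + 1)) k)
    (hwdeg : ∀ a, (w a).IsHomogeneous δ)
    (hwinj : ∀ x : MvPolynomial (Fin (d + 1)) k, x • w = 0 → x = 0)
    (hker1 : ∀ v : Fin (n + 1) → MvPolynomial (Fin (d + 1)) k,
      φ.mulVec v = 0 ↔ ∃ x : MvPolynomial (Fin (d + 1)) k, x • w = v)
    (hker2 : ∀ v : Fin (n + 1) → MvPolynomial (Fin (d + 1)) k,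
      (∑ j, v j * f j = 0) ↔ ∃ u : Fin (n + 1) → MvPolynomial (Fin (d + 1)) k, φ.mulVec u = v)
    (hG : CondG (d + 1) (Ideal.span (Set.range f))) :
    (∀ i : ℕ, i + 3 ≤ d →
      projDeg d P i = (D : ℚ) ^ (d - i) *
        ∑ m ∈ Finset.range ((n - d + i) / 2 + 1), ((n - 1 - 2 * m).choose (d - i - 1) : ℚ)) ∧
    (∀ i : ℕ, d ≤ i + 2 → i ≤ d → projDeg d P i = (δ : ℚ) ^ (d - i)) := by
  obtain ⟨j₀, q₀, hPq⟩ := hP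
  have hfh : ∀ a, (f a).IsHomogeneous δ := fun a => (hf a).2
  have hφdeg' : ∀ a b, (φ a b).IsHomogeneous D := by
    intro a b
    rcases eq_or_ne (φ a b) 0 with h | h
    · rw [h]
      exact MvPolynomial.isHomogeneous_zero _ _ _
    · exact hφdeg a b h
  have h0 := factorial_mul_coeff_eq_one 0 (hf 0).1 (hf 0).2 hPdeg.le
    (fun j hj => hPq j q₀ hj le_rfl)
  have hproj : ∀ i ≤ d, projDeg d P i =
      (d - (d - i)).factorial * (d - i).factorial * P.coeff (expo (d - (d - i)) (d - i)) := by
    intro i hi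
    rw [Nat.sub_sub_self hi]
    rfl
  rcases Nat.eq_zero_or_pos d with rfl | hd
  · refine ⟨fun i hi => absurd hi (by omega), fun i _ hi => ?_⟩
    obtain rfl : i = 0 := by omega
    rw [hproj 0 le_rfl]
    simpa using h0
  have hfP : (fun g => (qdim ((RingHom.ker (reesMap f)).restrictScalars k) (biPiece k d n g) : ℚ))
      =ᶠ[bigBideg] bieval P := by
    refine eventually_bigBideg.mpr ⟨max j₀ q₀, fun j q hj hq => ?_⟩
    lift j to ℕ using by omega
    lift q to ℕ using by omega
    have h1 := hPq j q (by omega) (by omega)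
    have h2 : bieval P (toLex ((j : ℤ), (q : ℤ))) =
        MvPolynomial.eval ![(j : ℚ), (q : ℚ)] P := by
      simp [bieval, Bideg.fst, Bideg.snd]
    rw [h2, h1]
    exact congrArg Nat.cast (qdim_ker_reesMap hfh j q)
  obtain ⟨c, hc⟩ := exists_mul_leading_coeff_eq hfh
    (fun p hp => le_height_of_le_idealHeight
      (show (1 : ℕ∞) ≤ _ by rw [hht]; decide) p hp)
    (fun p hp hlt => exists_card_le_of_minGens_le hlt.ne_top (hG p hp hlt))
    hφalt.1 hφalt.2 hφdeg' (fun v hv => (hker2 v).mp hv) hPdeg.le hfP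
  obtain ⟨hn, hcoeff⟩ := even_and_leading_coeff_eq hc hd (le_trans hd hdn) hD h0
  have hδD : 2 * δ = n * D := by
    refine two_mul_degree_eq hφalt.1 ⟨0, (hf 0).1⟩ hφdeg' hwdeg ?_
      ((hker1 w).mpr ⟨1, one_smul _ w⟩) (fun u => (hker2 _).mpr ⟨u, rfl⟩)
      (fun v hv => (hker1 v).mp hv) (fun v hv => (hker2 v).mp hv)
      (fun π hπ => exists_not_dvd_of_two_le_idealHeight (by rw [hht]; decide) hπ)
    by_contra! hcon
    refine one_ne_zero (hwinj 1 ?_)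
    rw [one_smul]
    exact funext hcon
  obtain ⟨r, hr⟩ := hn
  rw [← two_mul] at hr
  have hδr : δ = D * r := by
    rw [hr, mul_assoc] at hδD
    rw [mul_comm D]
    exact Nat.eq_of_mul_eq_mul_left two_pos hδD
  have hd' : ∀ i ≤ d, projDeg d P i = (D : ℚ) ^ (d - i) * altChoose (d - i) n := fun i hi => by
    rw [hproj i hi, hcoeff _ (Nat.sub_le d i)]
  refine ⟨fun i hi => ?_, fun i hi hid => ?_⟩
  · rw [hd' i (by omega), altChoose_eq_sum_of_even (by omega) (by omega) ⟨r, by omega⟩,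
      show n - (d - i) = n - d + i by omega]
  · rw [hd' i hid, hδr, hr]
    push_cast
    rw [mul_pow]
    congr 1
    obtain h | h | h : d - i = 0 ∨ d - i = 1 ∨ d - i = 2 := by omega
    · rw [h, altChoose_zero, if_pos (even_two_mul r), pow_zero]
    · rw [h, altChoose_one, pow_one, show (2 * r + 1) / 2 = r by omega]
    · rw [h, altChoose_two]

end
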